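/- arXiv:1802.04726 — 3 statements merged into one kernel-verified Lean document; each statement's English description precedes it below -/
import Mathlib

section
/- Let $u$ be a subharmonic function in a domain $\Omega \subseteq \mathbb{R}^n$ ($n \geq 2$), let $K$ be a Borel subset of $\Omega$ and let $x_0 \in K$. Let $h : (0,\infty) \to (0,\infty)$ be a function for which there exist real numbers $M > 0$ and $c > 4$ such that $\int_0^{c\epsilon} h(r)/r^{n-1}\, dr \leq M\, h(\epsilon)/\epsilon^{n-2}$ for all sufficiently small $\epsilon > 0$. Suppose there exist a positive Borel measure $\mu$ on $\mathbb{R}^n$ and real numbers $A, B > 0$, $\epsilon_0 > 0$ such that (1) $\mu(K \cap \mathbb{B}(x_0,\epsilon)) \geq A\, h(\epsilon)$ for all $\epsilon < \epsilon_0$, and (2) $\mu(K \cap \mathbb{B}(x,\epsilon)) \leq B\, h(\epsilon)$ for all $x \in K$ and all $\epsilon < \epsilon_0$. Then $\lim_{\epsilon \to 0} \frac{1}{\mu(K \cap \mathbb{B}(x_0,\epsilon))} \int_{K \cap \mathbb{B}(x_0,\epsilon)} u(x)\, d\mu(x) = u(x_0)$. -/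
open MeasureTheory Metric Filter Set ENNReal Topology

noncomputable section

/-- Euclidean space `ℝⁿ`. -/
abbrev Eucl (n : ℕ) := EuclideanSpace ℝ (Fin n)

/-- The Laplacian of a real-valued function on `ℝⁿ`, as the sum of second partial
derivatives in the coordinate directions. -/
noncomputable def lap {n : ℕ} (f : Eucl n → ℝ) (x : Eucl n) : ℝ :=
  ∑ i : Fin n, fderiv ℝ (fun y => fderiv ℝ f y (EuclideanSpace.single i 1)) x
    (EuclideanSpace.single i 1)

/-- `f` is harmonic on a set `G`: it is `C²` there and its Laplacian vanishes. -/
def IsHarmonicOn {n : ℕ} (f : Eucl n → ℝ) (G : Set (Eucl n)) : Prop :=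
  ContDiffOn ℝ 2 f G ∧ ∀ x ∈ G, lap f x = 0

/-- `u : Ω → [-∞, ∞)` is subharmonic on `Ω`: it is upper semicontinuous, takes values
in `[-∞, ∞)`, is not identically `-∞`, and for every relatively compact open subset `G`
of `Ω` and every `φ` harmonic on `G` and continuous on `closure G`, `u ≤ φ` on `∂G`
implies `u ≤ φ` on `G`. -/
def IsSubharmonicOn {n : ℕ} (u : Eucl n → EReal) (Ω : Set (Eucl n)) : Prop :=
  UpperSemicontinuousOn u Ω ∧ (∀ x ∈ Ω, u x < ⊤) ∧ (∃ x ∈ Ω, u x ≠ ⊥) ∧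
  ∀ G : Set (Eucl n), IsOpen G → IsCompact (closure G) → closure G ⊆ Ω →
    ∀ φ : Eucl n → ℝ, IsHarmonicOn φ G → ContinuousOn φ (closure G) →
      (∀ x ∈ frontier G, u x ≤ (φ x : EReal)) → ∀ x ∈ G, u x ≤ (φ x : EReal)

/-- The positive part of an extended real number, as a value in `ℝ≥0∞`. -/
noncomputable def EReal.posPart (a : EReal) : ℝ≥0∞ :=
  if a = ⊤ then ⊤ else ENNReal.ofReal a.toReal

/-- The integral `∫_S u dμ` of an `EReal`-valued function, with values in `[-∞, +∞]`. -/
noncomputable def eintegral {n : ℕ} (μ : Measure (Eucl n)) (S : Set (Eucl n))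
    (u : Eucl n → EReal) : EReal :=
  ((∫⁻ x in S, (u x).posPart ∂μ : ℝ≥0∞) : EReal) -
    ((∫⁻ x in S, (-(u x)).posPart ∂μ : ℝ≥0∞) : EReal)

/-- The `μ`-average `(1/μ(S)) ∫_S u dμ` of an `EReal`-valued function over `S`. -/
noncomputable def eavg {n : ℕ} (μ : Measure (Eucl n)) (S : Set (Eucl n))
    (u : Eucl n → EReal) : EReal :=
  (((μ S)⁻¹ : ℝ≥0∞) : EReal) * eintegral μ S u

/-- The radial kernel `∫_t^T r^{1-n} dr`. -/
def kk (n : ℕ) (T t : ℝ) : ℝ := ∫ r in t..T, (r ^ (n - 1))⁻¹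

theorem kk_ii (n : ℕ) {a b : ℝ} (ha : 0 < a) (hb : 0 < b) :
    IntervalIntegrable (fun r : ℝ => (r ^ (n - 1))⁻¹) volume a b := by
  apply ContinuousOn.intervalIntegrable
  intro x hx
  have : 0 < x := lt_of_lt_of_le (lt_min ha hb) hx.1
  exact ContinuousAt.continuousWithinAt (by fun_prop (disch := positivity))

theorem kk_self (n : ℕ) (T : ℝ) : kk n T T = 0 := by simp [kk]

theorem kk_split (n : ℕ) {T s t : ℝ} (hT : 0 < T) (hs : 0 < s) (ht : 0 < t) :
    kk n T s = (∫ r in s..t, (r ^ (n - 1))⁻¹) + kk n T t :=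
  (intervalIntegral.integral_add_adjacent_intervals (kk_ii n hs ht) (kk_ii n ht hT)).symm

theorem kk_le_int (n : ℕ) {s t : ℝ} (hs : 0 < s) (hst : s ≤ t) :
    (t - s) * (t ^ (n - 1))⁻¹ ≤ ∫ r in s..t, (r ^ (n - 1))⁻¹ := by
  have ht : 0 < t := hs.trans_le hst
  have := intervalIntegral.integral_mono_on (μ := volume) (f := fun _ => (t ^ (n - 1))⁻¹) hst
    (by simp) (kk_ii n hs ht) (fun r hr => by
      have : 0 < r := hs.trans_le hr.1
      exact inv_anti₀ (by positivity) (pow_le_pow_left₀ this.le hr.2 _))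
  simpa using this

theorem kk_int_le (n : ℕ) {s t : ℝ} (hs : 0 < s) (hst : s ≤ t) :
    (∫ r in s..t, (r ^ (n - 1))⁻¹) ≤ (t - s) * (s ^ (n - 1))⁻¹ := by
  have ht : 0 < t := hs.trans_le hst
  have := intervalIntegral.integral_mono_on (μ := volume) (g := fun _ => (s ^ (n - 1))⁻¹) hst
    (kk_ii n hs ht) (by simp) (fun r hr => by
      have : 0 < r := hs.trans_le hr.1
      exact inv_anti₀ (by positivity) (pow_le_pow_left₀ hs.le hr.1 _))
  simpa using this

theorem kk_anti (n : ℕ) {T s t : ℝ} (hT : 0 < T) (hs : 0 < s) (hst : s ≤ t) :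
    kk n T t ≤ kk n T s := by
  have ht : 0 < t := hs.trans_le hst
  rw [kk_split n hT hs ht]
  have := kk_le_int n hs hst
  have h2 : 0 ≤ (t - s) * (t ^ (n - 1))⁻¹ := mul_nonneg (by linarith) (by positivity)
  linarith

theorem kk_pos (n : ℕ) {T t : ℝ} (ht : 0 < t) (htT : t < T) : 0 < kk n T t := by
  have := kk_le_int n ht htT.le
  have h2 : 0 < (T - t) * (T ^ (n - 1))⁻¹ :=
    mul_pos (by linarith) (by have := ht.trans htT; positivity)
  exact h2.trans_le this

theorem kk_double (n : ℕ) {T t : ℝ} (ht : 0 < t) (htT : 4 * t ≤ T) :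
    kk n T t ≤ (1 + 4 ^ (n - 1)) * kk n T (2 * t) := by
  have hT : 0 < T := by linarith
  have h1 := kk_split n hT ht (by positivity : 0 < 2 * t)
  have h2 := kk_split n hT (by positivity : 0 < 2 * t) (by positivity : 0 < 4 * t)
  have h3 := kk_int_le n ht (by linarith : t ≤ 2 * t)
  have h4 := kk_le_int n (by positivity : 0 < 2 * t) (by linarith : 2 * t ≤ 4 * t)
  have h5 : 0 ≤ kk n T (4 * t) := by
    rw [← kk_self n T]; exact kk_anti n hT (by positivity) htT
  have h6 : (2 * t - t) * (t ^ (n - 1))⁻¹ ≤ 4 ^ (n - 1) * ((4 * t - 2 * t) * ((4 * t) ^ (n - 1))⁻¹) := by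
    rw [mul_pow]
    have : (4 : ℝ) ^ (n - 1) * ((4 * t - 2 * t) * (4 ^ (n - 1) * t ^ (n - 1))⁻¹)
      = 2 * t * (t ^ (n - 1))⁻¹ := by field_simp; ring
    rw [this]
    have : 0 < (t ^ (n - 1))⁻¹ := by positivity
    nlinarith [mul_pos ht this]
  have h7 : (4 : ℝ) ^ (n - 1) * ((4 * t - 2 * t) * ((4 * t) ^ (n - 1))⁻¹)
      ≤ 4 ^ (n - 1) * kk n T (2 * t) := by
    apply mul_le_mul_of_nonneg_left _ (by positivity)
    linarith
  linarith

theorem kk_lower {n : ℕ} (hn : 2 ≤ n) {T e : ℝ} (he : 0 < e) (hT : 2 * e ≤ T) :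
    1 / e ^ (n - 2) ≤ 2 ^ (n - 1) * kk n T e := by
  have hT0 : 0 < T := by linarith
  have h1 := kk_split n hT0 he (by positivity : 0 < 2 * e)
  have h2 := kk_le_int n he (by linarith : e ≤ 2 * e)
  have h3 : 0 ≤ kk n T (2 * e) := by
    rw [← kk_self n T]; exact kk_anti n hT0 (by positivity) hT
  have h4 : 1 / e ^ (n - 2) = 2 ^ (n - 1) * ((2 * e - e) * ((2 * e) ^ (n - 1))⁻¹) := by
    obtain ⟨m, rfl⟩ := Nat.exists_eq_add_of_le' hn
    have e1 : m + 2 - 1 = m + 1 := by omega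
    have e2 : m + 2 - 2 = m := by omega
    rw [e1, e2, mul_pow]
    field_simp
    ring
  rw [h4]
  apply mul_le_mul_of_nonneg_left _ (by positivity)
  linarith

theorem kk_hasDerivAt (n : ℕ) {T t : ℝ} (hT : 0 < T) (ht : 0 < t) :
    HasDerivAt (kk n T) (-(t ^ (n - 1))⁻¹) t := by
  refine intervalIntegral.integral_hasDerivAt_left (kk_ii n ht hT) ?_ ?_
  · refine ⟨univ, univ_mem, ?_⟩
    exact Measurable.aestronglyMeasurable (by fun_prop)
  · fun_prop (disch := positivity)

theorem norm_sub_hasFDerivAt {n : ℕ} {y z : Eucl n} (h : y ≠ z) :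
    HasFDerivAt (fun y : Eucl n => ‖y - z‖) (‖y - z‖⁻¹ • innerSL ℝ (y - z)) y := by
  have h0 : 0 < ‖y - z‖ := norm_pos_iff.2 (sub_ne_zero.2 h)
  have h1 : HasFDerivAt (fun y : Eucl n => ‖y - z‖ ^ 2) (2 • innerSL ℝ (y - z)) y := by
    have := ((hasFDerivAt_id y).sub_const z).norm_sq
    exact this.congr_fderiv (by ext v; simp)
  have h2 := h1.sqrt (by positivity)
  simp only [Real.sqrt_sq (norm_nonneg _)] at h2
  refine h2.congr_fderiv ?_
  ext v
  simp
  field_simp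

theorem harm_of_fderiv {n : ℕ} {G : Set (Eucl n)} (hG : IsOpen G) (hn : 2 ≤ n) {ι : Type*} (s : Finset ι)
    (c : ι → ℝ) (z : ι → Eucl n) (hz : ∀ i ∈ s, z i ∉ G) (φ : Eucl n → ℝ)
    (hφ : ∀ y ∈ G, HasFDerivAt φ
      (∑ i ∈ s, c i • ((‖y - z i‖ ^ n)⁻¹ • innerSL ℝ (y - z i))) y) :
    IsHarmonicOn φ G := by
  have hne : ∀ i ∈ s, ∀ y ∈ G, y ≠ z i := fun i hi y hy h => hz i hi (h ▸ hy)
  constructor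
  · have : (2 : WithTop ℕ∞) = 1 + 1 := by norm_num
    rw [this, contDiffOn_succ_iff_fderiv_of_isOpen hG]
    refine ⟨fun y hy => (hφ y hy).differentiableAt.differentiableWithinAt, by simp, ?_⟩
    refine ContDiffOn.congr ?_ (fun y hy => (hφ y hy).fderiv)
    refine ContDiffOn.sum fun i hi => ?_
    intro y hy
    have h0 : y - z i ≠ 0 := sub_ne_zero.2 (hne i hi y hy)
    have h1 : ContDiffAt ℝ 1 (fun y : Eucl n => ‖y - z i‖) y :=
      (contDiffAt_id.sub contDiffAt_const).norm ℝ h0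
    have h2 : ContDiffAt ℝ 1 (fun y : Eucl n => innerSL ℝ (y - z i)) y :=
      (innerSL ℝ).contDiff.contDiffAt.comp y (contDiffAt_id.sub contDiffAt_const)
    have h3 : ‖y - z i‖ ^ n ≠ 0 := pow_ne_zero _ (norm_ne_zero_iff.2 h0)
    have h4 : ContDiffAt ℝ 1 (fun y : Eucl n => (‖y - z i‖ ^ n)⁻¹ • innerSL ℝ (y - z i)) y :=
      ((h1.pow n).inv h3).smul h2
    exact (h4.const_smul (c i)).contDiffWithinAt
  · intro x hx
    have key : ∀ j : Fin n, fderiv ℝ (fun y => fderiv ℝ φ y (EuclideanSpace.single j 1)) x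
        (EuclideanSpace.single j 1) = ∑ i ∈ s, c i * ((‖x - z i‖ ^ n)⁻¹
          - n * (‖x - z i‖ ^ (n + 2))⁻¹ * ((x - z i) j) ^ 2) := by
      intro j
      have e1 : (fun y => fderiv ℝ φ y (EuclideanSpace.single j 1)) =ᶠ[𝓝 x]
          fun y => ∑ i ∈ s, c i * ((‖y - z i‖ ^ n)⁻¹ * (innerSL ℝ (EuclideanSpace.single j (1:ℝ)) (y - z i))) := by
        filter_upwards [hG.mem_nhds hx] with y hy
        rw [(hφ y hy).fderiv]
        simp [EuclideanSpace.inner_single_right,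
          EuclideanSpace.inner_single_left]
      rw [e1.fderiv_eq]
      have e2 : HasFDerivAt (fun y => ∑ i ∈ s, c i * ((‖y - z i‖ ^ n)⁻¹ *
          (innerSL ℝ (EuclideanSpace.single j (1:ℝ)) (y - z i))))
          (∑ i ∈ s, c i • ((‖x - z i‖ ^ n)⁻¹ • (innerSL ℝ (EuclideanSpace.single j (1:ℝ)))
            + (innerSL ℝ (EuclideanSpace.single j (1:ℝ)) (x - z i)) •
              (-((‖x - z i‖ ^ n) ^ 2)⁻¹ * (n * ‖x - z i‖ ^ (n - 1))) • (‖x - z i‖⁻¹ • innerSL ℝ (x - z i)))) x := by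
        refine HasFDerivAt.fun_sum fun i hi => ?_
        have h0 : x - z i ≠ 0 := sub_ne_zero.2 (hne i hi x hx)
        have h3 : ‖x - z i‖ ≠ 0 := (norm_ne_zero_iff.2 h0)
        have d1 : HasDerivAt (fun t : ℝ => (t ^ n)⁻¹)
          (-((‖x - z i‖ ^ n) ^ 2)⁻¹ * (n * ‖x - z i‖ ^ (n - 1))) ‖x - z i‖ := by
          have := (hasDerivAt_pow n ‖x - z i‖).inv (pow_ne_zero _ h3)
          exact this.congr_deriv (by rw [div_eq_mul_inv]; ring)
        have d2 := d1.comp_hasFDerivAt x (norm_sub_hasFDerivAt (hne i hi x hx))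
        have d3 : HasFDerivAt (fun y : Eucl n => innerSL ℝ (EuclideanSpace.single j (1:ℝ)) (y - z i))
          (innerSL ℝ (EuclideanSpace.single j (1:ℝ))) x := by
          have := (innerSL ℝ (EuclideanSpace.single j (1:ℝ)) : Eucl n →L[ℝ] ℝ).hasFDerivAt.comp x
            ((hasFDerivAt_id x).sub_const (z i))
          exact this
        exact (d2.mul d3).const_mul (c i)
      rw [e2.fderiv]
      simp only [sum_apply]
      refine Finset.sum_congr rfl fun i hi => ?_
      have h0 : x - z i ≠ 0 := sub_ne_zero.2 (hne i hi x hx)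
      have h3 : ‖x - z i‖ ≠ 0 := (norm_ne_zero_iff.2 h0)
      obtain ⟨m, rfl⟩ := Nat.exists_eq_add_of_le' hn
      have e1 : m + 2 - 1 = m + 1 := by omega
      simp [EuclideanSpace.inner_single_right, EuclideanSpace.inner_single_left]
      field_simp
      ring
    unfold lap
    simp_rw [key]
    rw [Finset.sum_comm]
    refine Finset.sum_eq_zero fun i hi => ?_
    rw [← Finset.mul_sum, Finset.sum_sub_distrib, ← Finset.mul_sum, ← EuclideanSpace.real_norm_sq_eq]
    have h0 : x - z i ≠ 0 := sub_ne_zero.2 (hne i hi x hx)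
    have h3 : ‖x - z i‖ ≠ 0 := (norm_ne_zero_iff.2 h0)
    simp
    right
    field_simp
    ring

theorem lcp {ι : Type*} [Fintype ι] (G : ι → ι → ℝ) (hsym : ∀ i j, G i j = G j i)
    (hG : ∀ i j, 0 < G i j) (a : ι → ℝ) (ha : ∀ i, 0 ≤ a i) :
    ∃ l : ι → ℝ, (∀ i, 0 ≤ l i) ∧ (∀ i, a i ≤ ∑ j, l j * G i j) ∧
      ∀ i, 0 < l i → ∑ j, l j * G i j = a i := by
  classical
  obtain ⟨L, hL0, hL⟩ : ∃ L : ℝ, 0 < L ∧ ∀ i, a i < L * G i i := by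
    refine ⟨1 + ∑ i, a i / G i i, ?_, ?_⟩
    · have : 0 ≤ ∑ i, a i / G i i := Finset.sum_nonneg fun i _ => div_nonneg (ha i) (hG i i).le
      linarith
    · intro i
      have : a i / G i i ≤ ∑ i, a i / G i i :=
        Finset.single_le_sum (f := fun i => a i / G i i)
          (fun i _ => div_nonneg (ha i) (hG i i).le) (Finset.mem_univ i)
      have h2 : a i / G i i < 1 + ∑ i, a i / G i i := by linarith
      rwa [div_lt_iff₀ (hG i i)] at h2
  let J : (ι → ℝ) → ℝ := fun l => (∑ i, ∑ j, l i * l j * G i j) / 2 - ∑ i, a i * l i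
  have hJ : Continuous J := by fun_prop
  obtain ⟨l, hl, hmin⟩ := (isCompact_Icc (a := (0 : ι → ℝ)) (b := fun _ => L)).exists_isMinOn
    ⟨0, by simp, fun i => hL0.le⟩ hJ.continuousOn
  have hexp : ∀ i s, J (l + Pi.single i s) = J l + s * ((∑ j, l j * G i j) - a i)
      + s ^ 2 * G i i / 2 := by
    intro i s
    have e1 : ∑ k, ∑ j, (l + Pi.single i s : ι → ℝ) k * (l + Pi.single i s : ι → ℝ) j * G k j
        = ∑ k, ∑ j, l k * l j * G k j + 2 * s * (∑ j, l j * G i j) + s ^ 2 * G i i := by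
      have : ∀ k j, (l + Pi.single i s : ι → ℝ) k * (l + Pi.single i s : ι → ℝ) j * G k j
        = l k * l j * G k j + (Pi.single i s : ι → ℝ) k * (l j * G k j)
          + (l k * G k j) * (Pi.single i s : ι → ℝ) j
          + (Pi.single i s : ι → ℝ) k * ((Pi.single i s : ι → ℝ) j * G k j) := by
        intro k j; simp only [Pi.add_apply]; ring
      simp_rw [this, Finset.sum_add_distrib]
      have h1 : ∑ k, ∑ j, (Pi.single i s : ι → ℝ) k * (l j * G k j) = s * ∑ j, l j * G i j := by
        simp_rw [← Finset.mul_sum]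
        simp [Pi.single_apply]
      have h2 : ∑ k, ∑ j, (l k * G k j) * (Pi.single i s : ι → ℝ) j = s * ∑ j, l j * G i j := by
        simp [Pi.single_apply, Finset.mul_sum]
        refine Finset.sum_congr rfl fun k _ => ?_
        rw [hsym k i]; ring
      have h3 : ∑ k, ∑ j, (Pi.single i s : ι → ℝ) k * ((Pi.single i s : ι → ℝ) j * G k j)
          = s ^ 2 * G i i := by
        simp [Pi.single_apply]; ring
      rw [h1, h2, h3]; ring
    have e2 : ∑ k, a k * (l + Pi.single i s : ι → ℝ) k = ∑ k, a k * l k + a i * s := by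
      simp [mul_add, Finset.sum_add_distrib, Pi.single_apply]
    simp only [J]
    rw [e1, e2]; ring
  have hstep : ∀ i s, 0 ≤ l i + s → l i + s ≤ L →
      0 ≤ s * ((∑ j, l j * G i j) - a i) + s ^ 2 * G i i / 2 := by
    intro i s h0 h1
    have hm : l + Pi.single i s ∈ Icc (0 : ι → ℝ) (fun _ => L) := by
      constructor
      · intro j
        by_cases hj : j = i
        · subst hj; simpa using h0
        · simpa [hj] using hl.1 j
      · intro j
        by_cases hj : j = i
        · subst hj; simpa using h1
        · simpa [hj] using hl.2 j
    have := hmin hm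
    simp only [mem_ofPred_eq] at this
    rw [hexp] at this
    linarith
  have hup : ∀ i, 0 < l i → (∑ j, l j * G i j) ≤ a i := by
    intro i hi
    by_contra! hcon
    set d := (∑ j, l j * G i j) - a i with hd
    have hd0 : 0 < d := by linarith
    have hg := hG i i
    set s := min (l i) (d / G i i) with hs
    have hs0 : 0 < s := lt_min hi (div_pos hd0 hg)
    have h1 : s ≤ l i := min_le_left _ _
    have h2 : s * G i i ≤ d := by
      rw [← le_div_iff₀ hg]; exact min_le_right _ _
    have h3 := hstep i (-s) (by linarith) (by linarith [hl.2 i])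
    nlinarith
  have hlt : ∀ i, l i < L := by
    intro i
    by_contra! hcon
    have h1 : l i = L := le_antisymm (hl.2 i) hcon
    have h2 := hup i (by rw [h1]; exact hL0)
    have h3 : l i * G i i ≤ ∑ j, l j * G i j :=
      Finset.single_le_sum (f := fun j => l j * G i j)
        (fun j _ => mul_nonneg (hl.1 j) (hG i j).le) (Finset.mem_univ i)
    rw [h1] at h3
    linarith [hL i]
  have hlow : ∀ i, a i ≤ ∑ j, l j * G i j := by
    intro i
    by_contra! hcon
    set d := a i - (∑ j, l j * G i j) with hd
    have hd0 : 0 < d := by linarith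
    have hg := hG i i
    set s := min (L - l i) (d / G i i) with hs
    have hs0 : 0 < s := lt_min (by linarith [hlt i]) (div_pos hd0 hg)
    have h1 : s ≤ L - l i := min_le_left _ _
    have h2 : s * G i i ≤ d := by
      rw [← le_div_iff₀ hg]; exact min_le_right _ _
    have h4 : 0 ≤ l i := hl.1 i
    have h3 := hstep i s (by linarith) (by linarith)
    nlinarith
  exact ⟨l, fun i => hl.1 i, hlow, fun i hi => le_antisymm (hup i hi) (hlow i)⟩

/-- The comparison constant. -/
def C1 (n : ℕ) : ℝ := 1 + 4 ^ (n - 1)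

theorem C1_pos (n : ℕ) : 0 < C1 n := by unfold C1; positivity

theorem gk_compare (n : ℕ) {T d : ℝ} (hd : 0 < d) {y y' z : Eucl n} (hy : ‖y' - y‖ ≤ d)
    (hT : 4 * max ‖y - z‖ d ≤ T) :
    kk n T (max ‖y - z‖ d) ≤ C1 n * kk n T (max ‖y' - z‖ d) := by
  have h0 : 0 < max ‖y - z‖ d := lt_max_of_lt_right hd
  have hTp : 0 < T := by linarith
  refine (kk_double n h0 hT).trans ?_
  refine mul_le_mul_of_nonneg_left (kk_anti n hTp (lt_max_of_lt_right hd) ?_) (C1_pos n).le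
  have h1 : ‖y' - z‖ ≤ ‖y' - y‖ + ‖y - z‖ := by
    have := norm_add_le (y' - y) (y - z); simpa using this
  have h2 := le_max_left ‖y - z‖ d
  have h3 := le_max_right ‖y - z‖ d
  exact max_le (by linarith) (by linarith)

theorem compare {n : ℕ} (hn : 2 ≤ n) {Ω : Set (Eucl n)} {u : Eucl n → EReal}
    (hu : IsSubharmonicOn u Ω) {x₀ : Eucl n} {e d : ℝ} (hd : 0 < d) (hde : d ≤ e)
    (hB : closedBall x₀ (17 * e) ⊆ Ω) (a : ℝ) (ha : ∀ y ∈ closedBall x₀ (17 * e), u y ≤ (a : EReal))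
    {ι : Type*} [Fintype ι] (z : ι → Eucl n) (hz : ∀ i, z i ∈ ball x₀ e) (b l : ι → ℝ)
    (hb : ∀ i, ∀ y ∈ closedBall (z i) d, u y ≤ ((a - b i : ℝ) : EReal))
    (hl : ∀ i, 0 ≤ l i)
    (hlb : ∀ i, 0 < l i → ∑ j, l j * kk n (16 * e) (max ‖z i - z j‖ d) = b i) :
    u x₀ ≤ ((a - (∑ j, l j * kk n (16 * e) (max ‖x₀ - z j‖ d)) / C1 n : ℝ) : EReal) := by
  classical
  have he : 0 < e := hd.trans_le hde
  have hC := C1_pos n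
  set w : Eucl n → ℝ := fun y => ∑ j, l j * kk n (16 * e) (max ‖y - z j‖ d) with hw
  -- on the small balls
  have hsmall : ∀ i, 0 < l i → ∀ y ∈ closedBall (z i) d, u y ≤ ((a - w y / C1 n : ℝ) : EReal) := by
    intro i hi y hy
    refine (hb i y hy).trans ?_
    rw [EReal.coe_le_coe_iff, ← hlb i hi]
    have : w y ≤ C1 n * ∑ j, l j * kk n (16 * e) (max ‖z i - z j‖ d) := by
      rw [Finset.mul_sum]
      refine Finset.sum_le_sum fun j _ => ?_
      rw [mul_left_comm]
      refine mul_le_mul_of_nonneg_left ?_ (hl j)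
      rw [mem_closedBall, dist_eq_norm] at hy
      refine gk_compare n hd (by rwa [norm_sub_rev]) ?_
      have h1 := hz i
      have h2 := hz j
      rw [mem_ball, dist_eq_norm] at h1 h2
      have h3 : ‖y - z j‖ ≤ ‖y - z i‖ + ‖z i - x₀‖ + ‖z j - x₀‖ := by
        have := norm_sub_le (y - z i + (z i - x₀)) (z j - x₀)
        have h4 := norm_add_le (y - z i) (z i - x₀)
        have h5 : y - z i + (z i - x₀) - (z j - x₀) = y - z j := by abel
        rw [h5] at this
        linarith
      have : max ‖y - z j‖ d ≤ 4 * e := max_le (by linarith) (by linarith)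
      linarith
    have h2 : w y / C1 n ≤ ∑ j, l j * kk n (16 * e) (max ‖z i - z j‖ d) := by
      rw [div_le_iff₀ hC]; linarith
    linarith
  set s : Finset ι := Finset.univ.filter fun i => 0 < l i with hs
  by_cases hx : ∃ i, 0 < l i ∧ x₀ ∈ closedBall (z i) d
  · obtain ⟨i, hi, hxi⟩ := hx
    exact hsmall i hi x₀ hxi
  set G : Set (Eucl n) := ball x₀ (17 * e) ∩ (⋃ i ∈ s, closedBall (z i) d)ᶜ with hG
  have hGo : IsOpen G := by
    refine isOpen_ball.inter ?_
    rw [isOpen_compl_iff]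
    exact Set.Finite.isClosed_biUnion (Finset.finite_toSet s) fun i _ => isClosed_closedBall
  have hcl : closure G ⊆ closedBall x₀ (17 * e) :=
    (closure_mono inter_subset_left).trans closure_ball_subset_closedBall
  have hxG : x₀ ∈ G := by
    refine ⟨mem_ball_self (by positivity), ?_⟩
    simp only [mem_compl_iff, mem_iUnion, not_exists]
    intro i hi hxi
    exact hx ⟨i, by simpa [hs] using hi, hxi⟩
  have hcont : Continuous w := by
    refine continuous_finsetSum _ fun j _ => continuous_const.mul ?_
    rw [continuous_iff_continuousAt]
    intro y
    have h0 : 0 < max ‖y - z j‖ d := lt_max_of_lt_right hd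
    exact ContinuousAt.comp (g := kk n (16 * e)) (f := fun y => max ‖y - z j‖ d)
      (kk_hasDerivAt n (by positivity) h0).continuousAt (by fun_prop)
  refine hu.2.2.2 G hGo (IsCompact.of_isClosed_subset (isCompact_closedBall _ _) isClosed_closure hcl)
    (hcl.trans hB) (fun y => a - w y / C1 n) ?_ (by fun_prop) ?_ x₀ hxG
  · refine harm_of_fderiv hGo hn s (fun i => l i / C1 n) z ?_ _ ?_
    · intro i hi hzi
      exact hzi.2 (mem_iUnion₂.2 ⟨i, hi, mem_closedBall_self hd.le⟩)
    · intro y hy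
      have hterm : ∀ i ∈ s, HasFDerivAt (fun y => kk n (16 * e) (max ‖y - z i‖ d))
          (-((‖y - z i‖ ^ n)⁻¹ • innerSL ℝ (y - z i))) y := by
        intro i hi
        have hyi : d < ‖y - z i‖ := by
          by_contra! hcon
          exact hy.2 (mem_iUnion₂.2 ⟨i, hi, by rwa [mem_closedBall, dist_eq_norm]⟩)
        have h0 : 0 < ‖y - z i‖ := hd.trans hyi
        have hne : y ≠ z i := sub_ne_zero.1 (norm_pos_iff.1 h0)
        have h1 := (kk_hasDerivAt n (T := 16 * e) (by positivity) h0).comp_hasFDerivAt y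
          (norm_sub_hasFDerivAt hne)
        have h2 : (fun y => kk n (16 * e) (max ‖y - z i‖ d)) =ᶠ[𝓝 y]
            (kk n (16 * e)) ∘ fun y => ‖y - z i‖ := by
          have : ∀ᶠ y' in 𝓝 y, d < ‖y' - z i‖ :=
            (by fun_prop : Continuous fun y' : Eucl n => ‖y' - z i‖).continuousAt.eventually
              (lt_mem_nhds hyi)
          filter_upwards [this] with y' hy'
          simp [max_eq_left hy'.le]
        refine (h1.congr_of_eventuallyEq h2).congr_fderiv ?_
        obtain ⟨m, rfl⟩ := Nat.exists_eq_add_of_le' hn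
        have e1 : m + 2 - 1 = m + 1 := by omega
        ext v
        simp
        field_simp
        ring
      have hwe : ∀ y, w y = ∑ i ∈ s, l i * kk n (16 * e) (max ‖y - z i‖ d) := by
        intro y
        refine (Finset.sum_subset (Finset.subset_univ s) fun i _ hi => ?_).symm
        have : l i = 0 := le_antisymm (by simpa [hs] using hi) (hl i)
        simp [this]
      simp_rw [hwe]
      have := ((HasFDerivAt.fun_sum fun i hi => (hterm i hi).const_mul (l i)).mul_const (C1 n)⁻¹).const_sub a
      simp_rw [div_eq_mul_inv]
      refine this.congr_fderiv ?_
      ext v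
      simp [Finset.mul_sum]
      refine Finset.sum_congr rfl fun i _ => ?_
      ring
  · intro y hy
    rw [hGo.frontier_eq] at hy
    have hyc := hcl hy.1
    by_cases hyb : y ∈ ball x₀ (17 * e)
    · have : y ∈ ⋃ i ∈ s, closedBall (z i) d := by
        by_contra hcon
        exact hy.2 ⟨hyb, hcon⟩
      obtain ⟨i, hi, hyi⟩ := mem_iUnion₂.1 this
      exact hsmall i (by simpa [hs] using hi) y hyi
    · refine (ha y hyc).trans ?_
      rw [EReal.coe_le_coe_iff]
      have : w y ≤ 0 := by
        refine Finset.sum_nonpos fun j _ => mul_nonpos_of_nonneg_of_nonpos (hl j) ?_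
        rw [← kk_self n (16 * e)]
        refine kk_anti n (by positivity) (by positivity) (le_max_of_le_left ?_)
        have h1 := hz j
        rw [mem_ball, dist_eq_norm, not_lt] at hyb
        rw [mem_ball, dist_eq_norm] at h1
        have h2 : ‖y - x₀‖ ≤ ‖y - z j‖ + ‖z j - x₀‖ := by
          have := norm_add_le (y - z j) (z j - x₀); simpa using this
        linarith
      have : w y / C1 n ≤ 0 := div_nonpos_of_nonpos_of_nonneg this hC.le
      linarith

theorem ofReal_kk (n : ℕ) {T t : ℝ} (ht : 0 < t) (htT : t ≤ T) :
    ENNReal.ofReal (kk n T t) = ∫⁻ r in Ioc t T, ENNReal.ofReal ((r ^ (n - 1))⁻¹) := by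
  unfold kk
  rw [intervalIntegral.integral_of_le htT]
  refine ofReal_integral_eq_lintegral_ofReal (kk_ii n ht (ht.trans_le htT)).1 ?_
  filter_upwards [ae_restrict_mem measurableSet_Ioc] with r hr
  have : 0 < r := ht.trans hr.1
  simp only [Pi.zero_apply]
  positivity

theorem pot_bound {n : ℕ} (hn : 2 ≤ n) {K : Set (Eucl n)} (hK : MeasurableSet K) {x₀ z : Eucl n}
    {h : ℝ → ℝ} {M c A B ε₀ e d : ℝ} (he : 0 < e) (heε : e < ε₀) (hc : 4 < c) (hA : 0 < A) (hB : 0 < B)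
    (hM : 0 < M) (hpos : ∀ r : ℝ, 0 < r → 0 < h r)
    (hint : ∫⁻ r in Ioo (0 : ℝ) (c * e), ENNReal.ofReal (h r / r ^ (n - 1)) ≤
        ENNReal.ofReal (M * (h e / e ^ (n - 2)))) (μ : Measure (Eucl n))
    (h1 : ENNReal.ofReal (A * h e) ≤ μ (K ∩ ball x₀ e))
    (hfin : μ (K ∩ ball x₀ e) ≠ ⊤)
    (h2 : ∀ ε : ℝ, 0 < ε → ε < ε₀ → μ (K ∩ ball z ε) ≤ ENNReal.ofReal (B * h ε))
    (hd : 0 < d) :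
    ∫⁻ x in K ∩ ball x₀ e, ENNReal.ofReal (kk n (16 * e) (max ‖x - z‖ d)) ∂μ ≤
      ENNReal.ofReal (1 + B * M / A * 2 ^ (n - 1)) * (μ (K ∩ ball x₀ e) *
        ENNReal.ofReal (kk n (16 * e) e)) := by
  set S := K ∩ ball x₀ e with hS
  have hSm : MeasurableSet S := hK.inter measurableSet_ball
  set T := 16 * e with hT
  have hT0 : 0 < T := by positivity
  have : IsFiniteMeasure (μ.restrict S) := ⟨by simpa using hfin.lt_top⟩
  let F : Eucl n → ℝ → ℝ≥0∞ := fun x r =>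
    (Ioi ‖x - z‖).indicator (fun r => ENNReal.ofReal ((r ^ (n - 1))⁻¹)) r
  have hFm : Measurable (Function.uncurry F) := by
    have : Function.uncurry F = {p : Eucl n × ℝ | ‖p.1 - z‖ < p.2}.indicator
        (fun p => ENNReal.ofReal ((p.2 ^ (n - 1))⁻¹)) := by
      ext ⟨x, r⟩
      simp [F, Function.uncurry, indicator]
    rw [this]
    refine Measurable.indicator (by fun_prop) ?_
    exact measurableSet_lt (by fun_prop) (by fun_prop)
  have hle : ∀ x, ENNReal.ofReal (kk n T (max ‖x - z‖ d)) ≤ ∫⁻ r in Ioc 0 T, F x r := by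
    intro x
    have h0 : 0 < max ‖x - z‖ d := lt_max_of_lt_right hd
    rcases le_total (max ‖x - z‖ d) T with hle | hle
    · rw [ofReal_kk n h0 hle]
      have : ∫⁻ r in Ioc (max ‖x - z‖ d) T, ENNReal.ofReal ((r ^ (n - 1))⁻¹)
          ≤ ∫⁻ r in Ioc (max ‖x - z‖ d) T, F x r := by
        refine setLIntegral_mono' measurableSet_Ioc fun r hr => ?_
        have : r ∈ Ioi ‖x - z‖ := (le_max_left _ _).trans_lt hr.1
        simp only [F, indicator_of_mem this]
        exact le_rfl
      refine this.trans (lintegral_mono_set ?_)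
      exact Ioc_subset_Ioc_left h0.le
    · have : kk n T (max ‖x - z‖ d) ≤ 0 := by
        rw [← kk_self n T]; exact kk_anti n hT0 hT0 hle
      simp [ENNReal.ofReal_of_nonpos this]
  have hswap : ∫⁻ x in S, ∫⁻ r in Ioc 0 T, F x r ∂volume ∂μ
      = ∫⁻ r in Ioc 0 T, ∫⁻ x in S, F x r ∂μ := by
    exact lintegral_lintegral_swap hFm.aemeasurable
  have hinner : ∀ r, ∫⁻ x in S, F x r ∂μ = ENNReal.ofReal ((r ^ (n - 1))⁻¹) * μ (ball z r ∩ S) := by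
    intro r
    have : (fun x => F x r) = (ball z r).indicator fun _ => ENNReal.ofReal ((r ^ (n - 1))⁻¹) := by
      ext x
      simp [F, indicator, dist_eq_norm]
    rw [this, lintegral_indicator_const measurableSet_ball, Measure.restrict_apply measurableSet_ball]
  calc ∫⁻ x in S, ENNReal.ofReal (kk n T (max ‖x - z‖ d)) ∂μ
      ≤ ∫⁻ x in S, ∫⁻ r in Ioc 0 T, F x r ∂volume ∂μ := lintegral_mono hle
    _ = ∫⁻ r in Ioc 0 T, ENNReal.ofReal ((r ^ (n - 1))⁻¹) * μ (ball z r ∩ S) := by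
        rw [hswap]; simp_rw [hinner]
    _ ≤ ∫⁻ r in Ioo 0 e ∪ Icc e T, ENNReal.ofReal ((r ^ (n - 1))⁻¹) * μ (ball z r ∩ S) := by
        refine lintegral_mono_set fun r hr => ?_
        rcases lt_or_ge r e with h | h
        · exact Or.inl ⟨hr.1, h⟩
        · exact Or.inr ⟨h, hr.2⟩
    _ ≤ (∫⁻ r in Ioo 0 e, ENNReal.ofReal ((r ^ (n - 1))⁻¹) * μ (ball z r ∩ S))
        + ∫⁻ r in Icc e T, ENNReal.ofReal ((r ^ (n - 1))⁻¹) * μ (ball z r ∩ S) :=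
        lintegral_union_le _ _ _
    _ ≤ ENNReal.ofReal (B * M / A * 2 ^ (n - 1)) * (μ S * ENNReal.ofReal (kk n T e))
        + ENNReal.ofReal 1 * (μ S * ENNReal.ofReal (kk n T e)) := by
        refine add_le_add ?_ ?_
        · have a1 : ∫⁻ r in Ioo 0 e, ENNReal.ofReal ((r ^ (n - 1))⁻¹) * μ (ball z r ∩ S)
              ≤ ∫⁻ r in Ioo 0 e, ENNReal.ofReal B * ENNReal.ofReal (h r / r ^ (n - 1)) := by
            refine setLIntegral_mono' measurableSet_Ioo fun r hr => ?_
            have b1 : μ (ball z r ∩ S) ≤ ENNReal.ofReal (B * h r) := by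
              refine (measure_mono ?_).trans (h2 r hr.1 (hr.2.trans heε))
              rintro x ⟨hx1, hx2⟩
              exact ⟨hx2.1, hx1⟩
            refine (mul_le_mul_right b1 _).trans ?_
            rw [← ENNReal.ofReal_mul (by have := hr.1; positivity), ← ENNReal.ofReal_mul hB.le]
            apply le_of_eq
            congr 1
            rw [div_eq_mul_inv]; ring
          refine a1.trans ?_
          rw [lintegral_const_mul' _ _ ENNReal.ofReal_ne_top]
          have a2 : ∫⁻ r in Ioo 0 e, ENNReal.ofReal (h r / r ^ (n - 1)) ≤
              ENNReal.ofReal (M * (h e / e ^ (n - 2))) := by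
            refine (lintegral_mono_set ?_).trans hint
            exact Ioo_subset_Ioo_right (by nlinarith)
          refine (mul_le_mul_right a2 _).trans ?_
          have hh := hpos e he
          have hk : 0 < kk n T e := kk_pos n he (by linarith)
          have a3 : B * (M * (h e / e ^ (n - 2))) ≤
              (B * M / A * 2 ^ (n - 1)) * ((A * h e) * kk n T e) := by
            have := kk_lower hn (T := T) he (by linarith)
            have e1 : B * (M * (h e / e ^ (n - 2))) = (B * M * h e) * (1 / e ^ (n - 2)) := by ring
            have e2 : (B * M / A * 2 ^ (n - 1)) * ((A * h e) * kk n T e)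
              = (B * M * h e) * (2 ^ (n - 1) * kk n T e) := by field_simp
            rw [e1, e2]
            exact mul_le_mul_of_nonneg_left this (by positivity)
          rw [← ENNReal.ofReal_mul hB.le]
          refine (ENNReal.ofReal_le_ofReal a3).trans ?_
          rw [ENNReal.ofReal_mul (by positivity), ENNReal.ofReal_mul (p := A * h e) (by positivity)]
          gcongr
        · rw [ENNReal.ofReal_one, one_mul, ofReal_kk n he (by linarith), mul_comm (μ S),
            ← lintegral_mul_const' _ _ hfin, setLIntegral_congr (Ioc_ae_eq_Icc (a := e) (b := T)).symm]
          refine lintegral_mono fun r => ?_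
          gcongr
          exact inter_subset_right
    _ = _ := by
        rw [← add_mul, ← ENNReal.ofReal_add (by positivity) (by positivity), add_comm]

theorem measurable_erealPosPart : Measurable EReal.posPart := by
  unfold EReal.posPart
  refine Measurable.ite (measurableSet_singleton _) measurable_const ?_
  exact ENNReal.measurable_ofReal.comp measurable_ereal_toReal

theorem posPart_coe (r : ℝ) : (r : EReal).posPart = ENNReal.ofReal r := by
  simp [EReal.posPart]

theorem posPart_top : (⊤ : EReal).posPart = ⊤ := by simp [EReal.posPart]

theorem posPart_bot : (⊥ : EReal).posPart = 0 := by simp [EReal.posPart]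

theorem le_posPart_sub {v : EReal} {a t : ℝ} (h : v < ((a - t : ℝ) : EReal)) :
    ENNReal.ofReal t ≤ ((a : EReal) - v).posPart := by
  induction v using EReal.rec with
  | bot => simp [posPart_top]
  | top => simp at h
  | coe r =>
    rw [← EReal.coe_sub, posPart_coe]
    rw [EReal.coe_lt_coe_iff] at h
    exact ENNReal.ofReal_le_ofReal (by linarith)

theorem lt_of_lt_posPart_sub {v : EReal} {a t : ℝ} (ht : 0 ≤ t)
    (h : ENNReal.ofReal t < ((a : EReal) - v).posPart) : v < ((a - t : ℝ) : EReal) := by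
  induction v using EReal.rec with
  | bot => exact EReal.bot_lt_coe _
  | top => simp [posPart_bot] at h
  | coe r =>
    rw [← EReal.coe_sub, posPart_coe, ENNReal.ofReal_lt_ofReal_iff_of_nonneg ht] at h
    rw [EReal.coe_lt_coe_iff]
    linarith

theorem posPart_identity {v : EReal} {a : ℝ} (h : v ≤ (a : EReal)) :
    v.posPart + ((a : EReal) - v).posPart + ENNReal.ofReal (-a)
      = (-v).posPart + ENNReal.ofReal a := by
  induction v using EReal.rec with
  | bot => simp [posPart_top, posPart_bot]
  | top => simp at h
  | coe r =>
    rw [EReal.coe_le_coe_iff] at h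
    rw [← EReal.coe_sub, ← EReal.coe_neg, posPart_coe, posPart_coe, posPart_coe]
    rw [← ENNReal.toReal_eq_toReal_iff' (by simp) (by simp)]
    rw [ENNReal.toReal_add (by simp) (by simp), ENNReal.toReal_add (by simp) (by simp),
      ENNReal.toReal_add (by simp) (by simp)]
    simp only [ENNReal.toReal_ofReal']
    rcases le_total r 0 with h1 | h1 <;> rcases le_total a 0 with h2 | h2 <;>
      simp [h1, h2, h] <;> linarith

theorem usc_isOpen {n : ℕ} {Ω : Set (Eucl n)} (hΩ : IsOpen Ω) {u : Eucl n → EReal}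
    (hu : UpperSemicontinuousOn u Ω) (t : EReal) : IsOpen {x | x ∈ Ω ∧ u x < t} := by
  rw [isOpen_iff_mem_nhds]
  rintro x ⟨hx, hxt⟩
  have := hu x hx t hxt
  rw [hΩ.nhdsWithin_eq hx] at this
  filter_upwards [this, hΩ.mem_nhds hx] with y h1 h2 using ⟨h2, h1⟩

theorem usc_aemeasurable {n : ℕ} {Ω : Set (Eucl n)} (hΩ : IsOpen Ω) {u : Eucl n → EReal}
    (hu : UpperSemicontinuousOn u Ω) (μ : Measure (Eucl n)) {S : Set (Eucl n)}
    (hS : MeasurableSet S) (hSΩ : S ⊆ Ω) : AEMeasurable u (μ.restrict S) := by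
  classical
  refine ⟨Ω.piecewise u (fun _ => ⊤), ?_, ?_⟩
  · refine measurable_of_Iio fun t => ?_
    have : Ω.piecewise u (fun _ => ⊤) ⁻¹' Iio t = {x | x ∈ Ω ∧ u x < t} := by
      ext x
      by_cases hx : x ∈ Ω <;> simp [hx]
    rw [this]
    exact (usc_isOpen hΩ hu t).measurableSet
  · filter_upwards [ae_restrict_mem hS] with x hx
    simp [hSΩ hx]

theorem eavg_eq {n : ℕ} (μ : Measure (Eucl n)) {S : Set (Eucl n)} (hS : MeasurableSet S)
    (h0 : μ S ≠ 0) (hfin : μ S ≠ ⊤) {u : Eucl n → EReal} (hu : AEMeasurable u (μ.restrict S))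
    (a : ℝ) (ha : ∀ x ∈ S, u x ≤ (a : EReal)) :
    eavg μ S u = (a : EReal) -
      (((μ S)⁻¹ * ∫⁻ x in S, ((a : EReal) - u x).posPart ∂μ : ℝ≥0∞) : EReal) := by
  have m1 : AEMeasurable (fun x => (u x).posPart) (μ.restrict S) :=
    measurable_erealPosPart.comp_aemeasurable hu
  have m2 : AEMeasurable (fun x => (-(u x)).posPart) (μ.restrict S) :=
    measurable_erealPosPart.comp_aemeasurable (hu.neg)
  have hid : ∫⁻ x in S, (u x).posPart ∂μ + ∫⁻ x in S, ((a : EReal) - u x).posPart ∂μ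
      + ENNReal.ofReal (-a) * μ S = ∫⁻ x in S, (-(u x)).posPart ∂μ + ENNReal.ofReal a * μ S := by
    rw [← setLIntegral_const, ← setLIntegral_const, ← lintegral_add_left' m1,
      ← lintegral_add_right _ measurable_const, ← lintegral_add_right _ measurable_const]
    exact setLIntegral_congr_fun hS fun x hx => posPart_identity (ha x hx)
  have hP : ∫⁻ x in S, (u x).posPart ∂μ ≠ ⊤ := by
    have : ∫⁻ x in S, (u x).posPart ∂μ ≤ ∫⁻ x in S, ENNReal.ofReal a ∂μ := by
      refine setLIntegral_mono' hS fun x hx => ?_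
      have h1 := ha x hx
      generalize u x = v at h1 ⊢
      induction v using EReal.rec with
      | bot => simp [posPart_bot]
      | top => simp at h1
      | coe r =>
        rw [posPart_coe]
        exact ENNReal.ofReal_le_ofReal (by simpa using h1)
    rw [setLIntegral_const] at this
    exact ne_top_of_le_ne_top (ENNReal.mul_ne_top ENNReal.ofReal_ne_top hfin) this
  unfold eavg eintegral
  generalize ∫⁻ x in S, (u x).posPart ∂μ = P at *
  generalize ∫⁻ x in S, (-(u x)).posPart ∂μ = Q at *
  generalize ∫⁻ x in S, ((a : EReal) - u x).posPart ∂μ = I at *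
  generalize μ S = m at *
  lift P to NNReal using hP
  lift m to NNReal using hfin
  have hm0 : m ≠ 0 := by simpa using h0
  have hmpos : (0 : ℝ) < m := by positivity
  have hinv : ((m : ℝ≥0∞)⁻¹) = ((m⁻¹ : NNReal) : ℝ≥0∞) := (ENNReal.coe_inv hm0).symm
  rw [hinv]
  by_cases hI : I = ⊤
  · subst hI
    have hQ : Q = ⊤ := by
      by_contra hQ
      lift Q to NNReal using hQ
      have : (Q : ℝ≥0∞) + ENNReal.ofReal a * m ≠ ⊤ := by
        refine ENNReal.add_ne_top.2 ⟨by simp, ENNReal.mul_ne_top (by simp) (by simp)⟩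
      apply this
      rw [← hid]; simp
    subst hQ
    have : ((m⁻¹ : NNReal) : ℝ≥0∞) * ⊤ = ⊤ := by
      rw [ENNReal.mul_top]; simpa using hm0
    rw [this]
    have h3 : ((P : ℝ≥0∞) : EReal) - ((⊤ : ℝ≥0∞) : EReal) = ⊥ := by
      rw [EReal.coe_ennreal_top, EReal.sub_top]
    rw [h3, EReal.coe_ennreal_top, EReal.sub_top]
    refine EReal.mul_bot_of_pos ?_
    have : (0 : ℝ≥0∞) < ((m⁻¹ : NNReal) : ℝ≥0∞) := by simpa using pos_iff_ne_zero.2 hm0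
    exact_mod_cast this
  · lift I to NNReal using hI
    have hQ : Q ≠ ⊤ := by
      intro hQ
      subst hQ
      have : (P : ℝ≥0∞) + I + ENNReal.ofReal (-a) * m ≠ ⊤ := by
        refine ENNReal.add_ne_top.2 ⟨by simp, ENNReal.mul_ne_top (by simp) (by simp)⟩
      apply this
      rw [hid]; simp
    lift Q to NNReal using hQ
    have hr := congrArg ENNReal.toReal hid
    rw [ENNReal.toReal_add (by simp) (ENNReal.mul_ne_top (by simp) (by simp)),
      ENNReal.toReal_add (by simp) (by simp),
      ENNReal.toReal_add (by simp) (ENNReal.mul_ne_top (by simp) (by simp))] at hr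
    simp only [ENNReal.toReal_mul, ENNReal.toReal_ofReal', ENNReal.coe_toReal] at hr
    have hr2 : (P : ℝ) - Q = a * m - I := by
      rcases le_total a 0 with h2 | h2 <;> simp [h2] at hr <;> linarith
    rw [← ENNReal.coe_mul]
    have c1 : ∀ p : NNReal, ((p : ℝ≥0∞) : EReal) = ((p : ℝ) : EReal) := fun p => rfl
    simp only [c1]
    rw [← EReal.coe_sub, ← EReal.coe_mul, ← EReal.coe_sub, hr2]
    congr 1
    push_cast
    field_simp

theorem kk_max_continuous (n : ℕ) {T d : ℝ} (hT : 0 < T) (hd : 0 < d) (z : Eucl n) :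
    Continuous fun y : Eucl n => kk n T (max ‖y - z‖ d) := by
  rw [continuous_iff_continuousAt]
  intro y
  have h0 : 0 < max ‖y - z‖ d := lt_max_of_lt_right hd
  exact ContinuousAt.comp (g := kk n T) (f := fun y => max ‖y - z‖ d)
    (kk_hasDerivAt n hT h0).continuousAt (by fun_prop)

theorem step {n : ℕ} (hn : 2 ≤ n) {Ω : Set (Eucl n)} {u : Eucl n → EReal}
    (hu : IsSubharmonicOn u Ω) {K : Set (Eucl n)} (hK : MeasurableSet K) {x₀ : Eucl n}
    {h : ℝ → ℝ} {M c A B ε₀ e d : ℝ} (he : 0 < e) (heε : e < ε₀) (hc : 4 < c) (hA : 0 < A) (hB : 0 < B)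
    (hM : 0 < M) (hpos : ∀ r : ℝ, 0 < r → 0 < h r)
    (hint : ∫⁻ r in Ioo (0 : ℝ) (c * e), ENNReal.ofReal (h r / r ^ (n - 1)) ≤
        ENNReal.ofReal (M * (h e / e ^ (n - 2)))) (μ : Measure (Eucl n))
    (h1 : ENNReal.ofReal (A * h e) ≤ μ (K ∩ ball x₀ e))
    (hfin : μ (K ∩ ball x₀ e) ≠ ⊤)
    (h2 : ∀ x ∈ K, ∀ ε : ℝ, 0 < ε → ε < ε₀ → μ (K ∩ ball x ε) ≤ ENNReal.ofReal (B * h ε))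
    (hBall : closedBall x₀ (17 * e) ⊆ Ω) (a α : ℝ)
    (ha : ∀ y ∈ closedBall x₀ (17 * e), u y ≤ (a : EReal)) (hα : u x₀ = (α : EReal))
    (hd : 0 < d) (hde : d ≤ e) (N : ℕ) :
    ∫⁻ x in K ∩ ball x₀ e, min (N : ℝ≥0∞) (⨅ y ∈ ball x (2 * d), ((a : EReal) - u y).posPart) ∂μ ≤
      ENNReal.ofReal (1 + B * M / A * 2 ^ (n - 1)) * (μ (K ∩ ball x₀ e) *
        ENNReal.ofReal (C1 n * (C1 n * (a - α)))) := by
  classical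
  set S := K ∩ ball x₀ e with hS
  have hC := C1_pos n
  have hSm : MeasurableSet S := hK.inter measurableSet_ball
  obtain ⟨t, htS, htf, htc⟩ := exists_finite_cover_balls_of_isCompact_closure (s := S) (ε := d)
    (IsCompact.of_isClosed_subset (isCompact_closedBall x₀ e) isClosed_closure
      ((closure_mono inter_subset_right).trans closure_ball_subset_closedBall)) hd
  have := htf.fintype
  let z : t → Eucl n := Subtype.val
  have hzS : ∀ i, z i ∈ S := fun i => htS i.2
  have hz : ∀ i, z i ∈ ball x₀ e := fun i => (hzS i).2
  let b' : t → ℝ≥0∞ := fun i => min (N : ℝ≥0∞) (⨅ y ∈ closedBall (z i) d, ((a : EReal) - u y).posPart)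
  let b : t → ℝ := fun i => (b' i).toReal
  have hb' : ∀ i, b' i ≠ ⊤ := fun i => ne_top_of_le_ne_top (ENNReal.natCast_ne_top N) (min_le_left _ _)
  have hmem : ∀ x ∈ S, ∀ i, max ‖x - z i‖ d < 16 * e := by
    intro x hx i
    have g1 := hx.2
    have g2 := hz i
    rw [mem_ball, dist_eq_norm] at g1 g2
    have g3 : ‖x - z i‖ ≤ ‖x - x₀‖ + ‖z i - x₀‖ := by
      have := norm_sub_le (x - x₀) (z i - x₀); simpa using this
    exact max_lt (by linarith) (by linarith)
  obtain ⟨l, hl, hl1, hl2⟩ := lcp (fun i j => kk n (16 * e) (max ‖z i - z j‖ d))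
    (fun i j => by rw [norm_sub_rev]) (fun i j => kk_pos n (lt_max_of_lt_right hd) (hmem _ (hzS i) j))
    b (fun i => ENNReal.toReal_nonneg)
  have hcomp := compare hn hu hd hde hBall a ha z hz b l (by
    intro i y hy
    have hya : u y ≤ a := by
      apply ha
      have g2 := hz i
      rw [mem_ball] at g2
      rw [mem_closedBall] at hy ⊢
      linarith [dist_triangle y (z i) x₀]
    have hle : b' i ≤ ((a : EReal) - u y).posPart :=
      (min_le_right _ _).trans (iInf₂_le y hy)
    generalize u y = v at hya hle
    induction v using EReal.rec with
    | bot => exact bot_le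
    | top => simp at hya
    | coe r =>
      rw [← EReal.coe_sub, posPart_coe] at hle
      rw [EReal.coe_le_coe_iff] at hya ⊢
      have : b i ≤ a - r := by
        have := ENNReal.toReal_mono ENNReal.ofReal_ne_top hle
        rwa [ENNReal.toReal_ofReal (by linarith)] at this
      linarith) hl hl2
  rw [hα, EReal.coe_le_coe_iff] at hcomp
  have hw0 : ∑ j, l j * kk n (16 * e) (max ‖x₀ - z j‖ d) ≤ C1 n * (a - α) := by
    have : (∑ j, l j * kk n (16 * e) (max ‖x₀ - z j‖ d)) / C1 n ≤ a - α := by linarith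
    rw [div_le_iff₀ hC] at this
    linarith
  have hsum : ∑ j, l j * kk n (16 * e) e ≤ C1 n * (a - α) := by
    refine le_trans (Finset.sum_le_sum fun j _ => ?_) hw0
    refine mul_le_mul_of_nonneg_left (kk_anti n (by positivity) (lt_max_of_lt_right hd) ?_) (hl j)
    have g2 := hz j
    rw [mem_ball, dist_eq_norm, norm_sub_rev] at g2
    exact max_le g2.le hde
  have hk : 0 < kk n (16 * e) e := kk_pos n he (by linarith)
  have hpt : ∀ x ∈ S, min (N : ℝ≥0∞) (⨅ y ∈ ball x (2 * d), ((a : EReal) - u y).posPart) ≤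
      ∑ j, ENNReal.ofReal (C1 n * l j) * ENNReal.ofReal (kk n (16 * e) (max ‖x - z j‖ d)) := by
    intro x hx
    obtain ⟨i, hi, hxi⟩ := mem_iUnion₂.1 (htc hx)
    have s1 : min (N : ℝ≥0∞) (⨅ y ∈ ball x (2 * d), ((a : EReal) - u y).posPart) ≤ b' ⟨i, hi⟩ := by
      refine min_le_min_left _ (biInf_mono fun y hy => ?_)
      change y ∈ closedBall i d at hy
      rw [mem_closedBall] at hy
      rw [mem_ball] at hxi ⊢
      rw [dist_comm] at hxi
      linarith [dist_triangle y i x]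
    refine s1.trans ?_
    have s2 : b' ⟨i, hi⟩ = ENNReal.ofReal (b ⟨i, hi⟩) := (ENNReal.ofReal_toReal (hb' _)).symm
    rw [s2]
    have s3 : b ⟨i, hi⟩ ≤ ∑ j, C1 n * l j * kk n (16 * e) (max ‖x - z j‖ d) := by
      refine (hl1 ⟨i, hi⟩).trans (Finset.sum_le_sum fun j _ => ?_)
      rw [mul_comm (C1 n), mul_assoc]
      refine mul_le_mul_of_nonneg_left ?_ (hl j)
      rw [mem_ball, dist_eq_norm] at hxi
      refine gk_compare n hd hxi.le ?_
      have g1 := hz ⟨i, hi⟩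
      have g2 := hz j
      rw [mem_ball, dist_eq_norm] at g1 g2
      have g3 : ‖z ⟨i, hi⟩ - z j‖ ≤ ‖z ⟨i, hi⟩ - x₀‖ + ‖z j - x₀‖ := by
        have := norm_sub_le (z ⟨i, hi⟩ - x₀) (z j - x₀); simpa using this
      have : max ‖z ⟨i, hi⟩ - z j‖ d ≤ 4 * e := max_le (by linarith) (by linarith)
      linarith
    refine (ENNReal.ofReal_le_ofReal s3).trans ?_
    rw [ENNReal.ofReal_sum_of_nonneg]
    · refine Finset.sum_le_sum fun j _ => ?_
      rw [ENNReal.ofReal_mul (mul_nonneg hC.le (hl j))]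
    · intro j _
      exact mul_nonneg (mul_nonneg hC.le (hl j))
        (kk_pos n (lt_max_of_lt_right hd) (hmem x hx j)).le
  calc _ ≤ ∫⁻ x in S, ∑ j, ENNReal.ofReal (C1 n * l j) *
          ENNReal.ofReal (kk n (16 * e) (max ‖x - z j‖ d)) ∂μ := setLIntegral_mono' hSm hpt
    _ = ∑ j, ENNReal.ofReal (C1 n * l j) *
          ∫⁻ x in S, ENNReal.ofReal (kk n (16 * e) (max ‖x - z j‖ d)) ∂μ := by
        have hm : ∀ j, Measurable fun x => ENNReal.ofReal (kk n (16 * e) (max ‖x - z j‖ d)) :=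
          fun j => ENNReal.measurable_ofReal.comp
            (kk_max_continuous n (by positivity) hd (z j)).measurable
        rw [lintegral_finsetSum _ fun j _ => (hm j).const_mul _]
        refine Finset.sum_congr rfl fun j _ => ?_
        rw [lintegral_const_mul _ (hm j)]
    _ ≤ ∑ j, ENNReal.ofReal (C1 n * l j) * (ENNReal.ofReal (1 + B * M / A * 2 ^ (n - 1)) *
          (μ S * ENNReal.ofReal (kk n (16 * e) e))) := by
        refine Finset.sum_le_sum fun j _ => ?_
        gcongr
        exact pot_bound hn hK he heε hc hA hB hM hpos hint μ h1 hfin (h2 (z j) (hzS j).1) hd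
    _ = ENNReal.ofReal (1 + B * M / A * 2 ^ (n - 1)) *
          (μ S * ENNReal.ofReal (∑ j, C1 n * l j * kk n (16 * e) e)) := by
        rw [ENNReal.ofReal_sum_of_nonneg
          (fun j _ => mul_nonneg (mul_nonneg hC.le (hl j)) hk.le), Finset.mul_sum, Finset.mul_sum]
        refine Finset.sum_congr rfl fun j _ => ?_
        rw [ENNReal.ofReal_mul (mul_nonneg hC.le (hl j))]
        ring
    _ ≤ _ := by
        gcongr
        simp_rw [mul_assoc]
        rw [← Finset.mul_sum]
        gcongr

theorem key {n : ℕ} (hn : 2 ≤ n) {Ω : Set (Eucl n)} (hΩ : IsOpen Ω) {u : Eucl n → EReal}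
    (hu : IsSubharmonicOn u Ω) {K : Set (Eucl n)} (hK : MeasurableSet K) (hKΩ : K ⊆ Ω) {x₀ : Eucl n}
    {h : ℝ → ℝ} {M c A B ε₀ e : ℝ} (he : 0 < e) (heε : e < ε₀) (hc : 4 < c) (hA : 0 < A) (hB : 0 < B)
    (hM : 0 < M) (hpos : ∀ r : ℝ, 0 < r → 0 < h r)
    (hint : ∫⁻ r in Ioo (0 : ℝ) (c * e), ENNReal.ofReal (h r / r ^ (n - 1)) ≤
        ENNReal.ofReal (M * (h e / e ^ (n - 2)))) (μ : Measure (Eucl n))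
    (h1 : ENNReal.ofReal (A * h e) ≤ μ (K ∩ ball x₀ e))
    (hfin : μ (K ∩ ball x₀ e) ≠ ⊤)
    (h2 : ∀ x ∈ K, ∀ ε : ℝ, 0 < ε → ε < ε₀ → μ (K ∩ ball x ε) ≤ ENNReal.ofReal (B * h ε))
    (hBall : closedBall x₀ (17 * e) ⊆ Ω) (a α : ℝ)
    (ha : ∀ y ∈ closedBall x₀ (17 * e), u y ≤ (a : EReal)) (hα : u x₀ = (α : EReal)) :
    ∫⁻ x in K ∩ ball x₀ e, ((a : EReal) - u x).posPart ∂μ ≤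
      ENNReal.ofReal (1 + B * M / A * 2 ^ (n - 1)) * (μ (K ∩ ball x₀ e) *
        ENNReal.ofReal (C1 n * (C1 n * (a - α)))) := by
  set S := K ∩ ball x₀ e with hS
  have hSm : MeasurableSet S := hK.inter measurableSet_ball
  let d : ℕ → ℝ := fun j => e / (j + 1)
  have hd : ∀ j, 0 < d j := fun j => by positivity
  have hde : ∀ j, d j ≤ e := fun j => div_le_self he.le (by simp)
  have hdl : Tendsto (fun j => 2 * d j) atTop (𝓝 0) := by
    have : Tendsto d atTop (𝓝 0) := by
      have := (tendsto_one_div_add_atTop_nhds_zero_nat (𝕜 := ℝ)).const_mul e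
      simpa [d, div_eq_mul_inv] using this
    simpa using this.const_mul 2
  let V : Eucl n → ℝ≥0∞ := fun x => ((a : EReal) - u x).posPart
  let f : ℕ → Eucl n → ℝ≥0∞ := fun j x => min (j : ℝ≥0∞) (⨅ y ∈ ball x (2 * d j), V y)
  have hfm : ∀ j, Measurable (f j) := by
    intro j
    refine measurable_const.min (measurable_of_Iio fun t => ?_)
    have : (fun x => ⨅ y ∈ ball x (2 * d j), V y) ⁻¹' Iio t
        = ⋃ y ∈ {y | V y < t}, ball y (2 * d j) := by
      ext x
      simp only [mem_preimage, mem_Iio, iInf_lt_iff, mem_iUnion, mem_ball]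
      constructor
      · rintro ⟨y, hy, hyt⟩
        exact ⟨y, hyt, by rwa [dist_comm]⟩
      · rintro ⟨y, hyt, hy⟩
        exact ⟨y, by rwa [dist_comm], hyt⟩
    rw [this]
    exact (isOpen_biUnion fun y _ => isOpen_ball).measurableSet
  have hlim : ∀ x ∈ S, V x ≤ liminf (fun j => f j x) atTop := by
    intro x hx
    refine le_of_forall_lt fun t ht => ?_
    obtain ⟨t', htt, ht'⟩ := exists_between ht
    refine htt.trans_le ?_
    have htop : t' ≠ ⊤ := ht'.ne_top
    refine le_liminf_of_le (by isBoundedDefault) ?_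
    have e1 : ENNReal.ofReal t'.toReal = t' := ENNReal.ofReal_toReal htop
    have hux : u x < ((a - t'.toReal : ℝ) : EReal) :=
      lt_of_lt_posPart_sub ENNReal.toReal_nonneg (by rw [e1]; exact ht')
    obtain ⟨r, hr, hball⟩ := Metric.isOpen_iff.1 (usc_isOpen hΩ hu.1 _) x ⟨hKΩ hx.1, hux⟩
    obtain ⟨N, hN⟩ := ENNReal.exists_nat_gt htop
    filter_upwards [hdl.eventually (gt_mem_nhds hr), eventually_ge_atTop N] with j hj hjN
    refine le_min (hN.le.trans (by exact_mod_cast hjN)) (le_iInf₂ fun y hy => ?_)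
    rw [← e1]
    exact le_posPart_sub (hball (ball_subset_ball hj.le hy)).2
  calc ∫⁻ x in S, V x ∂μ ≤ ∫⁻ x in S, liminf (fun j => f j x) atTop ∂μ := setLIntegral_mono' hSm hlim
    _ ≤ liminf (fun j => ∫⁻ x in S, f j x ∂μ) atTop := lintegral_liminf_le hfm
    _ ≤ _ := by
      refine liminf_le_of_le (by isBoundedDefault) fun b hb => ?_
      obtain ⟨j, hj⟩ := hb.exists
      exact hj.trans (step hn hu hK he heε hc hA hB hM hpos hint μ h1 hfin h2 hBall a α ha hα
        (hd j) (hde j) j)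

/-- **Main Theorem 1** (extension of the mean value theorem). Let `u` be subharmonic on a
domain `Ω ⊆ ℝⁿ` (`n ≥ 2`), `K ⊆ Ω` a Borel set, `x₀ ∈ K`, and `h : (0,∞) → (0,∞)` with
`∫₀^{cε} h(r)/r^{n-1} dr ≤ M h(ε)/ε^{n-2}` for small `ε`, where `M > 0`, `c > 4`. If a
positive Borel measure `μ` satisfies `μ(K ∩ B(x₀,ε)) ≥ A h(ε)` and
`μ(K ∩ B(x,ε)) ≤ B h(ε)` for all `x ∈ K`, `ε < ε₀`, then the `μ`-averages of `u` over
`K ∩ B(x₀,ε)` tend to `u(x₀)` as `ε → 0`. -/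
theorem main_theorem_1 {n : ℕ} (hn : 2 ≤ n)
    (Ω : Set (Eucl n)) (hΩ : IsOpen Ω) (hΩconn : IsConnected Ω)
    (u : Eucl n → EReal) (hu : IsSubharmonicOn u Ω)
    (K : Set (Eucl n)) (hK : MeasurableSet K) (hKΩ : K ⊆ Ω)
    (x₀ : Eucl n) (hx₀ : x₀ ∈ K)
    (h : ℝ → ℝ) (hpos : ∀ r : ℝ, 0 < r → 0 < h r)
    (M c : ℝ) (hM : 0 < M) (hc : 4 < c)
    (hint : ∃ ε₁ > (0 : ℝ), ∀ ε : ℝ, 0 < ε → ε ≤ ε₁ →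
      ∫⁻ r in Ioo (0 : ℝ) (c * ε), ENNReal.ofReal (h r / r ^ (n - 1)) ≤
        ENNReal.ofReal (M * (h ε / ε ^ (n - 2))))
    (μ : Measure (Eucl n)) (A B ε₀ : ℝ) (hA : 0 < A) (hB : 0 < B) (hε₀ : 0 < ε₀)
    (h1 : ∀ ε : ℝ, 0 < ε → ε < ε₀ → ENNReal.ofReal (A * h ε) ≤ μ (K ∩ ball x₀ ε))
    (h2 : ∀ x ∈ K, ∀ ε : ℝ, 0 < ε → ε < ε₀ → μ (K ∩ ball x ε) ≤ ENNReal.ofReal (B * h ε)) :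
    Tendsto (fun ε : ℝ => eavg μ (K ∩ ball x₀ ε) u) (𝓝[>] 0) (𝓝 (u x₀)) := by
  obtain ⟨ε₁, hε₁, hint⟩ := hint
  have hx₀Ω : x₀ ∈ Ω := hKΩ hx₀
  -- eventual facts
  have hfin : ∀ e : ℝ, 0 < e → e < ε₀ → μ (K ∩ ball x₀ e) ≠ ⊤ := fun e h0 h3 =>
    ne_top_of_le_ne_top ENNReal.ofReal_ne_top (h2 x₀ hx₀ e h0 h3)
  have hne : ∀ e : ℝ, 0 < e → e < ε₀ → μ (K ∩ ball x₀ e) ≠ 0 := fun e h0 h3 => by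
    have : 0 < ENNReal.ofReal (A * h e) := ENNReal.ofReal_pos.2 (mul_pos hA (hpos e h0))
    exact (this.trans_le (h1 e h0 h3)).ne'
  have hev : ∀ a : ℝ, u x₀ < (a : EReal) → ∀ᶠ e : ℝ in 𝓝[>] 0, 0 < e ∧ e < ε₀ ∧ e ≤ ε₁ ∧
      closedBall x₀ (17 * e) ⊆ Ω ∧ ∀ y ∈ closedBall x₀ (17 * e), u y ≤ (a : EReal) := by
    intro a ha
    obtain ⟨r, hr, hball⟩ := Metric.isOpen_iff.1 (usc_isOpen hΩ hu.1 _) x₀ ⟨hx₀Ω, ha⟩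
    have hr' : 0 < min (min ε₀ ε₁) (r / 17) := lt_min (lt_min hε₀ hε₁) (by positivity)
    filter_upwards [Ioo_mem_nhdsGT hr'] with e he
    have g1 : e < ε₀ := he.2.trans_le ((min_le_left _ _).trans (min_le_left _ _))
    have g2 : e < ε₁ := he.2.trans_le ((min_le_left _ _).trans (min_le_right _ _))
    have g3 : e < r / 17 := he.2.trans_le (min_le_right _ _)
    have g4 : closedBall x₀ (17 * e) ⊆ ball x₀ r := closedBall_subset_ball (by linarith)
    exact ⟨he.1, g1, g2.le, fun y hy => (hball (g4 hy)).1, fun y hy => (hball (g4 hy)).2.le⟩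
  have heq : ∀ (a e : ℝ), 0 < e → e < ε₀ → (∀ y ∈ closedBall x₀ (17 * e), u y ≤ (a : EReal)) →
      eavg μ (K ∩ ball x₀ e) u = (a : EReal) - (((μ (K ∩ ball x₀ e))⁻¹ *
        ∫⁻ x in K ∩ ball x₀ e, ((a : EReal) - u x).posPart ∂μ : ℝ≥0∞) : EReal) := by
    intro a e h0 h3 h4
    have hSm : MeasurableSet (K ∩ ball x₀ e) := hK.inter measurableSet_ball
    refine eavg_eq μ hSm (hne e h0 h3) (hfin e h0 h3)
      (usc_aemeasurable hΩ hu.1 μ hSm (inter_subset_left.trans hKΩ)) a fun x hx => h4 x ?_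
    have := hx.2
    rw [mem_ball] at this
    rw [mem_closedBall]
    linarith
  rw [tendsto_order]
  constructor
  · intro b hb
    have hbot : u x₀ ≠ ⊥ := (bot_le.trans_lt hb).ne'
    have htop : u x₀ ≠ ⊤ := (hu.2.1 x₀ hx₀Ω).ne
    obtain ⟨α, hα⟩ : ∃ α : ℝ, u x₀ = (α : EReal) := ⟨(u x₀).toReal, (EReal.coe_toReal htop hbot).symm⟩
    rw [hα] at hb
    obtain ⟨β, hbβ, hβα⟩ := EReal.lt_iff_exists_real_btwn.1 hb
    rw [EReal.coe_lt_coe_iff] at hβα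
    have hC := C1_pos n
    have hD0 : 0 < 1 + B * M / A * 2 ^ (n - 1) := by positivity
    set D : ℝ := (1 + B * M / A * 2 ^ (n - 1)) * (C1 n * C1 n) with hD
    have hDpos : 0 < D := by positivity
    set η : ℝ := (α - β) / D with hη
    have hηpos : 0 < η := div_pos (by linarith) hDpos
    have hDη : D * η = α - β := by rw [hη]; field_simp
    filter_upwards [hev (α + η) (by rw [hα, EReal.coe_lt_coe_iff]; linarith)] with e hE
    obtain ⟨he, heε, heε1, hBall, ha⟩ := hE
    rw [heq (α + η) e he heε ha]
    have hkey := key hn hΩ hu hK hKΩ he heε hc hA hB hM hpos (hint e he heε1) μ (h1 e he heε)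
      (hfin e he heε) h2 hBall (α + η) α ha hα
    have hle : (μ (K ∩ ball x₀ e))⁻¹ *
        ∫⁻ x in K ∩ ball x₀ e, (((α + η : ℝ) : EReal) - u x).posPart ∂μ ≤ ENNReal.ofReal (α - β) := by
      refine (mul_le_mul_right hkey _).trans (le_of_eq ?_)
      rw [mul_left_comm (ENNReal.ofReal _), ← mul_assoc,
        ENNReal.inv_mul_cancel (hne e he heε) (hfin e he heε), one_mul,
        ← ENNReal.ofReal_mul hD0.le]
      congr 1
      rw [← hDη, hD]; ring
    have hle2 : (((μ (K ∩ ball x₀ e))⁻¹ *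
        ∫⁻ x in K ∩ ball x₀ e, (((α + η : ℝ) : EReal) - u x).posPart ∂μ : ℝ≥0∞) : EReal)
        ≤ ((α - β : ℝ) : EReal) := by
      refine (EReal.coe_ennreal_le_coe_ennreal_iff.2 hle).trans (le_of_eq ?_)
      rw [EReal.coe_ennreal_ofReal, max_eq_left (by linarith)]
    refine hbβ.trans (lt_of_lt_of_le ?_ (EReal.sub_le_sub le_rfl hle2))
    rw [← EReal.coe_sub, EReal.coe_lt_coe_iff]
    linarith
  · intro b hb
    obtain ⟨a, hua, hab⟩ := EReal.lt_iff_exists_real_btwn.1 hb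
    filter_upwards [hev a hua] with e hE
    obtain ⟨he, heε, heε1, hBall, ha⟩ := hE
    rw [heq a e he heε ha]
    refine lt_of_le_of_lt ?_ hab
    refine (EReal.sub_le_sub le_rfl (EReal.coe_ennreal_nonneg _)).trans ?_
    simp

end
end

section
/- Let $\Omega$ be a domain in $\mathbb{R}^n$ ($n \geq 2$), let $u$ be an upper semicontinuous function on $\Omega$, let $v$ be a subharmonic function on $\Omega$, and let $K$ be a Borel subset of $\Omega$. Let $h : (0,\infty) \to (0,\infty)$ be a function for which there exist real numbers $M > 0$ and $c > 4$ such that $\int_0^{c\epsilon} h(r)/r^{n-1}\, dr \leq M\, h(\epsilon)/\epsilon^{n-2}$ for all sufficiently small $\epsilon > 0$. Suppose there exist a positive Borel measure $\mu$ on $\mathbb{R}^n$, real numbers $A, B > 0$, $\epsilon_0 > 0$, and a set $N \subseteq K$ such that (1) $\mu(N) = 0$, (2) $A\, h(\epsilon) \leq \mu(K \cap \mathbb{B}(x,\epsilon)) \leq B\, h(\epsilon)$ for all $x \in K$ and all $\epsilon < \epsilon_0$, and (3) $u \geq v$ on $K \setminus N$. Then $u \geq v$ on $K$. -/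
open MeasureTheory Metric Filter Set ENNReal Topology

noncomputable section

/-! ### Pointwise harmonicity -/

def HarmAt {n : ℕ} (f : Eucl n → ℝ) (x : Eucl n) : Prop :=
  ContDiffAt ℝ 2 f x ∧ lap f x = 0

theorem diffAt_fderiv_apply {n : ℕ} {f : Eucl n → ℝ} {x : Eucl n}
    (hf : ContDiffAt ℝ 2 f x) (e : Eucl n) :
    DifferentiableAt ℝ (fun y => fderiv ℝ f y e) x := by
  have h1 : ContDiffAt ℝ 1 (fderiv ℝ f) x := hf.fderiv_right (by norm_num)
  have h2 := h1.differentiableAt (by norm_num)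
  exact h2.clm_apply (differentiableAt_const e)

theorem ev_diff {n : ℕ} {f : Eucl n → ℝ} {x : Eucl n}
    (hf : ContDiffAt ℝ 2 f x) : ∀ᶠ y in 𝓝 x, DifferentiableAt ℝ f y := by
  filter_upwards [hf.eventually (by norm_num)] with y hy
  exact hy.differentiableAt (by norm_num)

theorem HarmAt.add {n : ℕ} {f g : Eucl n → ℝ} {x : Eucl n}
    (hf : HarmAt f x) (hg : HarmAt g x) : HarmAt (fun y => f y + g y) x := by
  refine ⟨hf.1.add hg.1, ?_⟩
  have key : lap (fun y => f y + g y) x = lap f x + lap g x := by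
    unfold lap
    rw [← Finset.sum_add_distrib]
    refine Finset.sum_congr rfl fun i _ => ?_
    have : (fun y => fderiv ℝ (fun y => f y + g y) y (EuclideanSpace.single i (1:ℝ))) =ᶠ[𝓝 x]
        fun y => fderiv ℝ f y (EuclideanSpace.single i (1:ℝ))
          + fderiv ℝ g y (EuclideanSpace.single i (1:ℝ)) := by
      filter_upwards [ev_diff hf.1, ev_diff hg.1] with y h1 h2
      rw [fderiv_fun_add h1 h2]; rfl
    rw [this.fderiv_eq, fderiv_fun_add (diffAt_fderiv_apply hf.1 _) (diffAt_fderiv_apply hg.1 _)]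
    rfl
  rw [key, hf.2, hg.2, add_zero]

theorem HarmAt.const_mul {n : ℕ} {f : Eucl n → ℝ} {x : Eucl n}
    (hf : HarmAt f x) (c : ℝ) : HarmAt (fun y => c * f y) x := by
  refine ⟨contDiffAt_const.mul hf.1, ?_⟩
  have key : lap (fun y => c * f y) x = c * lap f x := by
    unfold lap
    rw [Finset.mul_sum]
    refine Finset.sum_congr rfl fun i _ => ?_
    have : (fun y => fderiv ℝ (fun y => c * f y) y (EuclideanSpace.single i (1:ℝ))) =ᶠ[𝓝 x]
        fun y => c * fderiv ℝ f y (EuclideanSpace.single i (1:ℝ)) := by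
      filter_upwards [ev_diff hf.1] with y h1
      rw [fderiv_const_mul h1]; rfl
    rw [this.fderiv_eq, fderiv_const_mul (diffAt_fderiv_apply hf.1 _)]
    rfl
  rw [key, hf.2, mul_zero]

theorem HarmAt.const {n : ℕ} (c : ℝ) (x : Eucl n) : HarmAt (fun _ => c) x := by
  refine ⟨contDiffAt_const, ?_⟩
  simp [lap]

theorem HarmAt.sum {n : ℕ} {ι : Type*} (t : Finset ι) (f : ι → Eucl n → ℝ) (x : Eucl n)
    (hf : ∀ i ∈ t, HarmAt (f i) x) : HarmAt (fun y => ∑ i ∈ t, f i y) x := by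
  classical
  induction t using Finset.induction_on with
  | empty => simpa using HarmAt.const 0 x
  | insert a s ha ih =>
    have := (hf a (by simp)).add (ih fun i hi => hf i (by simp [hi]))
    simpa [Finset.sum_insert ha] using this

theorem hasFDerivAt_norm' {n : ℕ} {x : Eucl n} (hx : x ≠ 0) :
    HasFDerivAt (fun y : Eucl n => ‖y‖) (‖x‖⁻¹ • innerSL ℝ x) x := by
  have h1 : HasFDerivAt (fun y : Eucl n => ‖y‖ ^ 2) (2 • innerSL ℝ x) x :=
    (hasStrictFDerivAt_norm_sq x).hasFDerivAt
  have h2 : DifferentiableAt ℝ (fun y : Eucl n => ‖y‖) x :=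
    (contDiffAt_norm (n := 1) ℝ hx).differentiableAt (by norm_num)
  have h3 := h2.hasFDerivAt.pow 2
  have h4 := h1.unique h3
  have hn : ‖x‖ ≠ 0 := norm_ne_zero_iff.mpr hx
  have : fderiv ℝ (fun y : Eucl n => ‖y‖) x = ‖x‖⁻¹ • innerSL ℝ x := by
    ext y
    have h5 := DFunLike.congr_fun h4 y
    simp at h5
    simp
    field_simp
    linarith
  rw [← this]
  exact h2.hasFDerivAt

/-- radial harmonic functions -/
theorem harmAt_radial {n : ℕ} (hn : 2 ≤ n) (g : ℝ → ℝ) (C : ℝ)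
    (hg : ∀ t > 0, HasDerivAt g (C * (t ^ (n - 1))⁻¹) t) (z x : Eucl n) (hx : x ≠ z) :
    HarmAt (fun y => g ‖y - z‖) x := by
  have hgc : ContDiffOn ℝ 2 g (Ioi 0) := by
    have : ContDiffOn ℝ (1 + 1) g (Ioi 0) := by
      rw [contDiffOn_succ_iff_deriv_of_isOpen isOpen_Ioi]
      refine ⟨fun t ht => (hg t ht).differentiableAt.differentiableWithinAt, by simp, ?_⟩
      have : ContDiffOn ℝ 1 (fun t : ℝ => C * (t ^ (n - 1))⁻¹) (Ioi 0) := by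
        refine contDiffOn_const.mul (ContDiffOn.inv (by fun_prop) ?_)
        intro t ht
        exact pow_ne_zero _ (ne_of_gt ht)
      exact this.congr fun t ht => (hg t ht).deriv
    exact this
  have hpos : ∀ y : Eucl n, y ≠ z → 0 < ‖y - z‖ := fun y hy => norm_pos_iff.mpr (sub_ne_zero.mpr hy)
  refine ⟨?_, ?_⟩
  · have h1 : ContDiffAt ℝ 2 (fun y : Eucl n => ‖y - z‖) x :=
      ContDiffAt.norm ℝ (by fun_prop) (sub_ne_zero.mpr hx)
    exact ContDiffAt.comp (g := g) x (hgc.contDiffAt (Ioi_mem_nhds (hpos x hx))) h1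
  · have hnorm : ∀ y : Eucl n, y ≠ z →
        HasFDerivAt (fun y : Eucl n => ‖y - z‖) (‖y - z‖⁻¹ • innerSL ℝ (y - z)) y := by
      intro y hy
      have h1 := hasFDerivAt_norm' (sub_ne_zero.mpr hy)
      have h2 : HasFDerivAt (fun y : Eucl n => y - z) (ContinuousLinearMap.id ℝ (Eucl n)) y :=
        (hasFDerivAt_id y).sub_const z
      have h3 := h1.comp y h2
      rw [ContinuousLinearMap.comp_id] at h3
      exact h3
    have hD : ∀ y : Eucl n, y ≠ z → ∀ e : Eucl n, fderiv ℝ (fun y => g ‖y - z‖) y e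
        = C * (inner ℝ (y - z) e * (‖y - z‖ ^ n)⁻¹) := by
      intro y hy e
      have h1 := (hg _ (hpos y hy)).comp_hasFDerivAt y (hnorm y hy)
      rw [show (fun y => g ‖y - z‖) = g ∘ (fun y => ‖y - z‖) from rfl, h1.fderiv]
      have h0 := (hpos y hy).ne'
      simp only [smul_apply, innerSL_apply_apply, smul_eq_mul]
      have : ‖y - z‖ ^ n = ‖y - z‖ ^ (n - 1) * ‖y - z‖ := by
        rw [← pow_succ]; congr 1; omega
      rw [this]
      field_simp
    have hev : ∀ᶠ y in 𝓝 x, y ≠ z := isOpen_ne.mem_nhds hx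
    have h0 := (hpos x hx).ne'
    have hterm : ∀ e : Eucl n, fderiv ℝ (fun y => fderiv ℝ (fun y => g ‖y - z‖) y e) x e
        = C * (inner ℝ e e * (‖x - z‖ ^ n)⁻¹
            - n * (inner ℝ (x - z) e) ^ 2 * (‖x - z‖ ^ (n + 2))⁻¹) := by
      intro e
      have h1 : (fun y => fderiv ℝ (fun y => g ‖y - z‖) y e) =ᶠ[𝓝 x]
          fun y => C * (inner ℝ (y - z) e * (‖y - z‖ ^ n)⁻¹) := by
        filter_upwards [hev] with y hy using hD y hy e
      rw [h1.fderiv_eq]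
      have h2 : HasFDerivAt (fun y : Eucl n => inner ℝ (y - z) e) (innerSL ℝ e) x := by
        have : (fun y : Eucl n => inner ℝ (y - z) e) = fun y => innerSL ℝ e y - inner ℝ z e := by
          ext y; simp [inner_sub_left, real_inner_comm]
        rw [this]
        exact (innerSL ℝ e).hasFDerivAt.sub_const _
      have hd : HasDerivAt (fun t : ℝ => (t ^ n)⁻¹)
          (-(n * ‖x - z‖ ^ (n - 1)) / (‖x - z‖ ^ n) ^ 2) ‖x - z‖ :=
        (hasDerivAt_pow n _).fun_inv (pow_ne_zero _ h0)
      have h3 := hd.comp_hasFDerivAt x (hnorm x hx)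
      have h4 := (h2.mul h3).const_mul C
      have h5 : fderiv ℝ (fun y => C * (inner ℝ (y - z) e * (‖y - z‖ ^ n)⁻¹)) x = _ := h4.fderiv
      rw [h5]
      simp only [smul_apply, add_apply, innerSL_apply_apply, smul_eq_mul, Function.comp]
      have e1 : ‖x - z‖ ^ n = ‖x - z‖ ^ (n - 1) * ‖x - z‖ := by
        rw [← pow_succ]; congr 1; omega
      have e2 : ‖x - z‖ ^ (n + 2) = ‖x - z‖ ^ (n - 1) * ‖x - z‖ ^ 3 := by
        rw [← pow_add]; congr 1; omega
      rw [e1, e2]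
      field_simp
      ring
    unfold lap
    simp_rw [hterm]
    rw [← Finset.mul_sum, Finset.sum_sub_distrib]
    have s1 : ∑ i : Fin n, (inner ℝ (EuclideanSpace.single i (1:ℝ)) (EuclideanSpace.single i (1:ℝ)) * (‖x - z‖ ^ n)⁻¹ : ℝ) = n * (‖x - z‖ ^ n)⁻¹ := by
      simp
    have s2 : ∑ i : Fin n, ((n:ℝ) * (inner ℝ (x - z) (EuclideanSpace.single i (1:ℝ))) ^ 2 * (‖x - z‖ ^ (n + 2))⁻¹) = n * (‖x - z‖ ^ n)⁻¹ := by
      rw [← Finset.sum_mul, ← Finset.mul_sum]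
      have : ∑ i : Fin n, (inner ℝ (x - z) (EuclideanSpace.single i (1:ℝ)) : ℝ) ^ 2 = ‖x - z‖ ^ 2 := by
        rw [EuclideanSpace.norm_sq_eq]
        simp [EuclideanSpace.inner_single_right]
      rw [this, pow_add]
      field_simp
    rw [s1, s2]; simp

/-! ### The truncated kernel -/

def kern (n : ℕ) (ε t : ℝ) : ℝ := ∫ s in (8 / 3 * t)..(4 * ε), (s ^ (n - 1))⁻¹

theorem kern_ii {n : ℕ} {a b : ℝ} (ha : 0 < a) (hb : 0 < b) :
    IntervalIntegrable (fun s : ℝ => (s ^ (n - 1))⁻¹) volume a b := by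
  apply ContinuousOn.intervalIntegrable
  refine ContinuousOn.inv₀ (by fun_prop) ?_
  intro s hs
  have : 0 < s := lt_of_lt_of_le (lt_min ha hb) hs.1
  positivity

theorem kern_hasDerivAt {n : ℕ} {ε : ℝ} (hε : 0 < ε) (t : ℝ) (ht : 0 < t) :
    HasDerivAt (kern n ε) (-(8 / 3) * ((8 / 3 : ℝ) ^ (n - 1))⁻¹ * (t ^ (n - 1))⁻¹) t := by
  have h0 : 0 < 8 / 3 * t := by positivity
  have h1 : HasDerivAt (fun a => ∫ s in a..(4 * ε), (s ^ (n - 1))⁻¹)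
      (-((8 / 3 * t) ^ (n - 1))⁻¹) (8 / 3 * t) := by
    apply intervalIntegral.integral_hasDerivAt_left (kern_ii h0 (by positivity))
    · exact Measurable.stronglyMeasurable (by fun_prop) |>.stronglyMeasurableAtFilter
    · exact ContinuousAt.inv₀ (by fun_prop) (by positivity)
  have h2 : HasDerivAt (fun t : ℝ => 8 / 3 * t) (8 / 3) t := by
    simpa using (hasDerivAt_id t).const_mul (8 / 3 : ℝ)
  have h3 := h1.comp t h2
  have : -(8 / 3) * ((8 / 3 : ℝ) ^ (n - 1))⁻¹ * (t ^ (n - 1))⁻¹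
      = -((8 / 3 * t) ^ (n - 1))⁻¹ * (8 / 3) := by
    rw [mul_pow, mul_inv]; ring
  rw [this]
  exact h3

theorem kern_nonpos {n : ℕ} {ε t : ℝ} (hε : 0 < ε) (ht : 3 / 2 * ε ≤ t) : kern n ε t ≤ 0 := by
  unfold kern
  rw [intervalIntegral.integral_symm, neg_nonpos]
  apply intervalIntegral.integral_nonneg (by linarith)
  intro s hs
  have : 0 < s := by linarith [hs.1]
  positivity

theorem kern_lower {n : ℕ} {ε t : ℝ} (hε : 0 < ε) (ht0 : 0 < t) (ht : t ≤ ε) :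
    4 / 3 * ε * ((4 * ε) ^ (n - 1))⁻¹ ≤ kern n ε t := by
  unfold kern
  have h1 : (∫ s in (8 / 3 * t)..(8 / 3 * ε), (s ^ (n - 1))⁻¹) +
      (∫ s in (8 / 3 * ε)..(4 * ε), (s ^ (n - 1))⁻¹)
      = ∫ s in (8 / 3 * t)..(4 * ε), (s ^ (n - 1))⁻¹ :=
    intervalIntegral.integral_add_adjacent_intervals (kern_ii (by positivity) (by positivity))
      (kern_ii (by positivity) (by positivity))
  have h2 : 0 ≤ ∫ s in (8 / 3 * t)..(8 / 3 * ε), (s ^ (n - 1))⁻¹ := by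
    apply intervalIntegral.integral_nonneg (by linarith)
    intro s hs
    have : 0 < s := by linarith [hs.1]
    positivity
  have h3 : (∫ s in (8 / 3 * ε)..(4 * ε), ((4 * ε) ^ (n - 1))⁻¹) ≤
      ∫ s in (8 / 3 * ε)..(4 * ε), (s ^ (n - 1))⁻¹ := by
    apply intervalIntegral.integral_mono_on (by linarith) (by simp)
      (kern_ii (by positivity) (by positivity))
    intro s hs
    have : 0 < s := by linarith [hs.1]
    gcongr
    exact hs.2
  rw [intervalIntegral.integral_const, smul_eq_mul] at h3
  rw [← h1]
  have : 4 / 3 * ε = 4 * ε - 8 / 3 * ε := by ring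
  rw [this]
  linarith

theorem kern_le_lintegral {n : ℕ} {ε t : ℝ} (hε : 0 < ε) (ht : 0 < t) :
    ENNReal.ofReal (kern n ε t) ≤ ∫⁻ r in Ioo (0 : ℝ) (4 * ε),
      (Ioi (8 / 3 * t)).indicator (fun r => ENNReal.ofReal ((r ^ (n - 1))⁻¹)) r := by
  have h0 : 0 < 8 / 3 * t := by positivity
  rcases le_or_gt (4 * ε) (8 / 3 * t) with h | h
  · rw [ENNReal.ofReal_of_nonpos (kern_nonpos hε (by linarith))]
    exact zero_le
  · unfold kern
    rw [intervalIntegral.integral_of_le h.le, integral_Ioc_eq_integral_Ioo]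
    rw [ofReal_integral_eq_lintegral_ofReal]
    · rw [setLIntegral_indicator measurableSet_Ioi]
      apply lintegral_mono_set
      intro r hr
      exact ⟨hr.1, h0.trans hr.1, hr.2⟩
    · have := (kern_ii (n := n) h0 (by positivity : 0 < 4 * ε)).1
      exact this.mono_set Ioo_subset_Ioc_self
    · filter_upwards [ae_restrict_mem measurableSet_Ioo] with r hr
      have : 0 < r := h0.trans hr.1
      simp only [Pi.zero_apply]
      positivity

/-! ### Discretisation -/

theorem exists_simple {n : ℕ} (F : Set (Eucl n)) (hF : IsCompact F) (hne : F.Nonempty)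
    (τ : ℝ) (hτ : 0 < τ) :
    ∃ s : SimpleFunc (Eucl n) (Eucl n), (∀ y, s y ∈ F) ∧ ∀ y ∈ F, dist y (s y) < τ := by
  classical
  obtain ⟨y0, hy0⟩ := hne
  obtain ⟨t, htF, htf, htc⟩ := hF.finite_cover_balls hτ
  lift t to Finset (Eucl n) using htf
  suffices H : ∀ t : Finset (Eucl n), (t : Set (Eucl n)) ⊆ F →
      ∃ s : SimpleFunc (Eucl n) (Eucl n), (∀ y, s y ∈ F) ∧ 
        ∀ y ∈ ⋃ z ∈ t, ball z τ, dist y (s y) < τ by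
    obtain ⟨s, h1, h2⟩ := H t htF
    exact ⟨s, h1, fun y hy => h2 y (by simpa using htc hy)⟩
  intro t
  induction t using Finset.induction_on with
  | empty => exact fun _ => ⟨SimpleFunc.const _ y0, fun _ => hy0, by simp⟩
  | insert a t ha ih =>
    intro hat
    obtain ⟨s, h1, h2⟩ := ih (fun z hz => hat (by simp [Finset.mem_coe.1 hz]))
    refine ⟨SimpleFunc.piecewise (ball a τ) measurableSet_ball (SimpleFunc.const _ a) s, ?_, ?_⟩
    · intro y
      by_cases hy : y ∈ ball a τ
      · simpa [SimpleFunc.coe_piecewise, hy, Set.piecewise] using hat (by simp)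
      · simpa [SimpleFunc.coe_piecewise, Set.piecewise, hy] using h1 y
    · intro y hy
      by_cases hya : y ∈ ball a τ
      · have h' : dist y a < τ := hya
        simp only [SimpleFunc.coe_piecewise, Set.piecewise, hya, if_true]
        exact h'
      · have : y ∈ ⋃ z ∈ t, ball z τ := by
          simp only [Finset.mem_insert, iUnion_iUnion_eq_or_left, mem_union] at hy
          exact hy.resolve_left hya
        simpa [SimpleFunc.coe_piecewise, Set.piecewise, hya] using h2 y this

/-! ### The discretised potential -/

theorem ofReal_sum_le' {ι : Type*} (t : Finset ι) (f : ι → ℝ) :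
    ENNReal.ofReal (∑ i ∈ t, f i) ≤ ∑ i ∈ t, ENNReal.ofReal (f i) := by
  classical
  induction t using Finset.induction_on with
  | empty => simp
  | insert a s ha ih =>
    rw [Finset.sum_insert ha, Finset.sum_insert ha]
    exact ENNReal.ofReal_add_le.trans (by gcongr)

def pot {n : ℕ} (ν : Measure (Eucl n)) (s : SimpleFunc (Eucl n) (Eucl n)) (ε : ℝ)
    (x : Eucl n) : ℝ :=
  ∑ z ∈ s.range, (ν (s ⁻¹' {z})).toReal * kern n ε ‖x - z‖

theorem pot_harm {n : ℕ} (hn : 2 ≤ n) (ν : Measure (Eucl n))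
    (s : SimpleFunc (Eucl n) (Eucl n)) {ε : ℝ} (hε : 0 < ε)
    (x : Eucl n) (hx : ∀ y, x ≠ s y) : HarmAt (pot ν s ε) x := by
  apply HarmAt.sum
  intro z hz
  apply HarmAt.const_mul
  apply harmAt_radial hn _ _ (fun t ht => kern_hasDerivAt hε t ht)
  obtain ⟨y, rfl⟩ := SimpleFunc.mem_range.1 hz
  exact hx y

theorem pot_nonpos {n : ℕ} (ν : Measure (Eucl n))
    (s : SimpleFunc (Eucl n) (Eucl n)) {ε : ℝ} (hε : 0 < ε)
    (x : Eucl n) (hx : ∀ y, 3 / 2 * ε ≤ dist x (s y)) : pot ν s ε x ≤ 0 := by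
  apply Finset.sum_nonpos
  intro z hz
  obtain ⟨y, rfl⟩ := SimpleFunc.mem_range.1 hz
  exact mul_nonpos_of_nonneg_of_nonpos ENNReal.toReal_nonneg
    (kern_nonpos hε (by rw [← dist_eq_norm]; exact hx y))

theorem pot_lower {n : ℕ} (ν : Measure (Eucl n)) [IsFiniteMeasure ν]
    (s : SimpleFunc (Eucl n) (Eucl n)) {ε : ℝ} (hε : 0 < ε)
    (x : Eucl n) (hx0 : ∀ y, x ≠ s y) (hx : ∀ y, dist x (s y) ≤ ε) :
    (ν univ).toReal * (4 / 3 * ε * ((4 * ε) ^ (n - 1))⁻¹) ≤ pot ν s ε x := by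
  rw [← s.sum_range_measure_preimage_singleton ν,
    ENNReal.toReal_sum (fun _ _ => measure_ne_top _ _), Finset.sum_mul]
  apply Finset.sum_le_sum
  intro z hz
  obtain ⟨y, rfl⟩ := SimpleFunc.mem_range.1 hz
  apply mul_le_mul_of_nonneg_left _ ENNReal.toReal_nonneg
  apply kern_lower hε
  · exact norm_pos_iff.mpr (sub_ne_zero.mpr (hx0 y))
  · rw [← dist_eq_norm]; exact hx y

theorem pot_upper {n : ℕ} (μ : Measure (Eucl n)) (K F : Set (Eucl n)) (hF : MeasurableSet F)
    (hFK : F ⊆ K)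
    (hFt : μ F ≠ ⊤) (s : SimpleFunc (Eucl n) (Eucl n)) {ε τ : ℝ} (hε : 0 < ε) (hτ : 0 < τ)
    (hs : ∀ y, s y ∈ F) (hs2 : ∀ y ∈ F, dist y (s y) < τ / 4)
    (h : ℝ → ℝ) (hpos : ∀ r : ℝ, 0 < r → 0 < h r) (B Q : ℝ) (hB : 0 < B) (hQ : 0 ≤ Q)
    (h2 : ∀ x ∈ K, ∀ r : ℝ, 0 < r → r < 4 * ε → μ (K ∩ ball x r) ≤ ENNReal.ofReal (B * h r))
    (hI : ∫⁻ r in Ioo (0 : ℝ) (4 * ε), ENNReal.ofReal (h r / r ^ (n - 1)) ≤ ENNReal.ofReal Q)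
    (x : Eucl n) (hx : ∀ y ∈ F, τ ≤ dist x y) :
    pot (μ.restrict F) s ε x ≤ B * Q := by
  classical
  set ν := μ.restrict F with hν
  have hνfin : IsFiniteMeasure ν := ⟨by simpa [hν] using hFt.lt_top⟩
  rw [← ENNReal.ofReal_le_ofReal_iff (by positivity)]
  have hball : ∀ r ∈ Ioo (0 : ℝ) (4 * ε),
      ν (s ⁻¹' ↑(s.range.filter fun z => 8 / 3 * ‖x - z‖ < r)) ≤ ENNReal.ofReal (B * h r) := by
    intro r hr
    rw [hν, Measure.restrict_apply' hF]
    have hsub : ∀ y ∈ s ⁻¹' ↑(s.range.filter fun z => 8 / 3 * ‖x - z‖ < r) ∩ F,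
        dist x y < r / 2 := by
      rintro y ⟨hy, hyF⟩
      have h1 : 8 / 3 * dist x (s y) < r := by
        rw [dist_eq_norm]
        simpa using hy
      have h3 := hx _ (hs y)
      have h4 := hs2 y hyF
      have h5 := dist_triangle x (s y) y
      rw [dist_comm (s y) y] at h5
      linarith
    rcases Set.eq_empty_or_nonempty (s ⁻¹' ↑(s.range.filter fun z => 8 / 3 * ‖x - z‖ < r) ∩ F)
      with he | ⟨y1, hy1⟩
    · rw [he]; simp
    · refine le_trans (measure_mono ?_) (h2 y1 (hFK hy1.2) r hr.1 hr.2)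
      intro y hy
      refine ⟨hFK hy.2, ?_⟩
      have a1 := hsub y hy
      have a2 := hsub y1 hy1
      have a3 := dist_triangle y x y1
      rw [dist_comm y x] at a3
      rw [mem_ball]; linarith
  have hxz : ∀ z ∈ s.range, 0 < ‖x - z‖ := by
    intro z hz
    obtain ⟨y, rfl⟩ := SimpleFunc.mem_range.1 hz
    rw [← dist_eq_norm]
    exact hτ.trans_le (hx _ (hs y))
  have hmeas : ∀ z : Eucl n, Measurable
      ((Ioi (8 / 3 * ‖x - z‖)).indicator (fun r : ℝ => ENNReal.ofReal ((r ^ (n - 1))⁻¹))) := by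
    intro z
    exact Measurable.indicator (by fun_prop) measurableSet_Ioi
  calc ENNReal.ofReal (pot ν s ε x)
      ≤ ∑ z ∈ s.range, ENNReal.ofReal ((ν (s ⁻¹' {z})).toReal * kern n ε ‖x - z‖) :=
        ofReal_sum_le' _ _
    _ = ∑ z ∈ s.range, ν (s ⁻¹' {z}) * ENNReal.ofReal (kern n ε ‖x - z‖) := by
        refine Finset.sum_congr rfl fun z _ => ?_
        rw [ENNReal.ofReal_mul ENNReal.toReal_nonneg, ENNReal.ofReal_toReal (measure_ne_top _ _)]
    _ ≤ ∑ z ∈ s.range, ν (s ⁻¹' {z}) * ∫⁻ r in Ioo (0 : ℝ) (4 * ε),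
          (Ioi (8 / 3 * ‖x - z‖)).indicator (fun r => ENNReal.ofReal ((r ^ (n - 1))⁻¹)) r := by
        refine Finset.sum_le_sum fun z hz => ?_
        gcongr
        exact kern_le_lintegral hε (hxz z hz)
    _ = ∫⁻ r in Ioo (0 : ℝ) (4 * ε), ∑ z ∈ s.range, ν (s ⁻¹' {z}) *
          (Ioi (8 / 3 * ‖x - z‖)).indicator (fun r => ENNReal.ofReal ((r ^ (n - 1))⁻¹)) r := by
        rw [lintegral_finsetSum _ (fun z _ => (hmeas z).const_mul _)]
        refine Finset.sum_congr rfl fun z _ => ?_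
        rw [lintegral_const_mul _ (hmeas z)]
    _ ≤ ∫⁻ r in Ioo (0 : ℝ) (4 * ε), ENNReal.ofReal B * ENNReal.ofReal (h r / r ^ (n - 1)) := by
        refine setLIntegral_mono' measurableSet_Ioo fun r hr => ?_
        have e1 : ∑ z ∈ s.range, ν (s ⁻¹' {z}) *
            (Ioi (8 / 3 * ‖x - z‖)).indicator (fun r => ENNReal.ofReal ((r ^ (n - 1))⁻¹)) r
            = ν (s ⁻¹' ↑(s.range.filter fun z => 8 / 3 * ‖x - z‖ < r))
              * ENNReal.ofReal ((r ^ (n - 1))⁻¹) := by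
          rw [← s.sum_measure_preimage_singleton, Finset.sum_mul, Finset.sum_filter]
          refine Finset.sum_congr rfl fun z _ => ?_
          by_cases hz : 8 / 3 * ‖x - z‖ < r
          · rw [if_pos hz, Set.indicator_of_mem (by exact hz)]
          · rw [if_neg hz, Set.indicator_of_notMem (by exact hz), mul_zero]
        rw [e1]
        refine (mul_le_mul_left (hball r hr) _).trans (le_of_eq ?_)
        have hr0 := hr.1
        have := hpos r hr0
        rw [← ENNReal.ofReal_mul (by positivity), ← ENNReal.ofReal_mul hB.le]
        congr 1
        rw [div_eq_mul_inv]; ring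
    _ = ENNReal.ofReal B * ∫⁻ r in Ioo (0 : ℝ) (4 * ε), ENNReal.ofReal (h r / r ^ (n - 1)) :=
        lintegral_const_mul' _ _ ENNReal.ofReal_ne_top
    _ ≤ ENNReal.ofReal B * ENNReal.ofReal Q := by gcongr
    _ = ENNReal.ofReal (B * Q) := (ENNReal.ofReal_mul hB.le).symm

/-- **Main Theorem 2** (comparison theorem for subharmonic functions). Let `u` be upper
semicontinuous and `v` subharmonic on a domain `Ω ⊆ ℝⁿ` (`n ≥ 2`), `K ⊆ Ω` Borel, and
`h : (0,∞) → (0,∞)` with `∫₀^{cε} h(r)/r^{n-1} dr ≤ M h(ε)/ε^{n-2}` for small `ε`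
(`M > 0`, `c > 4`). If a positive Borel measure `μ`, constants `A, B > 0`, `ε₀ > 0` and
`N ⊆ K` satisfy `μ(N) = 0`, `A h(ε) ≤ μ(K ∩ B(x,ε)) ≤ B h(ε)` for all `x ∈ K`, `ε < ε₀`,
and `u ≥ v` on `K \ N`, then `u ≥ v` on `K`. -/
theorem main_theorem_2 {n : ℕ} (hn : 2 ≤ n)
    (Ω : Set (Eucl n)) (hΩ : IsOpen Ω) (hΩconn : IsConnected Ω)
    (u : Eucl n → EReal) (hu : UpperSemicontinuousOn u Ω) (hu' : ∀ x ∈ Ω, u x < ⊤)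
    (v : Eucl n → EReal) (hv : IsSubharmonicOn v Ω)
    (K : Set (Eucl n)) (hK : MeasurableSet K) (hKΩ : K ⊆ Ω)
    (h : ℝ → ℝ) (hpos : ∀ r : ℝ, 0 < r → 0 < h r)
    (M c : ℝ) (hM : 0 < M) (hc : 4 < c)
    (hint : ∃ ε₁ > (0 : ℝ), ∀ ε : ℝ, 0 < ε → ε ≤ ε₁ →
      ∫⁻ r in Ioo (0 : ℝ) (c * ε), ENNReal.ofReal (h r / r ^ (n - 1)) ≤
        ENNReal.ofReal (M * (h ε / ε ^ (n - 2))))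
    (μ : Measure (Eucl n)) (A B ε₀ : ℝ) (hA : 0 < A) (hB : 0 < B) (hε₀ : 0 < ε₀)
    (N : Set (Eucl n)) (hNK : N ⊆ K) (hN : μ N = 0)
    (h2 : ∀ x ∈ K, ∀ ε : ℝ, 0 < ε → ε < ε₀ →
      ENNReal.ofReal (A * h ε) ≤ μ (K ∩ ball x ε) ∧
        μ (K ∩ ball x ε) ≤ ENNReal.ofReal (B * h ε))
    (h3 : ∀ x ∈ K \ N, v x ≤ u x) :
    ∀ x ∈ K, v x ≤ u x := by
  intro x0 hx0K
  by_contra hlt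
  rw [not_le] at hlt
  obtain ⟨hvusc, hvtop, -, hvmax⟩ := hv
  obtain ⟨ε₁, hε₁, hint⟩ := hint
  have hx0N : x0 ∈ N := by
    by_contra hc'
    exact absurd (h3 x0 ⟨hx0K, hc'⟩) (not_le.mpr hlt)
  have hx0Ω := hKΩ hx0K
  obtain ⟨a, hua, hav⟩ := EReal.lt_iff_exists_real_btwn.1 hlt
  obtain ⟨V, hV⟩ : ∃ V : ℝ, v x0 = (V : EReal) :=
    ⟨(v x0).toReal, (EReal.coe_toReal (hvtop x0 hx0Ω).ne (ne_bot_of_gt hav)).symm⟩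
  have haV : a < V := by rw [hV] at hav; exact_mod_cast hav
  set δ : ℝ := 2 / 3 * A * ((4 : ℝ) ^ (n - 1))⁻¹ / (B * M) with hδ
  have hδ0 : 0 < δ := by positivity
  set m : ℝ := a + (V - a) * (1 + δ) with hm
  have hma : 0 < m - a := by rw [hm]; nlinarith
  have hvm : v x0 < (m : EReal) := by
    rw [hV]; exact_mod_cast (by rw [hm]; nlinarith : V < m)
  have hev : ∀ᶠ y in 𝓝 x0, y ∈ Ω ∧ u y < (a : EReal) ∧ v y < (m : EReal) := by
    have e1 := hu x0 hx0Ω _ hua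
    have e2 := hvusc x0 hx0Ω _ hvm
    rw [hΩ.nhdsWithin_eq hx0Ω] at e1 e2
    filter_upwards [hΩ.mem_nhds hx0Ω, e1, e2] with y h1 h2 h3 using ⟨h1, h2, h3⟩
  obtain ⟨ρ, hρ, hball⟩ := Metric.eventually_nhds_iff_ball.1 hev
  obtain ⟨ε, hε, hεε₁, hεε₀, hερ⟩ : ∃ ε : ℝ, 0 < ε ∧ ε ≤ ε₁ ∧ 4 * ε ≤ ε₀ ∧ 3 * ε ≤ ρ := by
    refine ⟨min ε₁ (min (ε₀ / 4) (ρ / 3)), by positivity, min_le_left _ _, ?_, ?_⟩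
    · have : min ε₁ (min (ε₀ / 4) (ρ / 3)) ≤ ε₀ / 4 := (min_le_right _ _).trans (min_le_left _ _)
      linarith
    · have : min ε₁ (min (ε₀ / 4) (ρ / 3)) ≤ ρ / 3 := (min_le_right _ _).trans (min_le_right _ _)
      linarith
  have hhε := hpos ε hε
  obtain ⟨hlow, hupp⟩ := h2 x0 hx0K ε hε (by linarith)
  -- the compact set
  set N' := toMeasurable μ N with hN'
  have hN'0 : μ N' = 0 := by rw [hN', measure_toMeasurable, hN]
  set D := (K ∩ ball x0 ε) \ N' with hD
  have hDm : MeasurableSet D :=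
    (hK.inter measurableSet_ball).diff (measurableSet_toMeasurable _ _)
  have hμD : μ D = μ (K ∩ ball x0 ε) := measure_sdiff_null hN'0
  have hDfin : μ D ≠ ⊤ := by
    rw [hμD]; exact ne_top_of_le_ne_top ENNReal.ofReal_ne_top hupp
  have hfin : IsFiniteMeasure (μ.restrict D) := ⟨by simpa using hDfin.lt_top⟩
  obtain ⟨F, hFD, hFc, hFlt⟩ : ∃ F ⊆ D, IsCompact F ∧
      ENNReal.ofReal (A * h ε / 2) < (μ.restrict D) F := by
    apply hDm.exists_lt_isCompact_of_ne_top
    · simpa using hDfin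
    · rw [Measure.restrict_apply_self, hμD]
      refine lt_of_lt_of_le ?_ hlow
      rw [ENNReal.ofReal_lt_ofReal_iff (by positivity)]
      have : 0 < A * h ε := by positivity
      linarith
  have hFm : MeasurableSet F := hFc.isClosed.measurableSet
  rw [Measure.restrict_apply hFm, inter_eq_left.mpr hFD] at hFlt
  have hFfin : μ F ≠ ⊤ := ne_top_of_le_ne_top hDfin (measure_mono hFD)
  have hFne : F.Nonempty := by
    by_contra hemp
    rw [not_nonempty_iff_eq_empty] at hemp
    rw [hemp, measure_empty] at hFlt
    exact not_lt_bot hFlt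
  have hFK : F ⊆ K := fun y hy => (hFD hy).1.1
  have hFb : ∀ y ∈ F, dist y x0 < ε := fun y hy => (hFD hy).1.2
  have hFv : ∀ y ∈ F, v y < (a : EReal) := by
    intro y hy
    have hyN : y ∉ N := fun hyN => (hFD hy).2 (subset_toMeasurable μ N hyN)
    have h1 := h3 y ⟨hFK hy, hyN⟩
    have h2 := (hball y (by rw [mem_ball]; linarith [hFb y hy])).2.1
    exact h1.trans_lt h2
  -- neighbourhood of F
  obtain ⟨U, hU, hFU, hUv⟩ : ∃ U, IsOpen U ∧ F ⊆ U ∧ ∀ y ∈ U, v y < (a : EReal) := by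
    refine ⟨interior {y | v y < (a : EReal)}, isOpen_interior, ?_, ?_⟩
    swap
    · intro y hy
      have hy' : y ∈ {y | v y < (a : EReal)} := interior_subset hy
      exact hy'
    intro y hy
    rw [mem_interior_iff_mem_nhds]
    have hyΩ := hKΩ (hFK hy)
    have := hvusc y hyΩ _ (hFv y hy)
    rw [hΩ.nhdsWithin_eq hyΩ] at this
    exact this
  obtain ⟨τ, hτ, hτU⟩ := hFc.exists_cthickening_subset_open hU hFU
  obtain ⟨s, hs1, hs2⟩ := exists_simple F hFc hFne (τ / 4) (by positivity)
  set G : Set (Eucl n) := ball x0 (5 / 2 * ε) \ cthickening τ F with hG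
  have hGo : IsOpen G := isOpen_ball.sdiff isClosed_cthickening
  have hx0G : x0 ∈ G := by
    refine ⟨mem_ball_self (by positivity), fun hx => ?_⟩
    exact absurd (hUv _ (hτU hx)) (not_lt.mpr hav.le)
  have hcl1 : closure G ⊆ closedBall x0 (5 / 2 * ε) :=
    closure_minimal (fun y hy => ball_subset_closedBall hy.1) isClosed_closedBall
  have hcl2 : ∀ x ∈ closure G, ∀ y ∈ F, τ ≤ dist x y := by
    intro x hx y hy
    have : closure G ⊆ {x | τ ≤ dist x y} := by
      refine closure_minimal ?_ (isClosed_le continuous_const (by fun_prop))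
      intro w hw
      by_contra hlt'
      simp only [mem_ofPred_eq, not_le] at hlt'
      exact hw.2 (mem_cthickening_of_dist_le w y τ F hy hlt'.le)
    exact this hx
  have hclρ : ∀ x ∈ closure G, x ∈ Ω ∧ u x < (a : EReal) ∧ v x < (m : EReal) := by
    intro x hx
    apply hball
    have := hcl1 hx
    rw [mem_closedBall] at this
    rw [mem_ball]; linarith
  -- the bound for the potential
  set Q : ℝ := M * (h ε / ε ^ (n - 2)) with hQ
  have hQ0 : 0 < Q := by positivity
  have hI : ∫⁻ r in Ioo (0 : ℝ) (4 * ε), ENNReal.ofReal (h r / r ^ (n - 1))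
      ≤ ENNReal.ofReal Q := by
    refine le_trans (lintegral_mono_set ?_) (hint ε hε hεε₁)
    apply Ioo_subset_Ioo_right
    nlinarith
  set p := pot (μ.restrict F) s ε with hp
  have hpup : ∀ x ∈ closure G, p x ≤ B * Q := fun x hx =>
    pot_upper μ K F hFm hFK hFfin s hε hτ hs1 hs2 h hpos B Q hB hQ0.le
      (fun y hy r hr0 hr => (h2 y hy r hr0 (by linarith)).2) hI x (hcl2 x hx)
  have hne : ∀ x ∈ closure G, ∀ y, x ≠ s y := by
    intro x hx y hxy
    have := hcl2 x hx (s y) (hs1 y)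
    rw [hxy, dist_self] at this
    linarith
  have hharm : ∀ x ∈ closure G,
      HarmAt (fun x => m + (-((m - a) / (B * Q))) * p x) x := fun x hx =>
    (HarmAt.const m x).add ((pot_harm hn _ s hε x (hne x hx)).const_mul _)
  have hmain := hvmax G hGo ((isCompact_closedBall x0 _).of_isClosed_subset isClosed_closure hcl1)
    (fun x hx => (hclρ x hx).1) (fun x => m + (-((m - a) / (B * Q))) * p x)
    ⟨fun x hx => (hharm x (subset_closure hx)).1.contDiffWithinAt,
      fun x hx => (hharm x (subset_closure hx)).2⟩
    (fun x hx => (hharm x hx).1.continuousAt.continuousWithinAt) ?_ x0 hx0G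
  · have hfinF : IsFiniteMeasure (μ.restrict F) := ⟨by simpa using hFfin.lt_top⟩
    have hpl := pot_lower (μ.restrict F) s hε x0 (hne x0 (subset_closure hx0G))
      (fun y => by rw [dist_comm]; exact (hFb _ (hs1 y)).le)
    rw [← hp, Measure.restrict_apply_univ] at hpl
    have hF2 : A * h ε / 2 ≤ (μ F).toReal := by
      rw [← ENNReal.ofReal_le_iff_le_toReal hFfin]; exact hFlt.le
    have hδp : δ * (B * Q) ≤ p x0 := by
      refine le_trans (le_of_eq ?_) (le_trans (mul_le_mul_of_nonneg_right hF2 ?_) hpl)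
      · obtain ⟨k, rfl⟩ : ∃ k, n = k + 2 := ⟨n - 2, by omega⟩
        rw [hδ, hQ]
        simp only [Nat.add_sub_cancel, show k + 2 - 1 = k + 1 by omega, mul_pow]
        field_simp
        ring
      · positivity
    rw [hV, EReal.coe_le_coe_iff] at hmain
    have h5 : (m - a) / (B * Q) * p x0 ≥ (m - a) * δ := by
      have hBQ : 0 < B * Q := by positivity
      calc (m - a) * δ = (m - a) / (B * Q) * (δ * (B * Q)) := by field_simp
        _ ≤ _ := by gcongr
    have h6 : m - a = (V - a) * (1 + δ) := by rw [hm]; ring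
    have h7 : 0 < (V - a) * δ ^ 2 := mul_pos (by linarith) (by positivity)
    have h8 : (m - a) * δ = (V - a) * δ + (V - a) * δ ^ 2 := by rw [h6]; ring
    have h9 : m - a = (V - a) + (V - a) * δ := by rw [h6]; ring
    rw [neg_mul] at hmain
    linarith
  · intro x hx
    have hBQ : 0 < B * Q := by positivity
    have hxcl : x ∈ closure G := hx.1
    have hxG : x ∉ G := by
      have := hx.2
      rwa [hGo.interior_eq] at this
    by_cases hxb : x ∈ ball x0 (5 / 2 * ε)
    · have hxt : x ∈ cthickening τ F := by
        by_contra hxt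
        exact hxG ⟨hxb, hxt⟩
      refine (hUv x (hτU hxt)).le.trans ?_
      rw [EReal.coe_le_coe_iff]
      have h5 : (m - a) / (B * Q) * p x ≤ (m - a) := by
        calc (m - a) / (B * Q) * p x ≤ (m - a) / (B * Q) * (B * Q) := by
              gcongr; exact hpup x hxcl
          _ = m - a := by field_simp
      linarith
    · refine (hclρ x hxcl).2.2.le.trans ?_
      rw [EReal.coe_le_coe_iff]
      rw [mem_ball, not_lt] at hxb
      have h5 : p x ≤ 0 := by
        apply pot_nonpos _ s hε
        intro y
        have := hFb _ (hs1 y)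
        have := dist_triangle x (s y) x0
        linarith
      have : 0 ≤ (m - a) / (B * Q) := by positivity
      nlinarith

end
end

section
/- Let $u$ be a subharmonic function in a domain $\Omega \subseteq \mathbb{R}^n$ ($n \geq 2$) and let $\mathbb{H}$ be a smooth hypersurface in $\mathbb{R}^n$ (an $(n-1)$-dimensional $C^1$ submanifold), with $\sigma$ the surface measure on $\mathbb{H}$ (the $(n-1)$-dimensional Hausdorff measure restricted to $\mathbb{H}$). Then for every $x_0 \in \mathbb{H} \cap \Omega$, $\lim_{\epsilon \to 0} \frac{1}{\sigma(\mathbb{H} \cap \mathbb{B}(x_0,\epsilon))} \int_{\mathbb{H} \cap \mathbb{B}(x_0,\epsilon)} u(x)\, d\sigma(x) = u(x_0)$. -/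
open MeasureTheory Metric Filter Set ENNReal Topology

noncomputable section

/-- `H` is a smooth (`C¹`) hypersurface in `ℝⁿ`: near each of its points it is the regular
zero level set of a `C¹` function (an `(n-1)`-dimensional `C¹` submanifold). -/
def IsC1Hypersurface {n : ℕ} (H : Set (Eucl n)) : Prop :=
  ∀ x ∈ H, ∃ U : Set (Eucl n), IsOpen U ∧ x ∈ U ∧ ∃ f : Eucl n → ℝ,
    ContDiffOn ℝ 1 f U ∧ (∀ y ∈ U, fderiv ℝ f y ≠ 0) ∧ H ∩ U = {y ∈ U | f y = 0}


lemma lap_radial {n : ℕ} (g gd gdd : ℝ → ℝ) (hg : ∀ s, 0 < s → HasDerivAt g (gd s) s)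
    (hg' : ∀ s, 0 < s → HasDerivAt gd (gdd s) s) (x : Eucl n) (hx : x ≠ 0) :
    lap (fun y => g (‖y‖ ^ 2)) x = 4 * ‖x‖ ^ 2 * gdd (‖x‖ ^ 2) + 2 * n * gd (‖x‖ ^ 2) := by
  have hn : ∀ y : Eucl n, HasFDerivAt (fun y : Eucl n => ‖y‖ ^ 2) (2 • innerSL ℝ y) y := by
    intro y
    exact (hasStrictFDerivAt_norm_sq y).hasFDerivAt
  have h1 : ∀ y : Eucl n, y ≠ 0 →
      HasFDerivAt (fun y => g (‖y‖ ^ 2)) (gd (‖y‖ ^ 2) • (2 • innerSL ℝ y)) y := by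
    intro y hy
    exact (hg _ (by positivity)).comp_hasFDerivAt y (hn y)
  have h2 : ∀ i : Fin n, fderiv ℝ (fun y => fderiv ℝ (fun y => g (‖y‖ ^ 2)) y
      (EuclideanSpace.single i 1)) x (EuclideanSpace.single i 1)
      = 4 * gdd (‖x‖ ^ 2) * (x i) ^ 2 + 2 * gd (‖x‖ ^ 2) := by
    intro i
    have he : (fun y => fderiv ℝ (fun y => g (‖y‖ ^ 2)) y (EuclideanSpace.single i (1:ℝ)))
        =ᶠ[𝓝 x] fun y => gd (‖y‖ ^ 2) * (2 * EuclideanSpace.proj (𝕜 := ℝ) i y) := by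
      filter_upwards [isOpen_ne.mem_nhds hx] with y hy
      rw [(h1 y hy).fderiv]
      simp [EuclideanSpace.inner_single_right]
    rw [he.fderiv_eq]
    have h3 : HasFDerivAt (fun y : Eucl n => gd (‖y‖ ^ 2)) (gdd (‖x‖ ^ 2) • (2 • innerSL ℝ x)) x :=
      (hg' _ (by positivity)).comp_hasFDerivAt x (hn x)
    have h4 : HasFDerivAt (fun y : Eucl n => 2 * EuclideanSpace.proj (𝕜 := ℝ) i y)
        ((2:ℝ) • (EuclideanSpace.proj (𝕜 := ℝ) i : Eucl n →L[ℝ] ℝ)) x :=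
      (EuclideanSpace.proj (𝕜 := ℝ) i : Eucl n →L[ℝ] ℝ).hasFDerivAt.const_mul 2
    rw [(h3.fun_mul h4).fderiv]
    simp [EuclideanSpace.inner_single_right]
    ring
  unfold lap
  simp_rw [h2]
  rw [Finset.sum_add_distrib, ← Finset.mul_sum, EuclideanSpace.real_norm_sq_eq]
  simp
  ring

lemma harmonic_radial {n : ℕ} (g gd gdd : ℝ → ℝ) (hg : ∀ s, 0 < s → HasDerivAt g (gd s) s)
    (hg' : ∀ s, 0 < s → HasDerivAt gd (gdd s) s) (hc : ContDiffOn ℝ 2 g (Ioi 0))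
    (h0 : ∀ s, 0 < s → 4 * s * gdd s + 2 * n * gd s = 0) :
    IsHarmonicOn (fun y : Eucl n => g (‖y‖ ^ 2)) {0}ᶜ := by
  constructor
  · refine hc.comp (contDiff_norm_sq ℝ).contDiffOn ?_
    intro y hy
    have : y ≠ 0 := hy
    simp only [mem_Ioi]
    positivity
  · intro x hx
    have : x ≠ 0 := hx
    rw [lap_radial g gd gdd hg hg' x hx]
    exact h0 _ (by positivity)

lemma exists_kernel {n : ℕ} (hn : 2 ≤ n) : ∃ α : ℝ, 0 < α ∧ α < (n - 1 : ℕ) ∧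
    ∀ ε : ℝ, 0 < ε → ∃ k : ℝ → ℝ, IsHarmonicOn (fun y : Eucl n => k ‖y‖) {0}ᶜ ∧
      (∀ r, 2 * ε ≤ r → k r ≤ 0) ∧ (∀ r, 0 < r → r ≤ ε → 1 / 2 ≤ k r) ∧
      ∀ r, 0 < r → k r ≤ 4 * (ε / r) ^ α := by
  rcases hn.eq_or_lt with h | h
  · subst h
    refine ⟨1 / 2, by norm_num, by norm_num, fun ε hε => ⟨fun r => Real.log (2 * ε) + (-1/2) * Real.log (r ^ 2), ?_, ?_, ?_, ?_⟩⟩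
    · refine harmonic_radial (fun s => Real.log (2 * ε) + (-1/2) * Real.log s)
        (fun s => (-1/2) * s⁻¹) (fun s => (-1/2) * (-(s^2)⁻¹)) ?_ ?_ ?_ ?_
      · intro s hs
        exact ((Real.hasDerivAt_log hs.ne').const_mul _).const_add _
      · intro s hs
        exact (hasDerivAt_inv hs.ne').const_mul _
      · refine contDiffOn_const.add (contDiffOn_const.mul ?_)
        exact Real.contDiffOn_log.mono (fun s hs => ne_of_gt hs)
      · intro s hs
        field_simp
        norm_num
    · intro r hr
      have : Real.log (2 * ε) ≤ Real.log r := Real.log_le_log (by positivity) hr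
      simp only [Real.log_pow]
      push_cast; linarith
    · intro r h0 hr
      have : Real.log r ≤ Real.log ε := Real.log_le_log (by positivity) hr
      have h2 := Real.log_two_gt_d9
      simp only [Real.log_pow, Real.log_mul two_ne_zero hε.ne']
      push_cast; linarith
    · intro r hr
      have h1 : Real.log (2 * ε / r) ≤ (2 * ε / r) ^ (1/2:ℝ) / (1/2) :=
        Real.log_le_rpow_div (by positivity) (by norm_num)
      rw [Real.log_div (by positivity) hr.ne', mul_div_assoc, Real.mul_rpow (by norm_num) (by positivity)] at h1
      have h2 : (2:ℝ) ^ (1/2:ℝ) ≤ 2 := by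
        calc (2:ℝ) ^ (1/2:ℝ) ≤ 2 ^ (1:ℝ) := Real.rpow_le_rpow_of_exponent_le (by norm_num) (by norm_num)
          _ = 2 := by simp
      have h3 : 0 ≤ (ε / r) ^ (1/2:ℝ) := by positivity
      simp only [Real.log_pow]
      push_cast
      nlinarith
  · have hn3 : (3:ℝ) ≤ n := by exact_mod_cast h
    set q : ℝ := n - 2 with hq
    have hsub : ((n - 1 : ℕ) : ℝ) = n - 1 := by
      rw [Nat.cast_sub (by omega)]; simp
    refine ⟨q, by linarith, by rw [hsub]; linarith, fun ε hε => ⟨fun r => ε ^ q * (r ^ 2) ^ (-q/2) + (- (1/2)^q), ?_, ?_, ?_, ?_⟩⟩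
    · refine harmonic_radial (fun s => ε ^ q * s ^ (-q/2) + (- (1/2)^q))
        (fun s => ε ^ q * ((-q/2) * s ^ (-q/2-1)))
        (fun s => ε ^ q * ((-q/2) * ((-q/2-1) * s ^ (-q/2-1-1)))) ?_ ?_ ?_ ?_
      · intro s hs
        exact ((Real.hasDerivAt_rpow_const (Or.inl hs.ne')).const_mul _).add_const _
      · intro s hs
        exact ((Real.hasDerivAt_rpow_const (Or.inl hs.ne')).const_mul _).const_mul _
      · refine (contDiffOn_const.mul ?_).add contDiffOn_const
        intro s hs
        exact (Real.contDiffAt_rpow_const (Or.inl (ne_of_gt hs))).contDiffWithinAt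
      · intro s hs
        have : s ^ (-q/2-1) = s ^ (-q/2-1-1) * s := by
          rw [← Real.rpow_add_one hs.ne']; ring_nf
        rw [this]
        have : (n:ℝ) = q + 2 := by linarith
        rw [this]
        ring
    all_goals
      have key : ∀ r : ℝ, 0 < r → ε ^ q * (r ^ 2) ^ (-q/2) = (ε / r) ^ q := by
        intro r hr
        rw [← Real.rpow_natCast, ← Real.rpow_mul hr.le, Real.div_rpow hε.le hr.le]
        rw [show ((2:ℕ):ℝ) * (-q/2) = -q by push_cast; ring, Real.rpow_neg hr.le]
        rfl
    · intro r hr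
      have hr0 : 0 < r := by linarith
      simp only [key r hr0]
      have : (ε / r) ^ q ≤ (1/2) ^ q := by
        apply Real.rpow_le_rpow (by positivity) _ (by linarith)
        rw [div_le_iff₀ hr0]; linarith
      linarith
    · intro r h0 hr
      simp only [key r h0]
      have h1 : 1 ≤ (ε / r) ^ q := by
        apply Real.one_le_rpow _ (by linarith)
        rw [le_div_iff₀ h0]; linarith
      have h2 : (1/2:ℝ) ^ q ≤ (1/2) ^ (1:ℝ) :=
        Real.rpow_le_rpow_of_exponent_ge (by norm_num) (by norm_num) (by linarith)
      rw [Real.rpow_one] at h2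
      linarith
    · intro r h0
      simp only [key r h0]
      have : 0 ≤ (1/2:ℝ)^q := by positivity
      have : 0 ≤ (ε / r) ^ q := by positivity
      linarith

lemma hyp_chart {n : ℕ} (H : Set (Eucl n)) (hH : IsC1Hypersurface H)
    (x₀ : Eucl n) (hx₀ : x₀ ∈ H) :
    ∃ (V : Submodule ℝ (Eucl n)) (π : Eucl n →L[ℝ] V) (δ c : ℝ) (K : NNReal),
      Module.finrank ℝ V + 1 = n ∧ 0 < δ ∧ 0 < c ∧ MeasurableSet (H ∩ ball x₀ δ) ∧
      (∀ y ∈ H ∩ ball x₀ δ, ∀ z ∈ H ∩ ball x₀ δ, dist y z ≤ K * dist (π y) (π z)) ∧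
      ∀ ε, 0 < ε → ε ≤ δ → ball (π x₀) (c * ε) ⊆ π '' (H ∩ ball x₀ ε) := by
  obtain ⟨U, hU, hxU, f, hf, hf', hHU⟩ := hH x₀ hx₀
  have hstrict : HasStrictFDerivAt f (fderiv ℝ f x₀) x₀ :=
    (hf.contDiffAt (hU.mem_nhds hxU)).hasStrictFDerivAt one_ne_zero
  set L := fderiv ℝ f x₀ with hL
  have hL0 : L ≠ 0 := hf' x₀ hxU
  set V : Submodule ℝ (Eucl n) := LinearMap.ker (L : Eucl n →ₗ[ℝ] ℝ) with hV
  obtain ⟨π, hπ⟩ : ∃ π : Eucl n →L[ℝ] V, ∀ x : V, π x = x :=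
    L.ker_closedComplemented_of_finiteDimensional_range
  have hsurj : LinearMap.range (L : Eucl n →ₗ[ℝ] ℝ) = ⊤ := by
    apply LinearMap.range_eq_top.2
    apply LinearMap.surjective
    intro h
    apply hL0
    ext x
    exact LinearMap.congr_fun h x
  have hrank : Module.finrank ℝ V + 1 = n := by
    have := LinearMap.finrank_range_add_finrank_ker (L : Eucl n →ₗ[ℝ] ℝ)
    rw [hsurj, finrank_top, Module.finrank_self, finrank_euclideanSpace_fin] at this
    rw [add_comm]
    exact this
  let P : Eucl n →L[ℝ] ℝ × V := L.prod π
  have hinj : Function.Injective (P : Eucl n →ₗ[ℝ] ℝ × V) := by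
    rw [injective_iff_map_eq_zero]
    intro x hx
    have h1 : L x = 0 := congrArg Prod.fst hx
    have h2 : π x = 0 := congrArg Prod.snd hx
    have h3 := hπ ⟨x, h1⟩
    simp only [h2] at h3
    exact (congrArg Subtype.val h3).symm
  have hdim : Module.finrank ℝ (Eucl n) = Module.finrank ℝ (ℝ × V) := by
    rw [Module.finrank_prod]
    simp
    omega
  let e : Eucl n ≃L[ℝ] ℝ × V :=
    (LinearMap.linearEquivOfInjective (P : Eucl n →ₗ[ℝ] ℝ × V) hinj hdim).toContinuousLinearEquiv
  have heP : (e : Eucl n →L[ℝ] ℝ × V) = P := by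
    ext x : 1
    rfl
  let F : Eucl n → ℝ × V := fun x => (f x, π x)
  have hF : HasStrictFDerivAt F (e : Eucl n →L[ℝ] ℝ × V) x₀ := by
    rw [heP]
    exact hstrict.prodMk π.hasStrictFDerivAt
  obtain ⟨s, hxs, hs, happ⟩ := hF.approximates_deriv_on_open_nhds
  obtain ⟨δ, hδ, hδs⟩ := Metric.isOpen_iff.1 (hs.inter hU) x₀ ⟨hxs, hxU⟩
  have hsub : ∀ ε ≤ δ, ∀ y ∈ ball x₀ ε, y ∈ s ∧ y ∈ U := fun ε hε y hy =>
    hδs (ball_subset_ball hε hy)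
  have hmemH : ∀ y ∈ U, (y ∈ H ↔ f y = 0) := by
    intro y hy
    constructor
    · intro h
      have : y ∈ H ∩ U := ⟨h, hy⟩
      rw [hHU] at this
      exact this.2
    · intro h
      have : y ∈ {y ∈ U | f y = 0} := ⟨hy, h⟩
      rw [← hHU] at this
      exact this.1
  have hnt : Nontrivial (Eucl n) := by
    have : ∃ x, L x ≠ 0 := by
      by_contra! h
      exact hL0 (by ext x; exact h x)
    obtain ⟨x, hx⟩ := this
    exact ⟨x, 0, by rintro rfl; simp at hx⟩
  set N : NNReal := ‖(e.symm : ℝ × V →L[ℝ] Eucl n)‖₊ with hN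
  have hNpos : 0 < N := by
    have := e.symm.norm_pos
    exact this
  refine ⟨V, π, δ, (N:ℝ)⁻¹ / 4, (N⁻¹ - N⁻¹ / 2)⁻¹, hrank, hδ, by positivity, ?_, ?_, ?_⟩
  · have h1 : IsOpen (ball x₀ δ ∩ f ⁻¹' {0}ᶜ) :=
      (hf.continuousOn.mono fun y hy => (hsub δ le_rfl y hy).2).isOpen_inter_preimage isOpen_ball
        isOpen_compl_singleton
    have h2 : H ∩ ball x₀ δ = ball x₀ δ \ (ball x₀ δ ∩ f ⁻¹' {0}ᶜ) := by
      ext y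
      constructor
      · rintro ⟨h, h'⟩
        exact ⟨h', fun h3 => h3.2 ((hmemH y (hsub δ le_rfl y h').2).1 h)⟩
      · rintro ⟨h, h'⟩
        refine ⟨(hmemH y (hsub δ le_rfl y h).2).2 ?_, h⟩
        by_contra h3
        exact h' ⟨h, h3⟩
    rw [h2]
    exact measurableSet_ball.diff h1.measurableSet
  · intro y hy z hz
    have h1 := (happ.antilipschitz (Or.inr (NNReal.half_lt_self (by positivity)))).le_mul_dist
      ⟨y, (hsub δ le_rfl y hy.2).1⟩ ⟨z, (hsub δ le_rfl z hz.2).1⟩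
    have hfy := (hmemH y (hsub δ le_rfl y hy.2).2).1 hy.1
    have hfz := (hmemH z (hsub δ le_rfl z hz.2).2).1 hz.1
    have h2 : dist (F y) (F z) = dist (π y) (π z) := by
      simp [F, Prod.dist_eq, hfy, hfz]
    calc dist y z ≤ _ := h1
      _ = _ := by
        congr 1
  · intro ε hε hεδ v hv
    have h1 := happ.surjOn_closedBall_of_nonlinearRightInverse e.toNonlinearRightInverse
      (ε := ε / 2) (b := x₀) (by positivity)
      (fun y hy => (hsub ε hεδ y (closedBall_subset_ball (by linarith) hy)).1)
    have h2 : ((0:ℝ), v) ∈ closedBall (F x₀)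
        ((((e.toNonlinearRightInverse).nnnorm : ℝ)⁻¹ - ((N⁻¹ / 2 : NNReal) : ℝ)) * (ε / 2)) := by
      have h3 : (((e.toNonlinearRightInverse).nnnorm : ℝ)⁻¹ - ((N⁻¹ / 2 : NNReal) : ℝ)) * (ε / 2)
          = (N:ℝ)⁻¹ / 4 * ε := by
        have : (e.toNonlinearRightInverse).nnnorm = N := rfl
        rw [this]
        push_cast
        ring
      rw [h3, mem_closedBall]
      have h4 : f x₀ = 0 := (hmemH x₀ hxU).1 hx₀
      simp only [F, Prod.dist_eq, h4, dist_self]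
      exact max_le (by positivity) (mem_ball.1 hv).le
    obtain ⟨y, hy, hFy⟩ := h1 h2
    have hyb : y ∈ ball x₀ ε := closedBall_subset_ball (by linarith) hy
    have h5 : f y = 0 := congrArg Prod.fst hFy
    exact ⟨y, ⟨(hmemH y (hsub ε hεδ y hyb).2).2 h5, hyb⟩, congrArg Prod.snd hFy⟩

lemma hyp_geom {n : ℕ} (H : Set (Eucl n)) (hH : IsC1Hypersurface H)
    (x₀ : Eucl n) (hx₀ : x₀ ∈ H) :
    ∃ (δ c C : ℝ), 0 < δ ∧ 0 < c ∧ 0 < C ∧ MeasurableSet (H ∩ ball x₀ δ) ∧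
      (∀ ε, 0 < ε → ε ≤ δ →
        ENNReal.ofReal (c * ε ^ (n - 1)) ≤ μH[((n : ℝ) - 1)] (H ∩ ball x₀ ε)) ∧
      ∀ x r, 0 < r →
        μH[((n : ℝ) - 1)] (H ∩ ball x₀ δ ∩ ball x r) ≤ ENNReal.ofReal (C * r ^ (n - 1)) := by
  obtain ⟨V, π, δ, c, K, hrank, hδ, hc, hmeas, hlip, hsurj⟩ := hyp_chart H hH x₀ hx₀
  have hd : ((n:ℝ) - 1) = (Module.finrank ℝ V : ℝ) := by
    have : ((Module.finrank ℝ V + 1 : ℕ) : ℝ) = n := by exact_mod_cast hrank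
    push_cast at this
    linarith
  have hd' : n - 1 = Module.finrank ℝ V := by omega
  rw [hd, hd']
  set d := Module.finrank ℝ V with hdd
  set B : ℝ≥0∞ := μH[(d:ℝ)] (ball (0:V) 1) with hB
  have hB0 : 0 < B := measure_ball_pos _ _ one_pos
  have hBt : B < ⊤ := measure_ball_lt_top
  have hBr : 0 < B.toReal := ENNReal.toReal_pos hB0.ne' hBt.ne
  have hball : ∀ (v : V) r, 0 < r → μH[(d:ℝ)] (ball v r) = ENNReal.ofReal (r ^ d * B.toReal) := by
    intro v r hr
    rw [Measure.addHaar_ball_of_pos _ _ hr, ENNReal.ofReal_mul (by positivity),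
      ENNReal.ofReal_toReal hBt.ne]
  set Q : ℝ := (‖π‖₊ : ℝ) + 1 with hQ
  have hQ0 : 0 < Q := by positivity
  have hπL : LipschitzWith (‖π‖₊ + 1) π := π.lipschitz.weaken (by simp)
  have hQc : ((‖π‖₊ + 1 : NNReal) : ℝ≥0∞) ^ (d:ℝ) = ENNReal.ofReal (Q ^ d) := by
    rw [ENNReal.rpow_natCast, ENNReal.ofReal_pow hQ0.le]
    congr 1
    rw [ENNReal.ofReal]
    congr 1
    ext
    rw [Real.coe_toNNReal _ hQ0.le]
    simp [hQ]
  refine ⟨δ, (Q ^ d)⁻¹ * (c ^ d * B.toReal), (K + 1) ^ d * (Q ^ d * B.toReal), hδ, by positivity,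
    by positivity, hmeas, ?_, ?_⟩
  · intro ε hε hεδ
    have h1 : μH[(d:ℝ)] (ball (π x₀) (c * ε)) ≤ ENNReal.ofReal (Q ^ d) * μH[(d:ℝ)] (H ∩ ball x₀ ε) := by
      rw [← hQc]
      exact (measure_mono (hsurj ε hε hεδ)).trans
        (hπL.hausdorffMeasure_image_le (Nat.cast_nonneg d) _)
    rw [hball _ _ (by positivity)] at h1
    have h2 : ENNReal.ofReal ((Q ^ d)⁻¹ * (c ^ d * B.toReal) * ε ^ d)
        = (ENNReal.ofReal (Q ^ d))⁻¹ * ENNReal.ofReal ((c * ε) ^ d * B.toReal) := by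
      rw [← ENNReal.ofReal_inv_of_pos (by positivity), ← ENNReal.ofReal_mul (by positivity)]
      congr 1
      rw [mul_pow]; ring
    rw [h2]
    calc _ ≤ (ENNReal.ofReal (Q ^ d))⁻¹ * (ENNReal.ofReal (Q ^ d) * μH[(d:ℝ)] (H ∩ ball x₀ ε)) := by
          gcongr
      _ = _ := by
        rw [← mul_assoc, ENNReal.inv_mul_cancel, one_mul]
        · simpa using pow_pos hQ0 d
        · exact ENNReal.ofReal_ne_top
  · intro x r hr
    set S := H ∩ ball x₀ δ ∩ ball x r with hS
    have hinj : InjOn π S := by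
      intro y hy z hz hyz
      have := hlip y hy.1 z hz.1
      rw [hyz, dist_self, mul_zero] at this
      exact dist_le_zero.1 this
    let g := Function.invFunOn π S
    have hgl : ∀ y ∈ S, g (π y) = y := fun y hy => hinj.leftInvOn_invFunOn hy
    have hgL : LipschitzOnWith K g (π '' S) := by
      apply LipschitzOnWith.of_dist_le_mul
      rintro _ ⟨y, hy, rfl⟩ _ ⟨z, hz, rfl⟩
      rw [hgl y hy, hgl z hz]
      exact hlip y hy.1 z hz.1
    have himg : S = g '' (π '' S) := by
      rw [image_image]
      ext y
      constructor
      · intro hy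
        exact ⟨y, hy, hgl y hy⟩
      · rintro ⟨z, hz, rfl⟩
        simp only [hgl z hz]; exact hz
    have hsubs : π '' S ⊆ ball (π x) (Q * r) := by
      rintro _ ⟨y, hy, rfl⟩
      have h1 := hπL.dist_le_mul y x
      have h2 : dist y x < r := hy.2
      rw [mem_ball]
      calc _ ≤ _ := h1
        _ = Q * dist y x := by simp [hQ]
        _ < Q * r := by gcongr
    calc μH[(d:ℝ)] S = μH[(d:ℝ)] (g '' (π '' S)) := by rw [← himg]
      _ ≤ (K:ℝ≥0∞) ^ (d:ℝ) * μH[(d:ℝ)] (π '' S) := hgL.hausdorffMeasure_image_le (Nat.cast_nonneg d)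
      _ ≤ (K:ℝ≥0∞) ^ (d:ℝ) * ENNReal.ofReal ((Q * r) ^ d * B.toReal) := by
          rw [← hball (π x) (Q * r) (by positivity)]
          gcongr
      _ ≤ ENNReal.ofReal ((K + 1) ^ d) * ENNReal.ofReal ((Q * r) ^ d * B.toReal) := by
          gcongr
          rw [ENNReal.rpow_natCast, ENNReal.ofReal_pow (by positivity)]
          gcongr
          rw [← ENNReal.ofReal_coe_nnreal]
          gcongr
          simp
      _ = _ := by
          rw [← ENNReal.ofReal_mul (by positivity)]
          congr 1
          rw [mul_pow]; ring

lemma weak_int {X : Type*} [MeasurableSpace X] (ν : Measure X) (f : X → ℝ≥0∞)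
    (hf : AEMeasurable f ν) (a p A : ℝ) (ha : 0 < a) (hp : 1 < p) (hA : 0 ≤ A)
    (h : ∀ t : ℝ, 1 ≤ t → ν {x | ENNReal.ofReal (a * t) < f x} ≤ ENNReal.ofReal (A * t ^ (-p))) :
    ∫⁻ x, f x ∂ν ≤ ENNReal.ofReal a *
      (ν univ + ENNReal.ofReal (A * (1 - (2:ℝ) ^ (1 - p))⁻¹)) := by
  let E : ℕ → Set X := fun k => {x | ENNReal.ofReal (a * 2 ^ k) < f x}
  have hE : ∀ k, NullMeasurableSet (E k) ν := fun k =>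
    nullMeasurableSet_lt aemeasurable_const hf
  let G : ℕ → X → ℝ≥0∞ := fun k => (E k).indicator fun _ => ENNReal.ofReal (2 ^ k)
  have hpt : ∀ x, f x ≤ ENNReal.ofReal a * (1 + ∑' k, G k x) := by
    intro x
    have hstep : ∀ m : ℕ, min (f x) (ENNReal.ofReal (a * 2 ^ m)) ≤
        ENNReal.ofReal a * (1 + ∑ k ∈ Finset.range m, G k x) := by
      intro m
      induction m with
      | zero => simp
      | succ m ih =>
        rw [Finset.sum_range_succ]
        by_cases hx : x ∈ E m
        · have h1 : ENNReal.ofReal (a * 2 ^ m) < f x := hx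
          rw [min_eq_right h1.le] at ih
          have h2 : G m x = ENNReal.ofReal (2 ^ m) := by simp [G, hx]
          rw [h2, ← add_assoc, mul_add, ← ENNReal.ofReal_mul ha.le]
          refine (min_le_right _ _).trans ?_
          calc ENNReal.ofReal (a * 2 ^ (m+1))
              = ENNReal.ofReal (a * 2 ^ m) + ENNReal.ofReal (a * 2 ^ m) := by
                rw [← ENNReal.ofReal_add (by positivity) (by positivity)]
                congr 1; ring
            _ ≤ _ := by gcongr
        · have h1 : f x ≤ ENNReal.ofReal (a * 2 ^ m) := not_lt.1 hx
          rw [min_eq_left h1] at ih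
          have h2 : G m x = 0 := by simp [G, hx]
          rw [h2, add_zero]
          exact (min_le_left _ _).trans ih
    set S := ENNReal.ofReal a * (1 + ∑' k, G k x) with hS
    have hstep' : ∀ m : ℕ, min (f x) (ENNReal.ofReal (a * 2 ^ m)) ≤ S := by
      intro m
      refine (hstep m).trans ?_
      rw [hS]
      gcongr
      exact ENNReal.sum_le_tsum _
    by_cases hSt : S = ⊤
    · rw [hSt]; exact le_top
    obtain ⟨m, hm⟩ := pow_unbounded_of_one_lt (S.toReal / a) one_lt_two
    have h3 : S < ENNReal.ofReal (a * 2 ^ m) := by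
      rw [ENNReal.lt_ofReal_iff_toReal_lt hSt]
      rw [div_lt_iff₀ ha] at hm
      linarith
    have h4 := hstep' m
    rcases min_le_iff.1 h4 with h5 | h5
    · exact h5
    · exact absurd h5 (not_le.2 h3)
  have hr0 : 0 < (2:ℝ) ^ (1 - p) := by positivity
  have hr1 : (2:ℝ) ^ (1 - p) < 1 := Real.rpow_lt_one_of_one_lt_of_neg one_lt_two (by linarith)
  have hsum : ∑' k, ∫⁻ x, G k x ∂ν ≤ ENNReal.ofReal (A * (1 - (2:ℝ) ^ (1 - p))⁻¹) := by
    have h1 : ∀ k, ∫⁻ x, G k x ∂ν ≤ ENNReal.ofReal (A * ((2:ℝ) ^ (1 - p)) ^ k) := by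
      intro k
      rw [lintegral_indicator_const₀ (hE k)]
      calc ENNReal.ofReal (2 ^ k) * ν (E k)
          ≤ ENNReal.ofReal (2 ^ k) * ENNReal.ofReal (A * ((2:ℝ) ^ k) ^ (-p)) := by
            gcongr
            exact h _ (one_le_pow₀ one_le_two)
        _ = _ := by
            rw [← ENNReal.ofReal_mul (by positivity)]
            congr 1
            have : ((2:ℝ) ^ (1 - p)) ^ k = (2:ℝ) ^ k * ((2:ℝ) ^ k) ^ (-p) := by
              rw [← Real.rpow_natCast, ← Real.rpow_natCast, ← Real.rpow_mul (by norm_num),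
                ← Real.rpow_mul (by norm_num), ← Real.rpow_add (by norm_num)]
              congr 1; ring
            rw [this]; ring
    refine (ENNReal.tsum_le_tsum h1).trans ?_
    rw [← ENNReal.ofReal_tsum_of_nonneg (fun k => by positivity)
      ((summable_geometric_of_lt_one hr0.le hr1).mul_left A), tsum_mul_left,
      tsum_geometric_of_lt_one hr0.le hr1]
  calc ∫⁻ x, f x ∂ν ≤ ∫⁻ x, ENNReal.ofReal a * (1 + ∑' k, G k x) ∂ν := lintegral_mono hpt
    _ = ENNReal.ofReal a * (ν univ + ∑' k, ∫⁻ x, G k x ∂ν) := by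
        rw [lintegral_const_mul' _ _ ENNReal.ofReal_ne_top, lintegral_add_left measurable_const,
          lintegral_tsum (fun k => aemeasurable_const.indicator₀ (hE k)), lintegral_one]
    _ ≤ _ := by gcongr

lemma pot_bound_s6 {n : ℕ} (ν : Measure (Eucl n)) (C : ℝ) (hC : 0 < C) (d : ℕ)
    (hν : ∀ x r, 0 < r → ν (ball x r) ≤ ENNReal.ofReal (C * r ^ d)) (α : ℝ) (hα : 0 < α)
    (hαd : α < d) (F : Set (Eucl n)) (hF0 : ν F ≠ 0) (hFt : ν F ≠ ⊤)
    (x : Eucl n) :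
    ∫⁻ z in F, ENNReal.ofReal (‖x - z‖ ^ (-α)) ∂ν ≤
      ENNReal.ofReal ((1 + (1 - (2:ℝ) ^ (1 - d / α))⁻¹) * C ^ (α / d) *
        (ν F).toReal ^ (1 - α / d)) := by
  set m := (ν F).toReal with hm
  have hm0 : 0 < m := ENNReal.toReal_pos hF0 hFt
  have hd0 : (0:ℝ) < d := hα.trans hαd
  set p : ℝ := d / α with hp
  have hp1 : 1 < p := by rw [hp, lt_div_iff₀ hα]; linarith
  have hp0 : 0 < p := by linarith
  set a : ℝ := (m / C) ^ (-(α/d)) with ha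
  have ha0 : 0 < a := by positivity
  have hap : a ^ (-p) = m / C := by
    rw [ha, ← Real.rpow_mul (by positivity), hp]
    have : -(α / d) * -(d / α) = 1 := by field_simp
    rw [this, Real.rpow_one]
  have hw := weak_int (ν.restrict F) (fun z => ENNReal.ofReal (‖x - z‖ ^ (-α)))
    (by fun_prop) a p m ha0 hp1 hm0.le ?_
  · refine hw.trans ?_
    rw [Measure.restrict_apply_univ, ← ENNReal.ofReal_toReal hFt, ← hm]
    have hr1 : (2:ℝ) ^ (1 - p) < 1 := Real.rpow_lt_one_of_one_lt_of_neg one_lt_two (by linarith)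
    have h5 : 0 ≤ (1 - (2:ℝ) ^ (1 - p))⁻¹ := inv_nonneg.2 (by linarith)
    rw [← ENNReal.ofReal_add hm0.le (by positivity), ← ENNReal.ofReal_mul ha0.le]
    apply ENNReal.ofReal_le_ofReal
    have h6 : a = C ^ (α/d) * m ^ (-(α/d)) := by
      rw [ha, Real.div_rpow hm0.le hC.le, Real.rpow_neg hC.le]
      field_simp
    have h7 : m ^ (1 - α / d) = m * m ^ (-(α/d)) := by
      rw [sub_eq_add_neg, Real.rpow_add hm0, Real.rpow_one]
    rw [h6, h7]
    apply le_of_eq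
    ring
  · intro t ht
    have ht0 : 0 < t := by linarith
    have hsub : {z | ENNReal.ofReal (a * t) < ENNReal.ofReal (‖x - z‖ ^ (-α))} ⊆
        ball x ((a * t) ^ (-(1/α))) := by
      intro z hz
      have hz' : ENNReal.ofReal (a * t) < ENNReal.ofReal (‖x - z‖ ^ (-α)) := hz
      rw [ENNReal.ofReal_lt_ofReal_iff'] at hz'
      have hz1 := hz'.1
      rw [mem_ball, dist_comm, dist_eq_norm]
      by_contra! hcon
      have h8 : ‖x - z‖ ^ (-α) ≤ ((a * t) ^ (-(1/α))) ^ (-α) :=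
        Real.rpow_le_rpow_of_nonpos (by positivity) hcon (by linarith)
      rw [← Real.rpow_mul (by positivity)] at h8
      have : -(1 / α) * -α = 1 := by field_simp
      rw [this, Real.rpow_one] at h8
      linarith
    calc _ ≤ ν {z | ENNReal.ofReal (a * t) < ENNReal.ofReal (‖x - z‖ ^ (-α))} :=
          Measure.restrict_apply_le _ _
      _ ≤ ν (ball x ((a * t) ^ (-(1/α)))) := measure_mono hsub
      _ ≤ _ := hν _ _ (by positivity)
      _ = _ := by
        congr 1
        have : ((a * t) ^ (-(1/α))) ^ d = a ^ (-p) * t ^ (-p) := by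
          rw [← Real.rpow_natCast, ← Real.rpow_mul (by positivity), ← Real.mul_rpow ha0.le ht0.le]
          congr 1
          rw [hp]; ring
        rw [this, hap]
        field_simp

lemma exists_partition {n : ℕ} (F : Set (Eucl n)) (hF : IsCompact F) (η : ℝ) (hη : 0 < η) :
    ∃ (N : ℕ) (z : Fin N → Eucl n) (P : Fin N → Set (Eucl n)), (∀ i, z i ∈ F) ∧
      (∀ i, MeasurableSet (P i)) ∧ Pairwise (Function.onFun Disjoint P) ∧ (⋃ i, P i) = F ∧
      ∀ i, ∀ y ∈ P i, dist y (z i) < η := by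
  obtain ⟨t, htF, htfin, htc⟩ := hF.finite_cover_balls hη
  have := htfin.fintype
  let e := Fintype.equivFin t
  let z : Fin (Fintype.card t) → Eucl n := fun i => (e.symm i : Eucl n)
  let B : Fin (Fintype.card t) → Set (Eucl n) := fun i => F ∩ ball (z i) η
  refine ⟨Fintype.card t, z, disjointed B, fun i => htF (e.symm i).2, ?_, disjoint_disjointed B, ?_, ?_⟩
  · intro i
    have hB : ∀ j, MeasurableSet (B j) := fun j => hF.measurableSet.inter measurableSet_ball
    exact disjointedRec (fun t j ht => ht.diff (hB j)) (hB i)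
  · rw [iUnion_disjointed]
    apply subset_antisymm
    · exact iUnion_subset fun i => inter_subset_left
    · intro y hy
      have := htc hy
      simp only [mem_iUnion] at this ⊢
      obtain ⟨w, hw, hyw⟩ := this
      refine ⟨e ⟨w, hw⟩, hy, ?_⟩
      simpa [z] using hyw
  · intro i y hy
    exact (disjointed_subset B i hy).2

lemma lap_diff_aux {n : ℕ} {f : Eucl n → ℝ} {x : Eucl n} (hf : ContDiffAt ℝ 2 f x) :
    (∀ᶠ y in 𝓝 x, DifferentiableAt ℝ f y) ∧
      ∀ v, DifferentiableAt ℝ (fun y => fderiv ℝ f y v) x := by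
  constructor
  · have h := hf.eventually (by simp)
    filter_upwards [h] with y hy
    exact hy.differentiableAt (by norm_num)
  · intro v
    have : DifferentiableAt ℝ (fderiv ℝ f) x :=
      (hf.fderiv_right (m := 1) (by norm_num)).differentiableAt (by norm_num)
    exact this.clm_apply (differentiableAt_const v)

lemma lap_add {n : ℕ} {f g : Eucl n → ℝ} {x : Eucl n} (hf : ContDiffAt ℝ 2 f x)
    (hg : ContDiffAt ℝ 2 g x) : lap (fun y => f y + g y) x = lap f x + lap g x := by
  unfold lap
  rw [← Finset.sum_add_distrib]
  refine Finset.sum_congr rfl fun i _ => ?_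
  obtain ⟨f1, f2⟩ := lap_diff_aux hf
  obtain ⟨g1, g2⟩ := lap_diff_aux hg
  have he : (fun y => fderiv ℝ (fun y => f y + g y) y (EuclideanSpace.single i (1:ℝ))) =ᶠ[𝓝 x]
      fun y => fderiv ℝ f y (EuclideanSpace.single i (1:ℝ)) +
        fderiv ℝ g y (EuclideanSpace.single i (1:ℝ)) := by
    filter_upwards [f1, g1] with y h1 h2
    rw [fderiv_fun_add h1 h2]
    rfl
  rw [he.fderiv_eq, fderiv_fun_add (f2 _) (g2 _)]
  rfl

lemma lap_const_mul {n : ℕ} {f : Eucl n → ℝ} {x : Eucl n} (c : ℝ) (hf : ContDiffAt ℝ 2 f x) :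
    lap (fun y => c * f y) x = c * lap f x := by
  unfold lap
  rw [Finset.mul_sum]
  refine Finset.sum_congr rfl fun i _ => ?_
  obtain ⟨f1, f2⟩ := lap_diff_aux hf
  have he : (fun y => fderiv ℝ (fun y => c * f y) y (EuclideanSpace.single i (1:ℝ))) =ᶠ[𝓝 x]
      fun y => c * fderiv ℝ f y (EuclideanSpace.single i (1:ℝ)) := by
    filter_upwards [f1] with y h1
    rw [fderiv_const_mul h1]
    rfl
  rw [he.fderiv_eq, fderiv_const_mul (f2 _)]
  rfl

lemma harm_const {n : ℕ} (c : ℝ) (G : Set (Eucl n)) : IsHarmonicOn (fun _ : Eucl n => c) G := by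
  refine ⟨contDiffOn_const, fun x _ => ?_⟩
  simp [lap]

lemma harm_add {n : ℕ} {f g : Eucl n → ℝ} {G : Set (Eucl n)} (hG : IsOpen G)
    (hf : IsHarmonicOn f G) (hg : IsHarmonicOn g G) : IsHarmonicOn (fun y => f y + g y) G := by
  refine ⟨hf.1.add hg.1, fun x hx => ?_⟩
  rw [lap_add (hf.1.contDiffAt (hG.mem_nhds hx)) (hg.1.contDiffAt (hG.mem_nhds hx)), hf.2 x hx,
    hg.2 x hx, add_zero]

lemma harm_const_mul {n : ℕ} {f : Eucl n → ℝ} {G : Set (Eucl n)} (hG : IsOpen G) (c : ℝ)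
    (hf : IsHarmonicOn f G) : IsHarmonicOn (fun y => c * f y) G := by
  refine ⟨contDiffOn_const.mul hf.1, fun x hx => ?_⟩
  rw [lap_const_mul c (hf.1.contDiffAt (hG.mem_nhds hx)), hf.2 x hx, mul_zero]

lemma harm_sum {n : ℕ} {ι : Type*} (s : Finset ι) {f : ι → Eucl n → ℝ} {G : Set (Eucl n)}
    (hG : IsOpen G) (hf : ∀ i, IsHarmonicOn (f i) G) :
    IsHarmonicOn (fun y => ∑ i ∈ s, f i y) G := by
  classical
  induction s using Finset.induction_on with
  | empty => simpa using harm_const 0 G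
  | insert a s ha ih =>
    simp_rw [Finset.sum_insert ha]
    exact harm_add hG (hf a) ih

lemma harm_translate {n : ℕ} {f : Eucl n → ℝ} (hf : IsHarmonicOn f {0}ᶜ) (z : Eucl n)
    {G : Set (Eucl n)} (hz : z ∉ G) : IsHarmonicOn (fun y => f (y - z)) G := by
  have hne : ∀ y ∈ G, y - z ∈ ({0}ᶜ : Set (Eucl n)) := by
    intro y hy h
    have : y = z := sub_eq_zero.1 h
    exact hz (this ▸ hy)
  refine ⟨hf.1.comp (contDiff_id.sub contDiff_const).contDiffOn hne, fun x hx => ?_⟩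
  rw [← hf.2 (x - z) (hne x hx)]
  unfold lap
  refine Finset.sum_congr rfl fun i _ => ?_
  have h1 : (fun y => fderiv ℝ (fun y => f (y - z)) y (EuclideanSpace.single i (1:ℝ))) =
      fun y => (fun w => fderiv ℝ f w (EuclideanSpace.single i (1:ℝ))) (y - z) := by
    funext y
    rw [fderiv_comp_sub]
  rw [h1, fderiv_comp_sub (f := fun w => fderiv ℝ f w (EuclideanSpace.single i (1:ℝ)))]

lemma exists_potential {n : ℕ} (ν : Measure (Eucl n)) (C : ℝ) (hC : 0 < C) (d : ℕ)
    (hν : ∀ x r, 0 < r → ν (ball x r) ≤ ENNReal.ofReal (C * r ^ d)) (α : ℝ) (hα : 0 < α)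
    (hαd : α < d) (ε : ℝ) (hε : 0 < ε) (k : ℝ → ℝ)
    (hk : IsHarmonicOn (fun y : Eucl n => k ‖y‖) {0}ᶜ)
    (hk0 : ∀ r, 2 * ε ≤ r → k r ≤ 0) (hk1 : ∀ r, 0 < r → r ≤ ε → 1 / 2 ≤ k r)
    (hk2 : ∀ r, 0 < r → k r ≤ 4 * (ε / r) ^ α)
    (F : Set (Eucl n)) (hF : IsCompact F) (x₀ : Eucl n) (hFb : F ⊆ ball x₀ ε)
    (hF0 : ν F ≠ 0) (hFt : ν F ≠ ⊤) (ρ : ℝ) (hρ : 0 < ρ) :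
    ∃ φ : Eucl n → ℝ, IsHarmonicOn φ Fᶜ ∧ (∀ x, 3 * ε ≤ dist x x₀ → φ x ≤ 0) ∧
      (∀ x, (∀ z ∈ F, ρ ≤ dist x z) → φ x ≤
        4 * 2 ^ α * ε ^ α * ((1 + (1 - (2:ℝ) ^ (1 - d / α))⁻¹) * C ^ (α / d) *
        (ν F).toReal ^ (1 - α / d))) ∧
      (x₀ ∉ F → (ν F).toReal / 2 ≤ φ x₀) := by
  obtain ⟨N, z, P, hzF, hPm, hPd, hPU, hPz⟩ := exists_partition F hF ρ hρ
  have hPF : ∀ i, P i ⊆ F := fun i => hPU ▸ subset_iUnion P i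
  have hPt : ∀ i, ν (P i) ≠ ⊤ := fun i => ne_top_of_le_ne_top hFt (measure_mono (hPF i))
  have hsumP : ∑ i, (ν (P i)).toReal = (ν F).toReal := by
    rw [← ENNReal.toReal_sum (fun i _ => hPt i), ← hPU, measure_iUnion hPd hPm, tsum_fintype]
  refine ⟨fun x => ∑ i, (ν (P i)).toReal * k ‖x - z i‖, ?_, ?_, ?_, ?_⟩
  · refine harm_sum _ hF.isClosed.isOpen_compl fun i => ?_
    refine harm_const_mul hF.isClosed.isOpen_compl _ ?_
    exact harm_translate (f := fun y => k ‖y‖) hk (z i) (fun h => h (hzF i))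
  · intro x hx
    refine Finset.sum_nonpos fun i _ => ?_
    refine mul_nonpos_of_nonneg_of_nonpos ENNReal.toReal_nonneg (hk0 _ ?_)
    have h1 : dist (z i) x₀ < ε := hFb (hzF i)
    have h2 := dist_triangle x (z i) x₀
    rw [dist_eq_norm x (z i)] at h2
    linarith
  · intro x hx
    have hxz : ∀ y ∈ F, ρ ≤ ‖x - y‖ := fun y hy => by rw [← dist_eq_norm]; exact hx y hy
    have h1 : ∀ i, (ν (P i)).toReal * k ‖x - z i‖ ≤
        4 * ε ^ α * ((ν (P i)).toReal * ‖x - z i‖ ^ (-α)) := by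
      intro i
      have h0 : 0 < ‖x - z i‖ := hρ.trans_le (hxz _ (hzF i))
      have h2 := hk2 _ h0
      rw [Real.div_rpow hε.le h0.le] at h2
      rw [Real.rpow_neg h0.le]
      calc _ ≤ (ν (P i)).toReal * (4 * (ε ^ α / ‖x - z i‖ ^ α)) := by gcongr
        _ = _ := by ring
    have h2 : ENNReal.ofReal (∑ i, (ν (P i)).toReal * ‖x - z i‖ ^ (-α)) ≤
        ENNReal.ofReal (2 ^ α) * ∫⁻ y in F, ENNReal.ofReal (‖x - y‖ ^ (-α)) ∂ν := by
      rw [ENNReal.ofReal_sum_of_nonneg (fun i _ => by positivity)]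
      rw [← hPU, lintegral_iUnion hPm hPd, tsum_fintype, Finset.mul_sum]
      refine Finset.sum_le_sum fun i _ => ?_
      rw [← lintegral_const_mul' _ _ ENNReal.ofReal_ne_top, ENNReal.ofReal_mul ENNReal.toReal_nonneg,
        ENNReal.ofReal_toReal (hPt i), mul_comm, ← setLIntegral_const]
      refine setLIntegral_mono' (hPm i) fun y hy => ?_
      rw [← ENNReal.ofReal_mul (by positivity)]
      apply ENNReal.ofReal_le_ofReal
      have hy1 : dist y (z i) < ρ := hPz i y hy
      have hy0 : 0 < ‖x - y‖ := hρ.trans_le (hxz _ (hPF i hy))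
      have hz0 := hxz _ (hzF i)
      have hle : ‖x - y‖ ≤ 2 * ‖x - z i‖ := by
        have := dist_triangle x (z i) y
        rw [dist_comm (z i) y, dist_eq_norm x y, dist_eq_norm x (z i)] at this
        linarith
      calc ‖x - z i‖ ^ (-α) ≤ (‖x - y‖ / 2) ^ (-α) :=
            Real.rpow_le_rpow_of_nonpos (by positivity) (by linarith) (by linarith)
        _ = 2 ^ α * ‖x - y‖ ^ (-α) := by
            rw [Real.div_rpow hy0.le (by norm_num), Real.rpow_neg (by norm_num : (0:ℝ) ≤ 2)]
            field_simp
    have h3 := pot_bound_s6 ν C hC d hν α hα hαd F hF0 hFt x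
    set T := ((1 + (1 - (2:ℝ) ^ (1 - d / α))⁻¹) * C ^ (α / d) *
        (ν F).toReal ^ (1 - α / d)) with hT
    have hr1 : (2:ℝ) ^ (1 - d / α) < 1 := Real.rpow_lt_one_of_one_lt_of_neg one_lt_two (by
      have : 1 < d / α := by rw [lt_div_iff₀ hα]; linarith
      linarith)
    have h5 : 0 ≤ (1 - (2:ℝ) ^ (1 - d / α))⁻¹ := inv_nonneg.2 (by linarith)
    have hT0 : 0 ≤ T := by positivity
    have h4 : ∑ i, (ν (P i)).toReal * ‖x - z i‖ ^ (-α) ≤ 2 ^ α * T := by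
      rw [← ENNReal.ofReal_le_ofReal_iff (by positivity)]
      refine h2.trans ?_
      rw [ENNReal.ofReal_mul (by positivity)]
      gcongr
    calc _ ≤ ∑ i, 4 * ε ^ α * ((ν (P i)).toReal * ‖x - z i‖ ^ (-α)) :=
          Finset.sum_le_sum fun i _ => h1 i
      _ = 4 * ε ^ α * ∑ i, (ν (P i)).toReal * ‖x - z i‖ ^ (-α) := by rw [Finset.mul_sum]
      _ ≤ 4 * ε ^ α * (2 ^ α * T) := by gcongr
      _ = _ := by ring
  · intro hx
    rw [← hsumP, Finset.sum_div]
    refine Finset.sum_le_sum fun i _ => ?_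
    have h1 : dist (z i) x₀ < ε := hFb (hzF i)
    rw [dist_comm, dist_eq_norm] at h1
    have h2 : 0 < ‖x₀ - z i‖ := by
      rw [norm_pos_iff, sub_ne_zero]
      rintro h
      exact hx (h ▸ hzF i)
    have := hk1 _ h2 h1.le
    have h0 : 0 ≤ (ν (P i)).toReal := ENNReal.toReal_nonneg
    nlinarith

lemma level_bound {n : ℕ} (Ω : Set (Eucl n)) (hΩ : IsOpen Ω) (u : Eucl n → EReal)
    (hu : IsSubharmonicOn u Ω) (x₀ : Eucl n) (ν : Measure (Eucl n)) (C : ℝ) (hC : 0 < C) (d : ℕ)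
    (hν : ∀ x r, 0 < r → ν (ball x r) ≤ ENNReal.ofReal (C * r ^ d)) (α : ℝ) (hα : 0 < α)
    (hαd : α < d) (ε : ℝ) (hε : 0 < ε) (k : ℝ → ℝ)
    (hk : IsHarmonicOn (fun y : Eucl n => k ‖y‖) {0}ᶜ)
    (hk0 : ∀ r, 2 * ε ≤ r → k r ≤ 0) (hk1 : ∀ r, 0 < r → r ≤ ε → 1 / 2 ≤ k r)
    (hk2 : ∀ r, 0 < r → k r ≤ 4 * (ε / r) ^ α)
    (u0 η t : ℝ) (hu0 : u x₀ = u0) (hη : 0 < η) (hΩε : closedBall x₀ (3 * ε) ⊆ Ω)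
    (huc : ∀ x ∈ closedBall x₀ (3 * ε), u x ≤ ((u0 + η : ℝ) : EReal)) (ht : η ≤ t)
    (F : Set (Eucl n)) (hF : IsCompact F) (hFb : F ⊆ ball x₀ ε)
    (hFu : ∀ x ∈ F, u x < ((u0 + η - t : ℝ) : EReal)) :
    ν F ≤ ENNReal.ofReal ((2 * (4 * 2 ^ α * ((1 + (1 - (2:ℝ) ^ (1 - d / α))⁻¹) * C ^ (α / d)))
      * η / t) ^ (d / α) * ε ^ d) := by
  have ht0 : 0 < t := hη.trans_le ht
  have hd0 : (0:ℝ) < d := hα.trans hαd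
  have hFt : ν F ≠ ⊤ :=
    ne_top_of_le_ne_top ENNReal.ofReal_ne_top ((measure_mono hFb).trans (hν x₀ ε hε))
  by_cases hF0 : ν F = 0
  · rw [hF0]; exact bot_le
  set m := (ν F).toReal with hm
  have hm0 : 0 < m := ENNReal.toReal_pos hF0 hFt
  have hr1 : (2:ℝ) ^ (1 - d / α) < 1 := Real.rpow_lt_one_of_one_lt_of_neg one_lt_two (by
      have : 1 < d / α := by rw [lt_div_iff₀ hα]; linarith
      linarith)
  have hW : 0 ≤ (1 - (2:ℝ) ^ (1 - d / α))⁻¹ := inv_nonneg.2 (by linarith)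
  set E : ℝ := 4 * 2 ^ α * ((1 + (1 - (2:ℝ) ^ (1 - d / α))⁻¹) * C ^ (α / d)) with hE
  have hE0 : 0 < E := by positivity
  let O : Set (Eucl n) := ball x₀ (3 * ε) ∩ {x | u x < ((u0 + η - t : ℝ) : EReal)}
  have hO : IsOpen O := by
    rw [isOpen_iff_mem_nhds]
    rintro x ⟨hx, hx'⟩
    have hxΩ : x ∈ Ω := hΩε (ball_subset_closedBall hx)
    have h1 := hu.1 x hxΩ _ hx'
    rw [hΩ.nhdsWithin_eq hxΩ] at h1
    filter_upwards [isOpen_ball.mem_nhds hx, h1] with y hy hy'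
    exact ⟨hy, hy'⟩
  have hFO : F ⊆ O := fun x hx =>
    ⟨ball_subset_ball (by linarith) (hFb hx), hFu x hx⟩
  obtain ⟨F', hF'c, hFF', hF'O⟩ := exists_compact_between hF hO hFO
  obtain ⟨ρ, hρ, hρF⟩ := hF.exists_thickening_subset_open isOpen_interior hFF'
  have hfar : ∀ x, x ∉ interior F' → ∀ z ∈ F, ρ ≤ dist x z := by
    intro x hx z hz
    by_contra! h
    exact hx (hρF (mem_thickening_iff.2 ⟨z, hz, h⟩))
  obtain ⟨φ, hφh, hφ0, hφM, hφx⟩ := exists_potential ν C hC d hν α hα hαd ε hε k hk hk0 hk1 hk2 F hF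
    x₀ hFb hF0 hFt ρ hρ
  set M : ℝ := E * ε ^ α * m ^ (1 - α / d) with hM
  have hM0 : 0 < M := by positivity
  have hφM' : ∀ x, x ∉ interior F' → φ x ≤ M := by
    intro x hx
    refine (hφM x (hfar x hx)).trans (le_of_eq ?_)
    rw [hM, hE, ← hm]; ring
  have hx₀F' : x₀ ∉ F' := by
    intro h
    have h1 : u x₀ < ((u0 + η - t : ℝ) : EReal) := (hF'O h).2
    rw [hu0, EReal.coe_lt_coe_iff] at h1
    linarith
  let G : Set (Eucl n) := ball x₀ (3 * ε) \ F'
  have hGo : IsOpen G := isOpen_ball.sdiff hF'c.isClosed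
  have hGcl : closure G ⊆ closedBall x₀ (3 * ε) ∩ (interior F')ᶜ := by
    apply closure_minimal
    · rintro x ⟨h1, h2⟩
      exact ⟨ball_subset_closedBall h1, fun h => h2 (interior_subset h)⟩
    · exact isClosed_closedBall.inter isOpen_interior.isClosed_compl
  have hclF : closure G ⊆ Fᶜ := fun x hx h => (hGcl hx).2 (hFF' h)
  have hGc : IsCompact (closure G) :=
    (isCompact_closedBall x₀ (3 * ε)).of_isClosed_subset isClosed_closure
      (hGcl.trans inter_subset_left)
  have hψ : IsHarmonicOn (fun x => (u0 + η) + (-(t / M)) * φ x) Fᶜ :=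
    harm_add hF.isClosed.isOpen_compl (harm_const _ _)
      (harm_const_mul hF.isClosed.isOpen_compl _ hφh)
  have hkey := hu.2.2.2 G hGo hGc (hGcl.trans (inter_subset_left.trans hΩε))
    (fun x => (u0 + η) + (-(t / M)) * φ x)
    ⟨hψ.1.mono (subset_closure.trans hclF), fun x hx => hψ.2 x (hclF (subset_closure hx))⟩
    (hψ.1.continuousOn.mono hclF) ?_ x₀ ⟨mem_ball_self (by positivity), hx₀F'⟩
  · rw [hu0, EReal.coe_le_coe_iff] at hkey
    have h1 := hφx (fun h => hx₀F' (interior_subset (hFF' h)))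
    rw [← hm] at h1
    have h2 : t / M * (m / 2) ≤ η := by
      have : t / M * (m / 2) ≤ t / M * φ x₀ := by gcongr
      linarith
    have h3 : t * m ≤ 2 * η * M := by
      have h4 : t / M * (m / 2) = t * m / (2 * M) := by field_simp
      rw [h4, div_le_iff₀ (by positivity)] at h2
      linarith
    have h4 : m = m ^ (1 - α / d) * m ^ (α / d) := by
      rw [← Real.rpow_add hm0]; simp
    have h5 : m ^ (α / d) ≤ 2 * E * η / t * ε ^ α := by
      have h6 : 0 < m ^ (1 - α / d) := by positivity
      have h7 : (t * m ^ (α / d)) * m ^ (1 - α / d) ≤ (2 * E * η * ε ^ α) * m ^ (1 - α / d) := by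
        calc (t * m ^ (α / d)) * m ^ (1 - α / d) = t * (m ^ (1 - α / d) * m ^ (α / d)) := by ring
          _ = t * m := by rw [← h4]
          _ ≤ 2 * η * M := h3
          _ = _ := by rw [hM]; ring
      have h8 := le_of_mul_le_mul_right h7 h6
      rw [div_mul_eq_mul_div, le_div_iff₀ ht0]
      linarith
    have h6 : m ≤ (2 * E * η / t) ^ (d / α) * ε ^ d := by
      have h7 : (m ^ (α / d)) ^ (d / α) ≤ (2 * E * η / t * ε ^ α) ^ (d / α) :=
        Real.rpow_le_rpow (by positivity) h5 (by positivity)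
      rw [← Real.rpow_mul hm0.le, Real.mul_rpow (by positivity) (by positivity),
        ← Real.rpow_mul hε.le] at h7
      have e1 : α / d * (d / α) = 1 := by field_simp
      have e2 : α * (d / α) = d := by field_simp
      rw [e1, e2, Real.rpow_one, Real.rpow_natCast] at h7
      exact h7
    rw [← ENNReal.ofReal_toReal hFt]
    exact ENNReal.ofReal_le_ofReal h6
  · intro x hx
    have hxcl : x ∈ closure G := frontier_subset_closure hx
    have hxG : x ∉ G := by
      rw [hGo.frontier_eq] at hx
      exact hx.2
    have htM : 0 ≤ t / M := by positivity
    by_cases hxF' : x ∈ F'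
    · have h1 : u x < ((u0 + η - t : ℝ) : EReal) := (hF'O hxF').2
      refine h1.le.trans ?_
      rw [EReal.coe_le_coe_iff]
      have h2 : t / M * φ x ≤ t / M * M := by
        gcongr
        exact hφM' x (hGcl hxcl).2
      rw [div_mul_cancel₀ _ hM0.ne'] at h2
      linarith
    · have h1 : 3 * ε ≤ dist x x₀ := by
        by_contra! h
        exact hxG ⟨h, hxF'⟩
      refine (huc x (hGcl hxcl).1).trans ?_
      rw [EReal.coe_le_coe_iff]
      have := mul_nonpos_of_nonneg_of_nonpos htM (hφ0 x h1)
      linarith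

lemma eavg_bounds {n : ℕ} (μ : Measure (Eucl n)) (S : Set (Eucl n)) (hS : MeasurableSet S)
    (u : Eucl n → EReal) (c : ℝ) (hm0 : μ S ≠ 0) (hmt : μ S ≠ ⊤)
    (hu : ∀ x ∈ S, u x ≤ (c : EReal)) (hmeas : AEMeasurable u (μ.restrict S)) :
    eavg μ S u ≤ (c : EReal) ∧ ∀ B : ℝ, 0 ≤ B →
      ∫⁻ x in S, ((c : EReal) - u x).toENNReal ∂μ ≤ ENNReal.ofReal B * μ S →
      ((c - B : ℝ) : EReal) ≤ eavg μ S u := by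
  have hpos : ∀ a : EReal, EReal.posPart a = a.toENNReal := fun a => rfl
  have hmneg : AEMeasurable (fun x => -(u x)) (μ.restrict S) :=
    measurable_neg.comp_aemeasurable hmeas
  have hmsub : AEMeasurable (fun x => (c : EReal) - u x) (μ.restrict S) := by
    have : Antitone fun a : EReal => (c : EReal) - a := fun a b h => EReal.sub_le_sub le_rfl h
    exact this.measurable.comp_aemeasurable hmeas
  set Ip := ∫⁻ x in S, (u x).posPart ∂μ with hIp
  set Im := ∫⁻ x in S, (-(u x)).posPart ∂μ with hIm
  set If := ∫⁻ x in S, ((c : EReal) - u x).toENNReal ∂μ with hIf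
  set m := μ S with hm
  have hpt : ∀ x ∈ S, ENNReal.ofReal c + (-(u x)).posPart =
      ((c : EReal) - u x).toENNReal + ((u x).posPart + ENNReal.ofReal (-c)) := by
    intro x hx
    have h1 := hu x hx
    simp only [hpos]
    induction hux : u x using EReal.rec with
    | bot => simp
    | top => rw [hux] at h1; simp at h1
    | coe r =>
      rw [hux, EReal.coe_le_coe_iff] at h1
      rw [← EReal.coe_neg, ← EReal.coe_sub]
      simp only [EReal.toENNReal_of_ne_top (EReal.coe_ne_top _), EReal.toReal_coe]
      rcases le_total 0 c with hc | hc <;> rcases le_total 0 r with hr | hr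
      · rw [ENNReal.ofReal_of_nonpos (by linarith : -r ≤ 0),
          ENNReal.ofReal_of_nonpos (by linarith : -c ≤ 0), add_zero, add_zero,
          ← ENNReal.ofReal_add (by linarith) hr]
        congr 1; ring
      · rw [ENNReal.ofReal_of_nonpos hr,
          ENNReal.ofReal_of_nonpos (by linarith : -c ≤ 0), add_zero, add_zero,
          ← ENNReal.ofReal_add (by linarith) (by linarith)]
        congr 1
      · have h2 : c = 0 := by linarith
        have h3 : r = 0 := by linarith
        simp [h2, h3]
      · rw [ENNReal.ofReal_of_nonpos hr, ENNReal.ofReal_of_nonpos hc, zero_add, zero_add,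
          ← ENNReal.ofReal_add (by linarith) (by linarith)]
        congr 1; ring
  have hintg : ENNReal.ofReal c * m + Im = If + (Ip + ENNReal.ofReal (-c) * m) := by
    have h1 := setLIntegral_congr_fun (μ := μ) hS hpt
    rw [lintegral_add_left measurable_const, lintegral_add_left' hmsub.ereal_toENNReal,
      lintegral_add_right _ measurable_const, setLIntegral_const, setLIntegral_const] at h1
    exact h1
  have hIpt : Ip ≠ ⊤ := by
    have : Ip ≤ ENNReal.ofReal c * m := by
      rw [hIp, hm, ← setLIntegral_const]
      refine setLIntegral_mono' hS fun x hx => ?_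
      rw [hpos]
      have := EReal.toENNReal_le_toENNReal (hu x hx)
      rwa [EReal.toENNReal_of_ne_top (EReal.coe_ne_top _), EReal.toReal_coe] at this
    exact ne_top_of_le_ne_top (ENNReal.mul_ne_top ENNReal.ofReal_ne_top hmt) this
  have hmr : 0 < m.toReal := ENNReal.toReal_pos hm0 hmt
  have hinv : ((m⁻¹ : ℝ≥0∞) : EReal) = ((m.toReal⁻¹ : ℝ) : EReal) := by
    rw [← ENNReal.toReal_inv, EReal.coe_ennreal_toReal (ENNReal.inv_ne_top.2 hm0)]
  have hav : eavg μ S u = ((m.toReal⁻¹ : ℝ) : EReal) * ((Ip : EReal) - (Im : EReal)) := by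
    rw [← hinv]; rfl
  have hfin : Im ≠ ⊤ → eavg μ S u = ((c - If.toReal / m.toReal : ℝ) : EReal) ∧ If ≠ ⊤ := by
    intro h
    have hl : ENNReal.ofReal c * m + Im ≠ ⊤ :=
      ENNReal.add_ne_top.2 ⟨ENNReal.mul_ne_top ENNReal.ofReal_ne_top hmt, h⟩
    have hIft : If ≠ ⊤ := by
      rw [hintg] at hl
      exact (ENNReal.add_ne_top.1 hl).1
    refine ⟨?_, hIft⟩
    have h1 := congrArg ENNReal.toReal hintg
    rw [ENNReal.toReal_add (ENNReal.mul_ne_top ENNReal.ofReal_ne_top hmt) h,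
      ENNReal.toReal_add hIft (ENNReal.add_ne_top.2 ⟨hIpt, ENNReal.mul_ne_top ENNReal.ofReal_ne_top hmt⟩),
      ENNReal.toReal_add hIpt (ENNReal.mul_ne_top ENNReal.ofReal_ne_top hmt),
      ENNReal.toReal_mul, ENNReal.toReal_mul, ENNReal.toReal_ofReal', ENNReal.toReal_ofReal'] at h1
    rw [hav, ← EReal.coe_ennreal_toReal hIpt, ← EReal.coe_ennreal_toReal h, ← EReal.coe_sub, ← EReal.coe_mul]
    congr 1
    have h2 : max c 0 - max (-c) 0 = c := max_zero_sub_eq_self c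
    have h3 : Ip.toReal - Im.toReal = c * m.toReal - If.toReal := by
      calc _ = (max c 0 - max (-c) 0) * m.toReal - If.toReal := by linarith
        _ = _ := by rw [h2]
    rw [h3]
    field_simp
  constructor
  · by_cases h : Im = ⊤
    · rw [hav, h]
      have : (Ip : EReal) - ((⊤ : ℝ≥0∞) : EReal) = ⊥ := by
        rw [← EReal.coe_ennreal_toReal hIpt]
        simp
      rw [this, EReal.coe_mul_bot_of_pos (by positivity)]
      exact bot_le
    · rw [(hfin h).1, EReal.coe_le_coe_iff]
      have : 0 ≤ If.toReal / m.toReal := by positivity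
      linarith
  · intro B hB hle
    have hIft : If ≠ ⊤ := ne_top_of_le_ne_top (ENNReal.mul_ne_top ENNReal.ofReal_ne_top hmt) hle
    have hImt : Im ≠ ⊤ := by
      have : ENNReal.ofReal c * m + Im ≠ ⊤ := by
        rw [hintg]
        exact ENNReal.add_ne_top.2 ⟨hIft, ENNReal.add_ne_top.2
          ⟨hIpt, ENNReal.mul_ne_top ENNReal.ofReal_ne_top hmt⟩⟩
      exact (ENNReal.add_ne_top.1 this).2
    rw [(hfin hImt).1, EReal.coe_le_coe_iff]
    have h1 := ENNReal.toReal_mono (ENNReal.mul_ne_top ENNReal.ofReal_ne_top hmt) hle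
    rw [ENNReal.toReal_mul, ENNReal.toReal_ofReal hB] at h1
    have : If.toReal / m.toReal ≤ B := by rwa [div_le_iff₀ hmr]
    linarith

lemma usc_level_open {n : ℕ} {Ω : Set (Eucl n)} (hΩ : IsOpen Ω) {u : Eucl n → EReal}
    (hu : UpperSemicontinuousOn u Ω) {V : Set (Eucl n)} (hV : IsOpen V) (hVΩ : V ⊆ Ω) (q : EReal) :
    IsOpen (V ∩ {x | u x < q}) := by
  rw [isOpen_iff_mem_nhds]
  rintro x ⟨hxV, hx⟩
  have h := hu x (hVΩ hxV) q hx
  rw [hΩ.nhdsWithin_eq (hVΩ hxV)] at h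
  exact inter_mem (hV.mem_nhds hxV) h

lemma usc_ev {n : ℕ} {Ω : Set (Eucl n)} (hΩ : IsOpen Ω) {u : Eucl n → EReal}
    (hu : UpperSemicontinuousOn u Ω) {x₀ : Eucl n} (hx : x₀ ∈ Ω) (q : EReal) (hq : u x₀ < q) :
    ∀ᶠ ε in 𝓝[>] (0:ℝ), 0 < ε ∧ closedBall x₀ (3 * ε) ⊆ Ω ∧
      ∀ x ∈ closedBall x₀ (3 * ε), u x ≤ q := by
  have h := (usc_level_open hΩ hu hΩ subset_rfl q).mem_nhds ⟨hx, hq⟩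
  obtain ⟨r, hr, hrs⟩ := Metric.nhds_basis_closedBall.mem_iff.1 h
  filter_upwards [Ioo_mem_nhdsGT (show (0:ℝ) < r / 3 by positivity)] with ε hε
  have hs : closedBall x₀ (3 * ε) ⊆ closedBall x₀ r := closedBall_subset_closedBall (by linarith [hε.2])
  exact ⟨hε.1, fun x hx => (hrs (hs hx)).1, fun x hx => (hrs (hs hx)).2.le⟩

lemma usc_aemeas {n : ℕ} {Ω : Set (Eucl n)} (hΩ : IsOpen Ω) {u : Eucl n → EReal}
    (hu : UpperSemicontinuousOn u Ω) (μ : Measure (Eucl n)) {S : Set (Eucl n)} (hS : S ⊆ Ω) :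
    AEMeasurable u (μ.restrict S) := by
  have h1 : AEMeasurable u (μ.restrict Ω) :=
    aemeasurable_restrict_of_measurable_subtype hΩ.measurableSet
      (upperSemicontinuousOn_iff_restrict.2 hu).measurable
  exact h1.mono_set hS

lemma lower_int {n : ℕ} (hn : 2 ≤ n) (Ω : Set (Eucl n)) (hΩ : IsOpen Ω) (u : Eucl n → EReal)
    (hu : IsSubharmonicOn u Ω) (x₀ : Eucl n) (ν : Measure (Eucl n)) [IsFiniteMeasure ν]
    (C : ℝ) (hC : 0 < C)
    (hν : ∀ x r, 0 < r → ν (ball x r) ≤ ENNReal.ofReal (C * r ^ (n - 1))) :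
    ∃ D W : ℝ, 0 < D ∧ 0 ≤ W ∧ ∀ u0 η ε : ℝ, 0 < ε → u x₀ = u0 → 0 < η →
      closedBall x₀ (3 * ε) ⊆ Ω →
      (∀ x ∈ closedBall x₀ (3 * ε), u x ≤ ((u0 + η : ℝ) : EReal)) →
      ∫⁻ x in ball x₀ ε, (((u0 + η : ℝ) : EReal) - u x).toENNReal ∂ν ≤
        ENNReal.ofReal (D * η) * (ν (ball x₀ ε) + ENNReal.ofReal (ε ^ (n - 1) * W)) := by
  obtain ⟨α, hα, hαd, hker⟩ := exists_kernel hn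
  set d := n - 1 with hd
  have hd0 : (0:ℝ) < d := hα.trans hαd
  have hp : 1 < d / α := by rw [lt_div_iff₀ hα]; linarith
  have hr1 : (2:ℝ) ^ (1 - d / α) < 1 := Real.rpow_lt_one_of_one_lt_of_neg one_lt_two (by linarith)
  have hW : 0 ≤ (1 - (2:ℝ) ^ (1 - d / α))⁻¹ := inv_nonneg.2 (by linarith)
  set D0 : ℝ := 2 * (4 * 2 ^ α * ((1 + (1 - (2:ℝ) ^ (1 - d / α))⁻¹) * C ^ (α / d))) with hD0
  have hD00 : 0 ≤ D0 := by positivity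
  refine ⟨max D0 1, (1 - (2:ℝ) ^ (1 - d / α))⁻¹, by positivity, hW, ?_⟩
  intro u0 η ε hε hu0 hη hΩε huc
  set D := max D0 1 with hD
  have hD1 : 1 ≤ D := le_max_right _ _
  have hDp : 0 < D := by linarith
  obtain ⟨k, hk, hk0, hk1, hk2⟩ := hker ε hε
  have hb3 : ball x₀ ε ⊆ closedBall x₀ (3 * ε) :=
    ball_subset_closedBall.trans (closedBall_subset_closedBall (by linarith))
  have hmeas : AEMeasurable (fun x => (((u0 + η : ℝ) : EReal) - u x).toENNReal)
      (ν.restrict (ball x₀ ε)) := by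
    have : Antitone fun a : EReal => ((u0 + η : ℝ) : EReal) - a :=
      fun a b h => EReal.sub_le_sub le_rfl h
    exact (this.measurable.comp_aemeasurable
      (usc_aemeas hΩ hu.1 ν (hb3.trans hΩε))).ereal_toENNReal
  have key := weak_int (ν.restrict (ball x₀ ε)) _ hmeas (D * η) (d / α) (ε ^ d) (by positivity) hp
    (by positivity) ?_
  · rwa [Measure.restrict_apply_univ] at key
  intro t ht
  have ht0 : 0 < t := by linarith
  have hηt : η ≤ D * η * t := by
    have : 1 ≤ D * t := one_le_mul_of_one_le_of_one_le hD1 ht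
    nlinarith
  have hop := usc_level_open hΩ hu.1 (isOpen_ball : IsOpen (ball x₀ ε)) (hb3.trans hΩε)
    ((u0 + η - D * η * t : ℝ) : EReal)
  have hsub : {x | ENNReal.ofReal (D * η * t) < (((u0 + η : ℝ) : EReal) - u x).toENNReal}
      ∩ ball x₀ ε ⊆ ball x₀ ε ∩ {x | u x < ((u0 + η - D * η * t : ℝ) : EReal)} := by
    rintro x ⟨hx, hxb⟩
    refine ⟨hxb, ?_⟩
    have h1 := huc x (hb3 hxb)
    simp only [mem_ofPred_eq] at hx ⊢
    induction hux : u x using EReal.rec with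
    | bot => exact EReal.bot_lt_coe _
    | top => rw [hux] at h1; exact absurd (top_le_iff.1 h1) (EReal.coe_ne_top _)
    | coe r =>
      rw [hux, ← EReal.coe_sub, EReal.toENNReal_of_ne_top (EReal.coe_ne_top _),
        EReal.toReal_coe] at hx
      have h2 := (ENNReal.ofReal_lt_ofReal_iff_of_nonneg (by positivity)).1 hx
      rw [EReal.coe_lt_coe_iff]
      linarith
  rw [Measure.restrict_apply' measurableSet_ball]
  refine (measure_mono hsub).trans ?_
  rw [hop.measure_eq_iSup_isCompact]
  refine iSup_le fun F => iSup_le fun hFs => iSup_le fun hF => ?_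
  refine (level_bound Ω hΩ u hu x₀ ν C hC d hν α hα hαd ε hε k hk hk0 hk1 hk2 u0 η (D * η * t)
    hu0 hη hΩε huc hηt F hF (fun x hx => (hFs hx).1) (fun x hx => (hFs hx).2)).trans ?_
  apply ENNReal.ofReal_le_ofReal
  rw [← hD0, mul_comm]
  refine mul_le_mul_of_nonneg_left ?_ (by positivity)
  rw [Real.rpow_neg ht0.le, ← Real.inv_rpow ht0.le]
  refine Real.rpow_le_rpow (by positivity) ?_ (by positivity)
  rw [div_le_iff₀ (by positivity)]
  have : t⁻¹ * (D * η * t) = D * η := by field_simp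
  rw [this]
  exact mul_le_mul_of_nonneg_right (le_max_left _ _) hη.le

/-- **Corollary 4.1.** If `u` is subharmonic on a domain `Ω ⊆ ℝⁿ` (`n ≥ 2`) and `ℍ` is a
smooth hypersurface with surface measure `σ = H^{n-1}|_ℍ`, then for every
`x₀ ∈ ℍ ∩ Ω` the σ-averages of `u` over `ℍ ∩ B(x₀,ε)` tend to `u(x₀)` as `ε → 0`. -/
theorem mean_value_on_hypersurface {n : ℕ} (hn : 2 ≤ n)
    (Ω : Set (Eucl n)) (hΩ : IsOpen Ω) (hΩconn : IsConnected Ω)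
    (u : Eucl n → EReal) (hu : IsSubharmonicOn u Ω)
    (H : Set (Eucl n)) (hH : IsC1Hypersurface H) :
    ∀ x₀ ∈ H ∩ Ω,
      Tendsto (fun ε : ℝ => eavg (μH[((n : ℝ) - 1)]) (H ∩ ball x₀ ε) u)
        (𝓝[>] 0) (𝓝 (u x₀)) := by
  rintro x₀ ⟨hxH, hxΩ⟩
  obtain ⟨δ, c, C, hδ, hc, hC, hms, hlow, hup⟩ := hyp_geom H hH x₀ hxH
  set μ : Measure (Eucl n) := μH[((n : ℝ) - 1)] with hμ
  set ν := μ.restrict (H ∩ ball x₀ δ) with hν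
  have hνb : ∀ x r, 0 < r → ν (ball x r) ≤ ENNReal.ofReal (C * r ^ (n - 1)) := by
    intro x r hr
    rw [hν, Measure.restrict_apply measurableSet_ball, inter_comm]
    exact hup x r hr
  have hfin : IsFiniteMeasure ν := by
    refine ⟨?_⟩
    rw [hν, Measure.restrict_apply_univ]
    have h := hup x₀ δ hδ
    rw [inter_assoc, inter_self] at h
    exact h.trans_lt ENNReal.ofReal_lt_top
  have hSeq : ∀ ε, ε ≤ δ → H ∩ ball x₀ ε = ball x₀ ε ∩ (H ∩ ball x₀ δ) := by
    intro ε hε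
    ext x
    have := @ball_subset_ball _ _ x₀ _ _ hε x
    simp only [mem_inter_iff]
    tauto
  have hSm : ∀ ε, ε ≤ δ → MeasurableSet (H ∩ ball x₀ ε) := by
    intro ε hε
    rw [hSeq ε hε]
    exact measurableSet_ball.inter hms
  have hSν : ∀ ε, ε ≤ δ → μ (H ∩ ball x₀ ε) = ν (ball x₀ ε) := by
    intro ε hε
    rw [hν, Measure.restrict_apply measurableSet_ball, hSeq ε hε]
  have hSr : ∀ ε, ε ≤ δ → μ.restrict (H ∩ ball x₀ ε) = ν.restrict (ball x₀ ε) := by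
    intro ε hε
    rw [hν, Measure.restrict_restrict measurableSet_ball, hSeq ε hε]
  have hm0 : ∀ ε, 0 < ε → ε ≤ δ → μ (H ∩ ball x₀ ε) ≠ 0 := by
    intro ε h0 hε
    refine (lt_of_lt_of_le ?_ (hlow ε h0 hε)).ne'
    rw [ENNReal.ofReal_pos]
    positivity
  have hmt : ∀ ε, ε ≤ δ → μ (H ∩ ball x₀ ε) ≠ ⊤ := by
    intro ε hε
    rw [hSν ε hε]
    exact measure_ne_top _ _
  have hsmall : ∀ ε, 0 < ε → H ∩ ball x₀ ε ⊆ closedBall x₀ (3 * ε) := fun ε hε =>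
    inter_subset_right.trans (ball_subset_closedBall.trans (closedBall_subset_closedBall (by linarith)))
  have hevδ : ∀ᶠ ε in 𝓝[>] (0:ℝ), ε ≤ δ := by
    filter_upwards [Ioo_mem_nhdsGT hδ] with ε hε using hε.2.le
  refine tendsto_order.2 ⟨?_, ?_⟩
  · intro a ha
    obtain ⟨a', haa, ha'⟩ := EReal.lt_iff_exists_real_btwn.1 ha
    obtain ⟨u0, hu0⟩ : ∃ u0 : ℝ, u x₀ = u0 := by
      refine ⟨(u x₀).toReal, (EReal.coe_toReal (hu.2.1 x₀ hxΩ).ne ?_).symm⟩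
      exact (lt_of_le_of_lt bot_le ha').ne'
    rw [hu0, EReal.coe_lt_coe_iff] at ha'
    obtain ⟨D, W, hD, hW, hintg⟩ := lower_int hn Ω hΩ u hu x₀ ν C hC hνb
    set B := D * (1 + W / c) with hB
    have hBp : 0 < B := by positivity
    set η := (u0 - a') / (B + 1) with hη
    have hηp : 0 < η := div_pos (by linarith) (by linarith)
    have hηe : η * (B + 1) = u0 - a' := div_mul_cancel₀ _ (by positivity)
    have hq : u x₀ < ((u0 + η : ℝ) : EReal) := by
      rw [hu0, EReal.coe_lt_coe_iff]; linarith
    filter_upwards [usc_ev hΩ hu.1 hxΩ _ hq, hevδ] with ε ⟨hε, hεΩ, hεu⟩ hεδ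
    have h1 := hintg u0 η ε hε hu0 hηp hεΩ hεu
    have h2 := (eavg_bounds μ (H ∩ ball x₀ ε) (hSm ε hεδ) u (u0 + η) (hm0 ε hε hεδ) (hmt ε hεδ)
      (fun x hx => hεu x (hsmall ε hε hx))
      (usc_aemeas hΩ hu.1 μ ((hsmall ε hε).trans hεΩ))).2 (B * η) (by positivity) ?_
    · refine haa.trans_le (le_trans ?_ h2)
      rw [EReal.coe_le_coe_iff]
      nlinarith
    · rw [hSr ε hεδ]
      refine h1.trans ?_
      rw [← hSν ε hεδ]
      have h3 := hlow ε hε hεδ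
      have h4 : ENNReal.ofReal (ε ^ (n - 1) * W) ≤ ENNReal.ofReal (W / c) * μ (H ∩ ball x₀ ε) := by
        calc ENNReal.ofReal (ε ^ (n - 1) * W)
            = ENNReal.ofReal (W / c) * ENNReal.ofReal (c * ε ^ (n - 1)) := by
              rw [← ENNReal.ofReal_mul (by positivity)]
              congr 1
              field_simp
          _ ≤ _ := by gcongr
      calc _ ≤ ENNReal.ofReal (D * η) * (μ (H ∩ ball x₀ ε)
            + ENNReal.ofReal (W / c) * μ (H ∩ ball x₀ ε)) := by gcongr
        _ = ENNReal.ofReal (D * η) * ((ENNReal.ofReal 1 + ENNReal.ofReal (W / c))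
            * μ (H ∩ ball x₀ ε)) := by rw [ENNReal.ofReal_one]; ring
        _ = ENNReal.ofReal (B * η) * μ (H ∩ ball x₀ ε) := by
            rw [← ENNReal.ofReal_add zero_le_one (by positivity), ← mul_assoc,
              ← ENNReal.ofReal_mul (by positivity)]
            congr 2
            rw [hB]; ring
        _ ≤ _ := le_rfl
  · intro b hb
    obtain ⟨b', hb', hbb⟩ := EReal.lt_iff_exists_real_btwn.1 hb
    filter_upwards [usc_ev hΩ hu.1 hxΩ _ hb', hevδ] with ε ⟨hε, hεΩ, hεu⟩ hεδ
    exact (eavg_bounds μ (H ∩ ball x₀ ε) (hSm ε hεδ) u b' (hm0 ε hε hεδ) (hmt ε hεδ)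
      (fun x hx => hεu x (hsmall ε hε hx))
      (usc_aemeas hΩ hu.1 μ ((hsmall ε hε).trans hεΩ))).1.trans_lt hbb

end
end
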